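/- Under assumptions (H0)-(H4) there exists a unique family (\underline v^{ij})_{(i,j)\in\Gamma^1\times\Gamma^2} of continuous functions of polynomial growth on [0,T]\times\mathbb{R}^k that is a viscosity solution of the max-min system of PDEs with bilateral inter-connected obstacles: for every (i,j), max{ v^{ij}-U^{ij}(\vec v) ; min{ v^{ij}-L^{ij}(\vec v) ; -\partial_t v^{ij}-\mathcal{L}^X v^{ij}-f^{ij}(t,x,(v^{kl}(t,x))_{(k,l)},\sigma(t,x)^\top D_x v^{ij}(t,x)) } } = 0 on (0,T)\times\mathbb{R}^k, with terminal condition v^{ij}(T,x)=h^{ij}(x). -/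

import Mathlib

open Set Matrix

noncomputable section

abbrev Euc (k : ℕ) : Type := EuclideanSpace ℝ (Fin k)

/-- Partial derivative in the `i`-th coordinate direction. -/
noncomputable def pd {k : ℕ} (i : Fin k) (ψ : Euc k → ℝ) (x : Euc k) : ℝ :=
  fderiv ℝ ψ x (EuclideanSpace.single i 1)

/-- Time derivative of `φ(t,x)` in `t`. -/
noncomputable def timeDeriv {k : ℕ} (φ : ℝ → Euc k → ℝ) (t : ℝ) (x : Euc k) : ℝ :=
  deriv (fun s => φ s x) t

/-- The second order generator
`𝓛^X φ(t,x) = ½ Tr[σσᵀ(t,x) D²_{xx} φ(t,x)] + b(t,x)ᵀ D_x φ(t,x)`. -/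
noncomputable def genL {k d : ℕ} (b : ℝ → Euc k → Fin k → ℝ)
    (σm : ℝ → Euc k → Matrix (Fin k) (Fin d) ℝ) (φ : ℝ → Euc k → ℝ)
    (t : ℝ) (x : Euc k) : ℝ :=
  (1 / 2) * ∑ i, ∑ j, (σm t x * (σm t x)ᵀ) i j * pd i (fun y => pd j (φ t) y) x
    + ∑ i, b t x i * pd i (φ t) x

/-- `σ(t,x)ᵀ D_x φ(t,x)` as a vector of `ℝ^d`. -/
noncomputable def sigGrad {k d : ℕ} (σm : ℝ → Euc k → Matrix (Fin k) (Fin d) ℝ)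
    (φ : ℝ → Euc k → ℝ) (t : ℝ) (x : Euc k) : Fin d → ℝ :=
  fun l => ∑ i, σm t x i l * pd i (φ t) x

/-- `φ` is of class `C^{1,2}`: once differentiable in `t`, twice in `x`,
with (jointly) continuous derivatives. -/
def IsC12 {k : ℕ} (φ : ℝ → Euc k → ℝ) : Prop :=
  (∀ x, Differentiable ℝ fun s => φ s x) ∧
  Continuous (fun p : ℝ × Euc k => deriv (fun s => φ s p.2) p.1) ∧
  (∀ t, ContDiff ℝ 2 (φ t)) ∧
  Continuous (fun p : ℝ × Euc k => fderiv ℝ (φ p.1) p.2) ∧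
  Continuous (fun p : ℝ × Euc k => fderiv ℝ (fderiv ℝ (φ p.1)) p.2)

/-- Polynomial growth on `[0,T] × ℝ^k`. -/
def PolyGrowth {k : ℕ} (T : ℝ) (Φ : ℝ → Euc k → ℝ) : Prop :=
  ∃ C γ : ℝ, 0 ≤ C ∧ 0 ≤ γ ∧ ∀ t ∈ Icc (0 : ℝ) T, ∀ x : Euc k, |Φ t x| ≤ C * (1 + ‖x‖ ^ γ)

/-- (H0): `b` and `σ` are jointly continuous and Lipschitz in `x` uniformly in `t`. -/
def H0 {k d : ℕ} (T : ℝ) (b : ℝ → Euc k → Fin k → ℝ)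
    (σm : ℝ → Euc k → Matrix (Fin k) (Fin d) ℝ) : Prop :=
  Continuous (fun p : ℝ × Euc k => b p.1 p.2) ∧
  Continuous (fun p : ℝ × Euc k => σm p.1 p.2) ∧
  ∃ C : ℝ, ∀ t ∈ Icc (0 : ℝ) T, ∀ x x' : Euc k,
    (∀ i, |b t x i - b t x' i| ≤ C * ‖x - x'‖) ∧
    (∀ i l, |σm t x i l - σm t x' i l| ≤ C * ‖x - x'‖)


/-- The lower inter-connected obstacle
`L^{ij}(\vec v)(t,x) = max_{kk ∈ Γ¹, kk ≠ i} ( v^{kk j}(t,x) - \underline g_{i kk}(t,x) )`,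
evaluated on the vector `vv = (v^{kl}(t,x))_{(k,l)}` of current values. -/
noncomputable def lowerObst {k : ℕ} {Γ1 Γ2 : Type} [Fintype Γ1] [DecidableEq Γ1]
    [Nontrivial Γ1] (gLow : Γ1 → Γ1 → ℝ → Euc k → ℝ) (i : Γ1) (j : Γ2)
    (t : ℝ) (x : Euc k) (vv : Γ1 × Γ2 → ℝ) : ℝ :=
  Finset.sup' (Finset.univ.erase i)
    (by
      obtain ⟨kk, hkk⟩ := exists_ne i
      exact ⟨kk, Finset.mem_erase.mpr ⟨hkk, Finset.mem_univ kk⟩⟩)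
    (fun kk => vv (kk, j) - gLow i kk t x)

/-- The upper inter-connected obstacle
`U^{ij}(\vec v)(t,x) = min_{l ∈ Γ², l ≠ j} ( v^{il}(t,x) + \bar g_{jl}(t,x) )`. -/
noncomputable def upperObst {k : ℕ} {Γ1 Γ2 : Type} [Fintype Γ2] [DecidableEq Γ2]
    [Nontrivial Γ2] (gUp : Γ2 → Γ2 → ℝ → Euc k → ℝ) (i : Γ1) (j : Γ2)
    (t : ℝ) (x : Euc k) (vv : Γ1 × Γ2 → ℝ) : ℝ :=
  Finset.inf' (Finset.univ.erase j)
    (by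
      obtain ⟨l, hl⟩ := exists_ne j
      exact ⟨l, Finset.mem_erase.mpr ⟨hl, Finset.mem_univ l⟩⟩)
    (fun l => vv (i, l) + gUp j l t x)

/-- Viscosity subsolution of the system of terminal value problems
`F^{ij}(t, x, (v^{kl})_{kl}, ∂_t v^{ij}, 𝓛^X v^{ij}, σᵀ D_x v^{ij}) = 0` on `(0,T) × ℝ^k`
with terminal data `v^{ij}(T,·) = h^{ij}`, in the sense of `C^{1,2}` test functions. -/
def IsViscSubsolSys {k d : ℕ} {Γ : Type} (T : ℝ) (b : ℝ → Euc k → Fin k → ℝ)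
    (σm : ℝ → Euc k → Matrix (Fin k) (Fin d) ℝ) (hterm : Γ → Euc k → ℝ)
    (F : Γ → ℝ → Euc k → (Γ → ℝ) → ℝ → ℝ → (Fin d → ℝ) → ℝ)
    (v : Γ → ℝ → Euc k → ℝ) : Prop :=
  (∀ ij x, v ij T x ≤ hterm ij x) ∧
  ∀ (ij : Γ) (t : ℝ) (x : Euc k), t ∈ Ioo (0 : ℝ) T →
    ∀ φ : ℝ → Euc k → ℝ, IsC12 φ →
      IsLocalMax (fun p : ℝ × Euc k => v ij p.1 p.2 - φ p.1 p.2) (t, x) →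
      v ij t x = φ t x →
      F ij t x (fun kl => v kl t x) (timeDeriv φ t x) (genL b σm φ t x)
        (sigGrad σm φ t x) ≤ 0

/-- Viscosity supersolution of the system. -/
def IsViscSupersolSys {k d : ℕ} {Γ : Type} (T : ℝ) (b : ℝ → Euc k → Fin k → ℝ)
    (σm : ℝ → Euc k → Matrix (Fin k) (Fin d) ℝ) (hterm : Γ → Euc k → ℝ)
    (F : Γ → ℝ → Euc k → (Γ → ℝ) → ℝ → ℝ → (Fin d → ℝ) → ℝ)
    (v : Γ → ℝ → Euc k → ℝ) : Prop :=
  (∀ ij x, hterm ij x ≤ v ij T x) ∧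
  ∀ (ij : Γ) (t : ℝ) (x : Euc k), t ∈ Ioo (0 : ℝ) T →
    ∀ φ : ℝ → Euc k → ℝ, IsC12 φ →
      IsLocalMin (fun p : ℝ × Euc k => v ij p.1 p.2 - φ p.1 p.2) (t, x) →
      v ij t x = φ t x →
      0 ≤ F ij t x (fun kl => v kl t x) (timeDeriv φ t x) (genL b σm φ t x)
        (sigGrad σm φ t x)

/-- Viscosity solution of the system: both a subsolution and a supersolution. -/
def IsViscSolSys {k d : ℕ} {Γ : Type} (T : ℝ) (b : ℝ → Euc k → Fin k → ℝ)
    (σm : ℝ → Euc k → Matrix (Fin k) (Fin d) ℝ) (hterm : Γ → Euc k → ℝ)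
    (F : Γ → ℝ → Euc k → (Γ → ℝ) → ℝ → ℝ → (Fin d → ℝ) → ℝ)
    (v : Γ → ℝ → Euc k → ℝ) : Prop :=
  IsViscSubsolSys T b σm hterm F v ∧ IsViscSupersolSys T b σm hterm F v

/-- The min-max expression of system (1.1):
`min{ v^{ij} - L^{ij}(\vec v) ; max{ v^{ij} - U^{ij}(\vec v) ;
  -∂_t v^{ij} - 𝓛^X v^{ij} - f^{ij}(t,x,\vec v, σᵀ D_x v^{ij}) } }`. -/
noncomputable def FminMax {k d : ℕ} {Γ1 Γ2 : Type} [Fintype Γ1] [Fintype Γ2]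
    [DecidableEq Γ1] [DecidableEq Γ2] [Nontrivial Γ1] [Nontrivial Γ2]
    (f : Γ1 → Γ2 → ℝ → Euc k → ((Γ1 × Γ2) → ℝ) → (Fin d → ℝ) → ℝ)
    (gLow : Γ1 → Γ1 → ℝ → Euc k → ℝ) (gUp : Γ2 → Γ2 → ℝ → Euc k → ℝ) :
    Γ1 × Γ2 → ℝ → Euc k → ((Γ1 × Γ2) → ℝ) → ℝ → ℝ → (Fin d → ℝ) → ℝ :=
  fun ij t x vv dtφ Lφ zφ =>
    min (vv ij - lowerObst gLow ij.1 ij.2 t x vv)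
      (max (vv ij - upperObst gUp ij.1 ij.2 t x vv)
        (-dtφ - Lφ - f ij.1 ij.2 t x vv zφ))

/-- The max-min expression of system (1.2):
`max{ v^{ij} - U^{ij}(\vec v) ; min{ v^{ij} - L^{ij}(\vec v) ;
  -∂_t v^{ij} - 𝓛^X v^{ij} - f^{ij}(t,x,\vec v, σᵀ D_x v^{ij}) } }`. -/
noncomputable def FmaxMin {k d : ℕ} {Γ1 Γ2 : Type} [Fintype Γ1] [Fintype Γ2]
    [DecidableEq Γ1] [DecidableEq Γ2] [Nontrivial Γ1] [Nontrivial Γ2]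
    (f : Γ1 → Γ2 → ℝ → Euc k → ((Γ1 × Γ2) → ℝ) → (Fin d → ℝ) → ℝ)
    (gLow : Γ1 → Γ1 → ℝ → Euc k → ℝ) (gUp : Γ2 → Γ2 → ℝ → Euc k → ℝ) :
    Γ1 × Γ2 → ℝ → Euc k → ((Γ1 × Γ2) → ℝ) → ℝ → ℝ → (Fin d → ℝ) → ℝ :=
  fun ij t x vv dtφ Lφ zφ =>
    max (vv ij - upperObst gUp ij.1 ij.2 t x vv)
      (min (vv ij - lowerObst gLow ij.1 ij.2 t x vv)
        (-dtφ - Lφ - f ij.1 ij.2 t x vv zφ))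

/-- (H4), the non-free-loop property: for every loop in `Γ¹ × Γ²` (a sequence of
pairs `p 0, p 1, …, p M` with `p M = p 0`, the first `M` pairs pairwise distinct,
`M ≥ 2`, and each step leaving at least one coordinate unchanged), the sum
`∑_q φ_{i_q j_q}(t,x)` does not vanish, where
`φ_{i_q j_q} = -\underline g_{i_q i_{q+1}} 1_{i_q ≠ i_{q+1}} + \bar g_{j_q j_{q+1}} 1_{j_q ≠ j_{q+1}}`. -/
def NoFreeLoop {k : ℕ} {Γ1 Γ2 : Type} [DecidableEq Γ1] [DecidableEq Γ2]
    (T : ℝ) (gLow : Γ1 → Γ1 → ℝ → Euc k → ℝ) (gUp : Γ2 → Γ2 → ℝ → Euc k → ℝ) : Prop :=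
  ∀ M : ℕ, 2 ≤ M → ∀ p : ℕ → Γ1 × Γ2,
    p M = p 0 →
    (∀ q q', q < M → q' < M → p q = p q' → q = q') →
    (∀ q < M, (p q).1 = (p (q + 1)).1 ∨ (p q).2 = (p (q + 1)).2) →
    ∀ t ∈ Icc (0 : ℝ) T, ∀ x : Euc k,
      (∑ q ∈ Finset.range M,
        ((if (p q).1 = (p (q + 1)).1 then 0 else -gLow (p q).1 (p (q + 1)).1 t x) +
          (if (p q).2 = (p (q + 1)).2 then 0 else gUp (p q).2 (p (q + 1)).2 t x))) ≠ 0

section Resolvent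

variable {E : Type*} [NormedAddCommGroup E] [InnerProductSpace ℝ E]

open scoped RealInnerProductSpace Topology

/-- `J` is the proximal map (resolvent of the subdifferential) of `φ`. -/
def IsResolvent (φ : E → ℝ) (J : E → E) : Prop :=
  ∀ y z, φ (J y) + ‖J y - y‖ ^ 2 / 2 ≤ φ z + ‖z - y‖ ^ 2 / 2

theorem exists_isResolvent [FiniteDimensional ℝ E] {φ : E → ℝ} (hφ : ConvexOn ℝ univ φ)
    {m : ℝ} (hm : ∀ z, m ≤ φ z) : ∃ J, IsResolvent φ J := by
  have hc : Continuous φ := hφ.locallyLipschitz.continuous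
  have key : ∀ y, ∃ z, ∀ z', φ z + ‖z - y‖ ^ 2 / 2 ≤ φ z' + ‖z' - y‖ ^ 2 / 2 := by
    intro y
    apply Continuous.exists_forall_le (f := fun z => φ z + ‖z - y‖ ^ 2 / 2) (by fun_prop)
    apply Filter.tendsto_atTop_add_left_of_le _ m hm
    have h1 : Filter.Tendsto (fun z : E => ‖z - y‖) (Filter.cocompact E) Filter.atTop := by
      have := tendsto_norm_cocompact_atTop (E := E)
      have h2 := (Homeomorph.subRight y).isClosedEmbedding.tendsto_cocompact
      exact this.comp h2
    exact ((Filter.tendsto_pow_atTop (two_ne_zero)).comp h1).atTop_div_const (by norm_num)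
  choose J hJ using key
  exact ⟨J, hJ⟩

variable {φ : E → ℝ} {J : E → E}

theorem IsResolvent.subgradient (hJ : IsResolvent φ J) (hφ : ConvexOn ℝ univ φ) (y z : E) :
    φ (J y) + ⟪y - J y, z - J y⟫ ≤ φ z := by
  by_contra! hlt
  set d := z - J y with hd
  set c := φ (J y) + ⟪y - J y, d⟫ - φ z with hcdef
  have hc : 0 < c := by linarith
  have key : ∀ s : ℝ, 0 < s → s ≤ 1 → c ≤ s * (‖d‖ ^ 2 / 2) := by
    intro s hs hs1
    have h1 := hJ y (J y + s • d)
    have h2 := hφ.2 (mem_univ (J y)) (mem_univ z) (sub_nonneg.2 hs1) hs.le (by ring)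
    have h3 : (1 - s) • J y + s • z = J y + s • d := by rw [hd]; module
    rw [h3] at h2
    have h4 : ‖J y + s • d - y‖ ^ 2
        = ‖J y - y‖ ^ 2 - 2 * s * ⟪y - J y, d⟫ + s ^ 2 * ‖d‖ ^ 2 := by
      have : J y + s • d - y = s • d - (y - J y) := by abel
      rw [this, norm_sub_sq_real, norm_smul, mul_pow, inner_smul_left, real_inner_comm,
        norm_sub_rev y (J y)]
      simp only [Real.norm_eq_abs, sq_abs, conj_trivial]; ring
    rw [h4] at h1
    simp only [smul_eq_mul] at h2
    have : s * c ≤ s * (s * (‖d‖ ^ 2 / 2)) := by rw [hcdef]; nlinarith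
    exact le_of_mul_le_mul_left this hs
  have hpos : 0 < ‖d‖ ^ 2 / 2 + c := by positivity
  have h5 := key (c / (2 * (‖d‖ ^ 2 / 2 + c))) (by positivity)
    (by rw [div_le_one (by positivity)]; nlinarith [sq_nonneg ‖d‖])
  rw [div_mul_eq_mul_div, le_div_iff₀ (by positivity)] at h5
  nlinarith [sq_nonneg ‖d‖, mul_pos hc hc, mul_nonneg hc.le (sq_nonneg ‖d‖)]

theorem IsResolvent.lipschitz (hJ : IsResolvent φ J) (hφ : ConvexOn ℝ univ φ) :
    LipschitzWith 1 J := by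
  apply LipschitzWith.of_dist_le_mul
  intro y y'
  have h1 := hJ.subgradient hφ y (J y')
  have h2 := hJ.subgradient hφ y' (J y)
  have h3 : ‖J y - J y'‖ ^ 2 ≤ ⟪y - y', J y - J y'⟫ := by
    have e1 : ⟪y - J y, J y' - J y⟫ = - ⟪y - J y, J y - J y'⟫ := by
      rw [← inner_neg_right, neg_sub]
    have e2 : ⟪y - y', J y - J y'⟫ = ⟪y - J y, J y - J y'⟫ - ⟪y' - J y', J y - J y'⟫
        + ⟪J y - J y', J y - J y'⟫ := by
      rw [← inner_sub_left, ← inner_add_left]; congr 1; abel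
    rw [e2, real_inner_self_eq_norm_sq]; linarith
  have h4 := real_inner_le_norm (y - y') (J y - J y')
  rw [dist_eq_norm, dist_eq_norm, NNReal.coe_one, one_mul]
  by_contra! h
  nlinarith [norm_nonneg (y - y'), norm_nonneg (J y - J y')]

/-- The Moreau envelope associated with the resolvent. -/
def moreauEnv (φ : E → ℝ) (J : E → E) (y : E) : ℝ := φ (J y) + ‖J y - y‖ ^ 2 / 2

theorem IsResolvent.env_bound (hJ : IsResolvent φ J) (hφ : ConvexOn ℝ univ φ) (y k : E) :
    |moreauEnv φ J (y + k) - moreauEnv φ J y - ⟪y - J y, k⟫| ≤ ‖k‖ ^ 2 / 2 := by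
  have up : ∀ y k : E, moreauEnv φ J (y + k) ≤ moreauEnv φ J y + ⟪y - J y, k⟫ + ‖k‖ ^ 2 / 2 := by
    intro y k
    have h := hJ (y + k) (J y)
    have e : ‖J y - (y + k)‖ ^ 2 = ‖J y - y‖ ^ 2 + 2 * ⟪y - J y, k⟫ + ‖k‖ ^ 2 := by
      have : J y - (y + k) = -((y - J y) + k) := by abel
      rw [this, norm_neg, norm_add_sq_real, norm_sub_rev y]
    rw [e] at h
    unfold moreauEnv; linarith
  have h1 := up y k
  have h2 := up (y + k) (-k)
  rw [add_neg_cancel_right, norm_neg, inner_neg_right] at h2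
  have h3 : ⟪y + k - J (y + k), k⟫ = ⟪y - J y, k⟫ + ‖k‖ ^ 2 - ⟪J (y + k) - J y, k⟫ := by
    rw [← real_inner_self_eq_norm_sq, ← inner_add_left, ← inner_sub_left]; congr 1; abel
  have h4 := real_inner_le_norm (J (y + k) - J y) k
  have h5 : ‖J (y + k) - J y‖ ≤ ‖k‖ := by
    have := (hJ.lipschitz hφ).dist_le_mul (y + k) y
    rw [dist_eq_norm, dist_eq_norm] at this; simpa using this
  have h6 := mul_le_mul_of_nonneg_right h5 (norm_nonneg k)
  rw [abs_le]; constructor <;> nlinarith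

/-- Second order expansion of the Moreau envelope where the resolvent is differentiable. -/
theorem IsResolvent.env_expansion (hJ : IsResolvent φ J) (hφ : ConvexOn ℝ univ φ) {y : E}
    {A : E →L[ℝ] E} (hA : HasFDerivAt J A y) {ε : ℝ} (hε : 0 < ε) :
    ∀ᶠ k in 𝓝 (0 : E), |moreauEnv φ J (y + k) - moreauEnv φ J y - ⟪y - J y, k⟫
      - (‖k‖ ^ 2 - ⟪A k, k⟫) / 2| ≤ ε * ‖k‖ ^ 2 := by
  have h1 := hA.isLittleO
  have h2 : ∀ᶠ k in 𝓝 (0 : E), ‖J (y + k) - J y - A k‖ ≤ ε * ‖k‖ := by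
    have := (hasFDerivAt_iff_isLittleO_nhds_zero.1 hA).def hε
    simpa using this
  obtain ⟨ρ, hρ, hb⟩ := Metric.eventually_nhds_iff_ball.1 h2
  refine Metric.eventually_nhds_iff_ball.2 ⟨ρ, hρ, fun k hk => ?_⟩
  have hk' : ‖k‖ < ρ := by simpa using hk
  let g : ℝ → ℝ := fun s => moreauEnv φ J (y + s • k) - s * ⟪y - J y, k⟫
      - s ^ 2 * ((‖k‖ ^ 2 - ⟪A k, k⟫) / 2)
  have hder : ∀ s, HasDerivAt g (-⟪J (y + s • k) - J y - A (s • k), k⟫) s := by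
    intro s
    have he : HasDerivAt (fun s : ℝ => moreauEnv φ J (y + s • k))
        ⟪y + s • k - J (y + s • k), k⟫ s := by
      rw [hasDerivAt_iff_isLittleO_nhds_zero]
      have : (fun r : ℝ => moreauEnv φ J (y + (s + r) • k) - moreauEnv φ J (y + s • k)
          - r • ⟪y + s • k - J (y + s • k), k⟫) =O[𝓝 0] fun r : ℝ => r ^ 2 := by
        refine Asymptotics.IsBigO.of_bound (‖k‖ ^ 2 / 2) (Filter.Eventually.of_forall fun r => ?_)
        have := hJ.env_bound hφ (y + s • k) (r • k)
        rw [add_assoc, ← add_smul, inner_smul_right, norm_smul, mul_pow] at this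
        simp only [Real.norm_eq_abs, sq_abs, smul_eq_mul] at this ⊢
        rw [abs_pow, sq_abs]; linarith
      refine this.trans_isLittleO ?_
      simpa using Asymptotics.isLittleO_pow_pow (𝕜 := ℝ) (m := 1) (n := 2) (by norm_num)
    have hd := (he.sub ((hasDerivAt_id s).mul_const ⟪y - J y, k⟫)).sub
      ((hasDerivAt_pow 2 s).mul_const ((‖k‖ ^ 2 - ⟪A k, k⟫) / 2))
    refine hd.congr_deriv ?_
    have e : y + s • k - J (y + s • k) = (y - J y) + s • k - (J (y + s • k) - J y - A (s • k))
        - s • A k := by rw [map_smul]; abel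
    rw [e, inner_sub_left, inner_sub_left, inner_add_left, inner_smul_left, inner_smul_left,
      real_inner_self_eq_norm_sq]
    simp; ring
  have hbd : ∀ s ∈ Icc (0 : ℝ) 1, ‖-⟪J (y + s • k) - J y - A (s • k), k⟫‖ ≤ ε * ‖k‖ ^ 2 := by
    intro s hs
    have hsk : ‖s • k‖ ≤ ‖k‖ := by
      rw [norm_smul, Real.norm_eq_abs, abs_of_nonneg hs.1]
      exact mul_le_of_le_one_left (norm_nonneg _) hs.2
    have h3 := hb (s • k) (by simpa using hsk.trans_lt hk')
    have h4 := abs_real_inner_le_norm (J (y + s • k) - J y - A (s • k)) k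
    rw [norm_neg, Real.norm_eq_abs]
    calc _ ≤ _ := h4
      _ ≤ (ε * ‖s • k‖) * ‖k‖ := by gcongr
      _ ≤ (ε * ‖k‖) * ‖k‖ := by gcongr
      _ = _ := by ring
  have := (convex_Icc (0 : ℝ) 1).norm_image_sub_le_of_norm_hasDerivWithin_le
    (fun s _ => (hder s).hasDerivWithinAt) hbd (left_mem_Icc.2 zero_le_one)
    (right_mem_Icc.2 zero_le_one)
  simp only [g] at this
  simp only [one_smul, zero_smul, add_zero, Real.norm_eq_abs] at this
  rw [sub_zero, abs_one, mul_one] at this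
  refine le_trans (le_of_eq ?_) this
  congr 1; ring


theorem IsResolvent.expansive_of_touch (hJ : IsResolvent φ J) (hφ : ConvexOn ℝ univ φ) {y : E}
    {r c : ℝ} (hc : 0 ≤ c)
    (hup : ∀ h, ‖h‖ < r → φ (J y + h) ≤ φ (J y) + ⟪y - J y, h⟫ + c * ‖h‖ ^ 2) {y' : E}
    (hy' : ‖J y' - J y‖ < r / 2) : ‖y' - y‖ ≤ (1 + 4 * c) * ‖J y' - J y‖ := by
  set δ := J y' - J y with hδ
  set q := (y' - J y') - (y - J y) with hq
  have hyq : y' - y = q + δ := by rw [hq, hδ]; abel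
  have key : ‖q‖ ≤ 4 * c * ‖δ‖ := by
    have main : ∀ k : E, ‖k‖ ≤ ‖δ‖ → ⟪q, k⟫ ≤ c * (2 * ‖δ‖) ^ 2 := by
      intro k hk
      have hn : ‖δ + k‖ ≤ 2 * ‖δ‖ := (norm_add_le _ _).trans (by linarith)
      have h1 := hup (δ + k) (by linarith)
      have h2 := hJ.subgradient hφ y' (J y' + k)
      have h3 := hJ.subgradient hφ y (J y')
      have e : J y + (δ + k) = J y' + k := by rw [hδ]; abel
      rw [e] at h1
      rw [add_sub_cancel_left] at h2
      rw [← hδ] at h3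
      have h4 : c * ‖δ + k‖ ^ 2 ≤ c * (2 * ‖δ‖) ^ 2 := by gcongr
      rw [hq, inner_sub_left]
      rw [inner_add_right] at h1
      linarith
    rcases eq_or_ne q 0 with h0 | h0
    · rw [h0, norm_zero]; positivity
    have hqpos : 0 < ‖q‖ := norm_pos_iff.2 h0
    rcases eq_or_ne δ 0 with hd0 | hd0
    · have h1 := hJ.subgradient hφ y' (J y')
      have hJe : J y' = J y := sub_eq_zero.1 hd0
      exfalso
      have hr : 0 < r := by rw [hd0, norm_zero] at hy'; linarith
      have h5 : ∀ s : ℝ, 0 < s → s * ‖q‖ < r → s * ‖q‖ ^ 2 ≤ c * (s * ‖q‖) ^ 2 := by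
        intro s hs hsr
        have hns : ‖s • q‖ = s * ‖q‖ := by rw [norm_smul, Real.norm_eq_abs, abs_of_pos hs]
        have h1 := hup (s • q) (by rwa [hns])
        have h2 := hJ.subgradient hφ y' (J y' + s • q)
        rw [add_sub_cancel_left, hJe] at h2
        have h6 : ⟪q, s • q⟫ = ⟪y' - J y, s • q⟫ - ⟪y - J y, s • q⟫ := by
          rw [← inner_sub_left, hq, hJe]
        rw [inner_smul_right q q, real_inner_self_eq_norm_sq] at h6
        rw [hns] at h1
        linarith
      have hs0 : 0 < min (r / (2 * ‖q‖)) (1 / (2 * (c + 1))) := by positivity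
      set s := min (r / (2 * ‖q‖)) (1 / (2 * (c + 1)))
      have hs1 : s ≤ r / (2 * ‖q‖) := min_le_left _ _
      have hs2 : s ≤ 1 / (2 * (c + 1)) := min_le_right _ _
      rw [le_div_iff₀ (by positivity)] at hs1 hs2
      have h7 := h5 s hs0 (by nlinarith)
      have h8 : s * ‖q‖ ^ 2 * (1 - c * s) ≤ 0 := by nlinarith
      have h9 : 0 < s * ‖q‖ ^ 2 * (1 - c * s) := by
        apply mul_pos (by positivity); nlinarith
      linarith
    · have hdpos : 0 < ‖δ‖ := norm_pos_iff.2 hd0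
      have h1 := main ((‖δ‖ / ‖q‖) • q) (by
        rw [norm_smul, Real.norm_eq_abs, abs_of_pos (by positivity), div_mul_cancel₀ _ hqpos.ne'])
      rw [inner_smul_right, real_inner_self_eq_norm_sq] at h1
      have h2 : ‖δ‖ / ‖q‖ * ‖q‖ ^ 2 = ‖δ‖ * ‖q‖ := by field_simp
      rw [h2] at h1
      have h3 : ‖δ‖ * ‖q‖ ≤ ‖δ‖ * (4 * c * ‖δ‖) := by nlinarith
      exact le_of_mul_le_mul_left h3 hdpos
  rw [hyq]
  have := norm_add_le q δ
  linarith

set_option maxHeartbeats 1000000 in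
theorem IsResolvent.second_order_expansion [FiniteDimensional ℝ E] (hJ : IsResolvent φ J)
    (hφ : ConvexOn ℝ univ φ) {y : E} {A : E →L[ℝ] E} (hA : HasFDerivAt J A y)
    {r c : ℝ} (hr : 0 < r) (hc : 0 ≤ c)
    (hup : ∀ h, ‖h‖ < r → φ (J y + h) ≤ φ (J y) + ⟪y - J y, h⟫ + c * ‖h‖ ^ 2) :
    ∃ B : E →L[ℝ] E, ∀ ε > 0, ∀ᶠ h in 𝓝 (0 : E),
      |φ (J y + h) - φ (J y) - ⟪y - J y, h⟫ - ⟪B h, h⟫ / 2| ≤ ε * ‖h‖ ^ 2 := by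
  have hlip := hJ.lipschitz hφ
  have hlit := hasFDerivAt_iff_isLittleO_nhds_zero.1 hA
  have hlit' : ∀ ε > 0, ∀ᶠ k in 𝓝 (0 : E), ‖J (y + k) - J y - A k‖ ≤ ε * ‖k‖ := by
    intro ε hε
    simpa using hlit.def hε
  have hinj : Function.Injective A := by
    rw [injective_iff_map_eq_zero]
    intro k hk
    by_contra hk0
    have hkpos : 0 < ‖k‖ := norm_pos_iff.2 hk0
    obtain ⟨ρ, hρ, hb⟩ := Metric.eventually_nhds_iff_ball.1 (hlit' (1 / (2 * (1 + 4 * c)))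
      (by positivity))
    set s := min (ρ / 2) (r / 4) / ‖k‖ with hs
    have hs0 : 0 < s := by positivity
    have hsk : ‖s • k‖ = min (ρ / 2) (r / 4) := by
      rw [norm_smul, Real.norm_eq_abs, abs_of_pos hs0, hs, div_mul_cancel₀ _ hkpos.ne']
    have hpos : 0 < ‖s • k‖ := by rw [hsk]; positivity
    have h1 := hb (s • k) (by
      rw [mem_ball_zero_iff, hsk]; exact (min_le_left _ _).trans_lt (by linarith))
    rw [map_smul, hk, smul_zero, sub_zero] at h1
    have h2 : ‖J (y + s • k) - J y‖ < r / 2 := by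
      have := hlip.dist_le_mul (y + s • k) y
      rw [dist_eq_norm, dist_eq_norm] at this
      simp only [NNReal.coe_one, one_mul, add_sub_cancel_left] at this
      have h3 : ‖s • k‖ ≤ r / 4 := hsk ▸ min_le_right _ _
      linarith
    have h3 := hJ.expansive_of_touch hφ hc hup h2
    rw [add_sub_cancel_left] at h3
    have h4 : (1 + 4 * c) * ‖J (y + s • k) - J y‖ ≤ (1 + 4 * c) *
      (1 / (2 * (1 + 4 * c)) * ‖s • k‖) := by gcongr
    have h5 : (1 + 4 * c) * (1 / (2 * (1 + 4 * c)) * ‖s • k‖) = ‖s • k‖ / 2 := by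
      field_simp
    linarith
  let Ae : E ≃ₗ[ℝ] E := LinearEquiv.ofInjectiveEndo (A : E →ₗ[ℝ] E) hinj
  let B : E →L[ℝ] E := LinearMap.toContinuousLinearMap (Ae.symm : E →ₗ[ℝ] E)
  have hAB : ∀ h, A (B h) = h := fun h => Ae.apply_symm_apply h
  refine ⟨B - ContinuousLinearMap.id ℝ E, fun ε hε => ?_⟩
  set C := ‖B‖ + 1 with hC
  have hC1 : 1 ≤ C := by have := norm_nonneg B; linarith
  set D := 2 * C ^ 2 + 2 * C + 16 * c * C with hD
  have hD0 : 0 < D := by positivity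
  set ε1 := min (ε / D) (1 / (2 * C)) with hε1
  have hε1pos : 0 < ε1 := by positivity
  have hε1D : ε1 * D ≤ ε := by
    have : ε1 ≤ ε / D := min_le_left _ _
    rwa [le_div_iff₀ hD0] at this
  have hε1C : ε1 * C ≤ 1 / 2 := by
    have : ε1 ≤ 1 / (2 * C) := min_le_right _ _
    rw [le_div_iff₀ (by linarith)] at this
    linarith
  have hBt : Filter.Tendsto B (𝓝 0) (𝓝 0) := by simpa using B.continuous.tendsto 0
  have hev1 := hBt.eventually (hJ.env_expansion hφ hA hε1pos)
  have hev2 := hBt.eventually (hlit' ε1 hε1pos)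
  have hev3 : ∀ᶠ h in 𝓝 (0 : E), ‖h‖ < r / 4 := by
    have : Metric.ball (0 : E) (r / 4) ∈ 𝓝 (0 : E) := Metric.ball_mem_nhds _ (by linarith)
    filter_upwards [this] with h hh using by simpa using hh
  filter_upwards [hev1, hev2, hev3] with h h1 h2 h3
  rcases eq_or_ne h 0 with h0 | h0
  · simp [h0]
  have hhpos : 0 < ‖h‖ := norm_pos_iff.2 h0
  set k := B h with hk
  have hAk : A k = h := hAB h
  rw [hAk] at h1 h2
  have hkn : ‖k‖ ≤ C * ‖h‖ := by
    have := B.le_opNorm h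
    rw [hC]; nlinarith
  have hk2 : ε1 * ‖k‖ ^ 2 ≤ ε1 * C ^ 2 * ‖h‖ ^ 2 := by
    have : ‖k‖ ^ 2 ≤ (C * ‖h‖) ^ 2 := by gcongr
    nlinarith
  set p := y - J y with hp
  set z := J y with hz
  set h' := J (y + k) - z with hh'
  have hd : ‖h' - h‖ ≤ ε1 * C * ‖h‖ := by
    calc _ ≤ ε1 * ‖k‖ := h2
      _ ≤ ε1 * (C * ‖h‖) := by gcongr
      _ = _ := by ring
  have hd1 : ‖h' - h‖ < ‖h‖ := by
    have := mul_le_mul_of_nonneg_right hε1C hhpos.le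
    linarith
  have hey : moreauEnv φ J y = φ z + ‖p‖ ^ 2 / 2 := by
    rw [moreauEnv, hp, norm_sub_rev]
  have hBq : ⟪(B - ContinuousLinearMap.id ℝ E) h, h⟫ = ⟪h, k⟫ - ‖h‖ ^ 2 := by
    simp only [_root_.sub_apply, ContinuousLinearMap.id_apply, inner_sub_left,
      real_inner_self_eq_norm_sq]
    rw [← hk, real_inner_comm]
  rw [hBq]
  rw [hey] at h1
  obtain ⟨h1l, h1u⟩ := abs_le.1 h1
  have expand : ∀ g : E, ‖z + g - (y + k)‖ ^ 2
      = ‖p‖ ^ 2 - 2 * (⟪p, g⟫ - ⟪p, k⟫) + (‖g‖ ^ 2 - 2 * ⟪g, k⟫ + ‖k‖ ^ 2) := by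
    intro g
    have : z + g - (y + k) = (g - k) - p := by rw [hp]; abel
    rw [this, norm_sub_sq_real (g - k) p, norm_sub_sq_real g k, inner_sub_left,
      real_inner_comm p g, real_inner_comm p k]
    ring
  have lower := hJ (y + k) (z + h)
  rw [expand h] at lower
  have hle : moreauEnv φ J (y + k) = φ (z + h') + ‖z + h' - (y + k)‖ ^ 2 / 2 := by
    rw [moreauEnv, hh', add_sub_cancel]
  have hle2 := hle
  rw [expand h'] at hle2
  have lower' : moreauEnv φ J (y + k) ≤ _ := lower
  -- Lipschitz estimate for `φ` minus its affine part
  let ψ : E → ℝ := fun x => φ x - φ z - ⟪p, x - z⟫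
  have hψ : ConvexOn ℝ univ ψ := by
    have hl : ConcaveOn ℝ univ (fun x : E => φ z + ⟪p, x - z⟫) := by
      refine ⟨convex_univ, fun x _ x' _ a b ha hb hab => le_of_eq ?_⟩
      have : a • x + b • x' - z = a • (x - z) + b • (x' - z) := by
        have : z = a • z + b • z := by rw [← add_smul, hab, one_smul]
        nth_rw 1 [this]; module
      simp only [this, inner_add_right, inner_smul_right, smul_eq_mul]
      linear_combination φ z * hab
    have := hφ.sub hl
    refine this.congr fun x _ => ?_
    simp only [ψ, Pi.sub_apply]; ring
  have hψb : ∀ a, dist a z < 4 * ‖h‖ → |ψ a| ≤ c * (4 * ‖h‖) ^ 2 := by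
    intro a ha
    rw [dist_eq_norm] at ha
    have h5 := hup (a - z) (by linarith)
    have h6 := hJ.subgradient hφ y a
    rw [add_sub_cancel] at h5
    have h7 : c * ‖a - z‖ ^ 2 ≤ c * (4 * ‖h‖) ^ 2 := by gcongr
    rw [abs_le]; simp only [ψ]
    constructor
    · have : 0 ≤ c * (4 * ‖h‖) ^ 2 := by positivity
      linarith
    · linarith
  have hL := (hψ.subset (subset_univ _) (convex_ball z (4 * ‖h‖))).lipschitzOnWith_of_abs_le
    (ε := 2 * ‖h‖) (by positivity) hψb
  have hrad : 4 * ‖h‖ - 2 * ‖h‖ = 2 * ‖h‖ := by ring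
  have hL2 := hL.dist_le_mul (z + h) (by
      rw [hrad, Metric.mem_ball, dist_eq_norm, add_sub_cancel_left]; linarith) (z + h') (by
      rw [hrad, Metric.mem_ball, dist_eq_norm, add_sub_cancel_left]
      have e1 : h' = h + (h' - h) := by abel
      have : ‖h'‖ ≤ ‖h‖ + ‖h' - h‖ := by nth_rw 1 [e1]; exact norm_add_le _ _
      linarith)
  have hK : ((2 * (c * (4 * ‖h‖) ^ 2) / (2 * ‖h‖)).toNNReal : ℝ) = 16 * c * ‖h‖ := by
    rw [Real.coe_toNNReal _ (by positivity)]; field_simp; ring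
  rw [hK, dist_eq_norm, dist_eq_norm, Real.norm_eq_abs, add_sub_add_left_eq_sub,
    norm_sub_rev h h'] at hL2
  have hL3 : |ψ (z + h) - ψ (z + h')| ≤ 16 * c * ‖h‖ * (ε1 * C * ‖h‖) :=
    hL2.trans (by gcongr)
  obtain ⟨-, hL4⟩ := abs_le.1 hL3
  simp only [ψ, add_sub_cancel_left] at hL4
  have hin : ⟪h' - h, k⟫ ≤ ε1 * C * ‖h‖ * (C * ‖h‖) :=
    (real_inner_le_norm _ _).trans (by gcongr)
  rw [inner_sub_left] at hin
  have hsq : ‖h‖ ^ 2 - ‖h'‖ ^ 2 ≤ ε1 * C * ‖h‖ * (2 * ‖h‖) := by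
    have e1 : h' = h + (h' - h) := by abel
    have e2 : ‖h'‖ ^ 2 = ‖h‖ ^ 2 + 2 * ⟪h, h' - h⟫ + ‖h' - h‖ ^ 2 := by
      nth_rw 1 [e1]; exact norm_add_sq_real _ _
    have e3 := (abs_le.1 (abs_real_inner_le_norm h (h' - h))).1
    have e4 : ‖h‖ * ‖h' - h‖ ≤ ‖h‖ * (ε1 * C * ‖h‖) := by gcongr
    nlinarith [sq_nonneg ‖h' - h‖]
  have hfin : ε1 * (2 * C ^ 2 + 2 * C + 16 * c * C) * ‖h‖ ^ 2 ≤ ε * ‖h‖ ^ 2 := by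
    gcongr
  have hpos1 : 0 ≤ ε1 * C ^ 2 * ‖h‖ ^ 2 := by positivity
  have hpos2 : 0 ≤ ε1 * C * ‖h‖ ^ 2 := by positivity
  have hpos3 : 0 ≤ ε1 * (c * C) * ‖h‖ ^ 2 := by positivity
  rw [abs_le]
  constructor
  · nlinarith
  · nlinarith

end Resolvent

section Jensen

variable {E : Type*} [NormedAddCommGroup E] [InnerProductSpace ℝ E]

open scoped RealInnerProductSpace Topology

theorem ConvexOn.subgradient_of_touch {φ : E → ℝ} (hφ : ConvexOn ℝ univ φ) {z q : E} {r C : ℝ}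
    (hr : 0 < r) (hup : ∀ h, ‖h‖ < r → φ (z + h) ≤ φ z + ⟪q, h⟫ + C * ‖h‖ ^ 2) (h : E) :
    φ z + ⟪q, h⟫ ≤ φ (z + h) := by
  have key : ∀ s : ℝ, 0 < s → s * ‖h‖ < r → φ z + ⟪q, h⟫ - φ (z + h) ≤ s * (C * ‖h‖ ^ 2) := by
    intro s hs hsr
    have hn : ‖-(s • h)‖ = s * ‖h‖ := by rw [norm_neg, norm_smul, Real.norm_eq_abs, abs_of_pos hs]
    have h1 := hup (-(s • h)) (by rwa [hn])
    rw [hn, inner_neg_right, inner_smul_right] at h1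
    have h2 := hφ.2 (mem_univ (z + -(s • h))) (mem_univ (z + h)) 
      (show (0 : ℝ) ≤ 1 / (1 + s) by positivity) (show (0 : ℝ) ≤ s / (1 + s) by positivity)
      (by field_simp)
    have e : (1 / (1 + s)) • (z + -(s • h)) + (s / (1 + s)) • (z + h) = z := by
      have : (1 / (1 + s)) * s = s / (1 + s) := by ring
      rw [smul_add, smul_add, smul_neg, smul_smul, this]
      have e2 : (1 / (1 + s)) • z + (s / (1 + s)) • z = z := by
        rw [← add_smul]; convert one_smul ℝ z; field_simp
      nth_rw 3 [← e2]; abel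
    rw [e] at h2
    simp only [smul_eq_mul] at h2
    have h3 : (1 + s) * φ z ≤ φ (z + -(s • h)) + s * φ (z + h) := by
      have := mul_le_mul_of_nonneg_left h2 (by positivity : 0 ≤ 1 + s)
      refine this.trans (le_of_eq ?_); field_simp
    have : s * (φ z + ⟪q, h⟫ - φ (z + h)) ≤ s * (s * (C * ‖h‖ ^ 2)) := by nlinarith
    exact le_of_mul_le_mul_left this hs
  have hev : ∀ᶠ s in 𝓝[>] (0 : ℝ), φ z + ⟪q, h⟫ - φ (z + h) ≤ s * (C * ‖h‖ ^ 2) := by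
    have h1 : ∀ᶠ s in 𝓝 (0 : ℝ), s * ‖h‖ < r := by
      have : Continuous fun s : ℝ => s * ‖h‖ := by fun_prop
      exact this.continuousAt.eventually_lt continuousAt_const (by simpa using hr)
    filter_upwards [self_mem_nhdsWithin, nhdsWithin_le_nhds h1] with s hs hs2 using key s hs hs2
  have ht : Filter.Tendsto (fun s : ℝ => s * (C * ‖h‖ ^ 2)) (𝓝[>] 0) (𝓝 (0 * (C * ‖h‖ ^ 2))) :=
    ((continuous_id.mul continuous_const).tendsto 0).mono_left nhdsWithin_le_nhds
  have := ge_of_tendsto ht hev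
  linarith

theorem IsResolvent.eq_of_subgradient {φ : E → ℝ} {J : E → E} (hJ : IsResolvent φ J) {z q : E}
    (hq : ∀ h, φ z + ⟪q, h⟫ ≤ φ (z + h)) : J (z + q) = z := by
  have h1 := hJ (z + q) z
  have h2 := hq (J (z + q) - z)
  rw [add_sub_cancel] at h2
  have h3 : ‖J (z + q) - (z + q)‖ ^ 2 = ‖J (z + q) - z‖ ^ 2 - 2 * ⟪q, J (z + q) - z⟫ + ‖q‖ ^ 2 := by
    rw [← sub_sub, norm_sub_sq_real, real_inner_comm]
  rw [h3, sub_add_cancel_left, norm_neg] at h1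
  have h4 : ‖J (z + q) - z‖ ^ 2 ≤ 0 := by linarith
  have h5 : ‖J (z + q) - z‖ = 0 := by nlinarith [norm_nonneg (J (z + q) - z)]
  exact sub_eq_zero.1 (norm_eq_zero.1 h5)

/-- If `Θ y = y - a J y` maps some point of every fibre onto a ball and `J` is nonexpansive, then
one of those points is a point of differentiability of `J`. -/
theorem exists_differentiableAt_of_lipschitz_cover [FiniteDimensional ℝ E] {J Θ : E → E}
    (hJ : LipschitzWith 1 J) {K : NNReal} (hΘ : LipschitzWith K Θ) {r : ℝ} (hr : 0 < r)
    (Y : E → E) (hY : ∀ p, ‖p‖ < r → Θ (Y p) = p) :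
    ∃ p, ‖p‖ < r ∧ DifferentiableAt ℝ J (Y p) := by
  borelize E
  by_contra! hcon
  have hμ : (MeasureTheory.Measure.hausdorffMeasure (Module.finrank ℝ E : ℝ) :
      MeasureTheory.Measure E).IsAddHaarMeasure :=
    MeasureTheory.isAddHaarMeasure_hausdorffMeasure
  set μ : MeasureTheory.Measure E := MeasureTheory.Measure.hausdorffMeasure (Module.finrank ℝ E : ℝ)
  have h0 : μ {y | ¬ DifferentiableAt ℝ J y} = 0 := by
    have := hJ.ae_differentiableAt (μ := μ)
    exact this
  have h1 : Metric.ball (0 : E) r ⊆ Θ '' {y | ¬ DifferentiableAt ℝ J y} := by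
    intro p hp
    have hp' : ‖p‖ < r := by simpa using hp
    exact ⟨Y p, hcon p hp', hY p hp'⟩
  have h2 : μ (Θ '' {y | ¬ DifferentiableAt ℝ J y}) = 0 := by
    have := hΘ.hausdorffMeasure_image_le (d := (Module.finrank ℝ E : ℝ)) (by positivity)
      {y | ¬ DifferentiableAt ℝ J y}
    change _ ≤ _ * μ _ at this
    rw [h0, mul_zero] at this
    exact le_antisymm this (zero_le)
  have h3 := MeasureTheory.measure_mono_null h1 h2
  have h4 := Metric.measure_ball_pos μ (0 : E) hr
  exact h4.ne' h3

/-- **Jensen's lemma** combined with Aleksandrov's theorem at the points it produces. -/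
theorem exists_second_order_point_near_max [FiniteDimensional ℝ E] {G : E → ℝ} {c m : ℝ}
    (hc : 0 ≤ c) (hconv : ConvexOn ℝ univ fun z => G z + c * ‖z‖ ^ 2)
    (hm : ∀ z, m ≤ G z + c * ‖z‖ ^ 2) (hmax : ∀ z, G z ≤ G 0) {δ : ℝ} (hδ : 0 < δ) :
    ∃ (z p : E) (B : E →L[ℝ] E), ‖z‖ < δ ∧ ‖p‖ < δ ∧
      (∀ᶠ h in 𝓝 (0 : E), G (z + h) ≤ G z + ⟪p, h⟫ + δ * ‖h‖ ^ 2) ∧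
      ∀ ε > 0, ∀ᶠ h in 𝓝 (0 : E),
        |G (z + h) - G z - ⟪p, h⟫ - ⟪B h, h⟫ / 2| ≤ ε * ‖h‖ ^ 2 := by
  obtain ⟨J, hJ⟩ := exists_isResolvent hconv hm
  set φ : E → ℝ := fun z => G z + c * ‖z‖ ^ 2 with hφ
  have hφc : Continuous φ := hconv.locallyLipschitz.continuous
  have hGc : Continuous G := by
    have : G = fun z => φ z - c * ‖z‖ ^ 2 := by ext z; simp [hφ]
    rw [this]; fun_prop
  set ρ := min δ (1 / 3) with hρ
  have hρ0 : 0 < ρ := by positivity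
  have hρδ : ρ ≤ δ := min_le_left _ _
  have hρ3 : ρ ≤ 1 / 3 := min_le_right _ _
  have hex : ∀ p : E, ‖p‖ < δ * ρ → ∃ z, ‖z‖ < ρ ∧ ∀ w, ‖w‖ ≤ ρ →
      G w - δ * ‖w‖ ^ 2 - ⟪p, w⟫ ≤ G z - δ * ‖z‖ ^ 2 - ⟪p, z⟫ := by
    intro p hp
    obtain ⟨z, hz, hzmax⟩ := (isCompact_closedBall (0 : E) ρ).exists_isMaxOn
      ⟨0, Metric.mem_closedBall_self hρ0.le⟩
      (f := fun w => G w - δ * ‖w‖ ^ 2 - ⟪p, w⟫) (by fun_prop)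
    have hz' : ‖z‖ ≤ ρ := by simpa using hz
    refine ⟨z, lt_of_le_of_ne hz' fun he => ?_, fun w hw => hzmax (by simpa using hw)⟩
    have h1 : G 0 ≤ G z - δ * ‖z‖ ^ 2 - ⟪p, z⟫ := by
      have := hzmax (Metric.mem_closedBall_self (x := (0 : E)) hρ0.le)
      simpa using this
    have h2 := hmax z
    have h3 := (abs_le.1 (abs_real_inner_le_norm p z)).1
    rw [he] at h1 h3
    nlinarith
  choose! Z hZ1 hZ2 using hex
  have hZloc : ∀ p, ‖p‖ < δ * ρ → ∀ h, ‖h‖ < ρ - ‖Z p‖ →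
      G (Z p + h) ≤ G (Z p) + ⟪p + (2 * δ) • Z p, h⟫ + δ * ‖h‖ ^ 2 := by
    intro p hp h hh
    have h1 := hZ2 p hp (Z p + h) ((norm_add_le _ _).trans (by linarith))
    rw [norm_add_sq_real, inner_add_right] at h1
    rw [inner_add_left, inner_smul_left]
    simp only [conj_trivial]
    linarith
  set a := 1 + 2 * (δ + c) with ha
  have ha0 : 0 < a := by positivity
  have hup : ∀ p, ‖p‖ < δ * ρ → ∀ h, ‖h‖ < ρ - ‖Z p‖ →
      φ (Z p + h) ≤ φ (Z p) + ⟪p + (2 * (δ + c)) • Z p, h⟫ + (δ + c) * ‖h‖ ^ 2 := by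
    intro p hp h hh
    have h1 := hZloc p hp h hh
    simp only [hφ]
    rw [norm_add_sq_real]
    rw [inner_add_left, inner_smul_left] at h1 ⊢
    simp only [conj_trivial] at h1 ⊢
    linarith
  have hJZ : ∀ p, ‖p‖ < δ * ρ → J (Z p + (p + (2 * (δ + c)) • Z p)) = Z p := by
    intro p hp
    exact hJ.eq_of_subgradient fun h => hconv.subgradient_of_touch
      (sub_pos.2 (hZ1 p hp)) (hup p hp) h
  have hJl := hJ.lipschitz hconv
  have hΘ : LipschitzWith (1 + ‖a‖₊ * 1) fun y => y - a • J y :=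
    LipschitzWith.id.sub ((lipschitzWith_smul a).comp hJl)
  obtain ⟨p, hp, A, hA⟩ := exists_differentiableAt_of_lipschitz_cover hJl hΘ
    (by positivity : 0 < δ * ρ) (fun p => Z p + (p + (2 * (δ + c)) • Z p)) (by
      intro p hp
      simp only [hJZ p hp, ha]
      module)
  have hJp := hJZ p hp
  set y := Z p + (p + (2 * (δ + c)) • Z p) with hy
  have hyJ : y - J y = p + (2 * (δ + c)) • Z p := by rw [hJp, hy]; abel
  obtain ⟨B, hB⟩ := hJ.second_order_expansion hconv hA (sub_pos.2 (hZ1 p hp))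
    (by positivity : 0 ≤ δ + c) (by rw [hyJ, hJp]; exact hup p hp)
  rw [hyJ, hJp] at hB
  refine ⟨Z p, p + (2 * δ) • Z p, B - (2 * c) • ContinuousLinearMap.id ℝ E,
    (hZ1 p hp).trans_le hρδ, ?_, ?_, fun ε hε => ?_⟩
  · have h1 := norm_add_le p ((2 * δ) • Z p)
    rw [norm_smul, Real.norm_eq_abs, abs_of_pos (by positivity)] at h1
    have h2 := hZ1 p hp
    nlinarith
  · have : Metric.ball (0 : E) (ρ - ‖Z p‖) ∈ 𝓝 (0 : E) :=
      Metric.ball_mem_nhds _ (sub_pos.2 (hZ1 p hp))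
    filter_upwards [this] with h hh
    exact hZloc p hp h (by simpa using hh)
  · filter_upwards [hB ε hε] with h hh
    refine le_trans (le_of_eq ?_) hh
    congr 1
    simp only [hφ, _root_.sub_apply, _root_.smul_apply, ContinuousLinearMap.id_apply,
      inner_sub_left, inner_add_left, inner_smul_left, real_inner_self_eq_norm_sq,
      norm_add_sq_real, conj_trivial]
    ring

end Jensen

section Sums

variable {E : Type*} [NormedAddCommGroup E] [InnerProductSpace ℝ E]

open scoped RealInnerProductSpace Topology

/-- `Uh` is the sup-convolution of `U` over the closed ball of radius `r`, attained at `Ξ`. -/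
structure IsSupConv (U : E → ℝ) (r α : ℝ) (Uh : E → ℝ) (Ξ : E → E) : Prop where
  mem : ∀ x, ‖Ξ x‖ ≤ r
  eq : ∀ x, Uh x = U (Ξ x) - 2 * α * ‖x - Ξ x‖ ^ 2
  le : ∀ x ξ, ‖ξ‖ ≤ r → U ξ - 2 * α * ‖x - ξ‖ ^ 2 ≤ Uh x

theorem exists_isSupConv [FiniteDimensional ℝ E] {U : E → ℝ} {r : ℝ} (hr : 0 < r) (α : ℝ)
    (hU : UpperSemicontinuousOn U (Metric.closedBall 0 r)) :
    ∃ Uh Ξ, IsSupConv U r α Uh Ξ := by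
  have key : ∀ x, ∃ ξ, ‖ξ‖ ≤ r ∧ ∀ ξ', ‖ξ'‖ ≤ r →
      U ξ' - 2 * α * ‖x - ξ'‖ ^ 2 ≤ U ξ - 2 * α * ‖x - ξ‖ ^ 2 := by
    intro x
    have h1 : UpperSemicontinuousOn (fun ξ => U ξ + -(2 * α * ‖x - ξ‖ ^ 2))
        (Metric.closedBall 0 r) := by
      apply hU.add
      apply ContinuousOn.upperSemicontinuousOn
      fun_prop
    obtain ⟨ξ, hξ, hmax⟩ := h1.exists_isMaxOn ⟨0, Metric.mem_closedBall_self hr.le⟩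
      (isCompact_closedBall (0 : E) r)
    refine ⟨ξ, by simpa using hξ, fun ξ' h' => ?_⟩
    have := hmax (show ξ' ∈ Metric.closedBall 0 r by simpa using h')
    simpa [sub_eq_add_neg] using this
  choose Ξ h1 h2 using key
  exact ⟨fun x => U (Ξ x) - 2 * α * ‖x - Ξ x‖ ^ 2, Ξ, h1, fun _ => rfl, h2⟩

namespace IsSupConv

variable {U : E → ℝ} {r α : ℝ} {Uh : E → ℝ} {Ξ : E → E}

theorem convexOn (h : IsSupConv U r α Uh Ξ) :
    ConvexOn ℝ univ fun x => Uh x + 2 * α * ‖x‖ ^ 2 := by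
  refine ⟨convex_univ, fun x₁ _ x₂ _ a b ha hb hab => ?_⟩
  set x := a • x₁ + b • x₂ with hx
  have e : ∀ x : E, ‖x - Ξ (a • x₁ + b • x₂)‖ ^ 2
      = ‖x‖ ^ 2 - 2 * ⟪x, Ξ (a • x₁ + b • x₂)⟫ + ‖Ξ (a • x₁ + b • x₂)‖ ^ 2 :=
    fun x => norm_sub_sq_real _ _
  rw [← hx] at e
  have h1 := h.le x₁ (Ξ x) (h.mem x)
  have h2 := h.le x₂ (Ξ x) (h.mem x)
  have h3 := h.eq x
  rw [e] at h1 h2 h3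
  have h4 : ⟪x, Ξ x⟫ = a * ⟪x₁, Ξ x⟫ + b * ⟪x₂, Ξ x⟫ := by
    nth_rw 1 [hx]; rw [inner_add_left, inner_smul_left, inner_smul_left]; simp
  simp only [smul_eq_mul]
  rw [h3, h4]
  have h5 := mul_le_mul_of_nonneg_left h1 ha
  have h6 := mul_le_mul_of_nonneg_left h2 hb
  have h7 : (U (Ξ x) - 2 * α * ‖Ξ x‖ ^ 2) = (a + b) * (U (Ξ x) - 2 * α * ‖Ξ x‖ ^ 2) := by
    rw [hab, one_mul]
  nlinarith

theorem ge (h : IsSupConv U r α Uh Ξ) (hr : 0 < r) (h0 : U 0 = 0) (x : E) :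
    -(2 * α * ‖x‖ ^ 2) ≤ Uh x := by
  have := h.le x 0 (by simpa using hr.le)
  simpa [h0] using this

/-- Localisation of the maximiser and of the value there. -/
theorem localize (h : IsSupConv U r α Uh Ξ) (hr : 0 < r) (hα : 0 < α) (h0 : U 0 = 0)
    (hq : ∀ ξ, ‖ξ‖ ≤ r → U ξ ≤ α / 2 * ‖ξ‖ ^ 2) (x : E) :
    ‖Ξ x‖ ≤ 3 * ‖x‖ ∧ |U (Ξ x)| ≤ 5 * α * ‖x‖ ^ 2 := by
  have h1 := h.ge hr h0 x
  have h2 := hq _ (h.mem x)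
  have h3 := h.eq x
  have h4 : ‖Ξ x‖ ≤ ‖x - Ξ x‖ + ‖x‖ := by
    have := norm_sub_le x (x - Ξ x)
    rw [sub_sub_cancel] at this; linarith
  have h5 : ‖Ξ x‖ ≤ 3 * ‖x‖ := by
    have h6 : 2 * α * ‖x - Ξ x‖ ^ 2 ≤ α / 2 * ‖Ξ x‖ ^ 2 + 2 * α * ‖x‖ ^ 2 := by linarith
    have h7 : α * (2 * ‖x - Ξ x‖ ^ 2) ≤ α * (1 / 2 * ‖Ξ x‖ ^ 2 + 2 * ‖x‖ ^ 2) := by linarith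
    have h8 := le_of_mul_le_mul_left h7 hα
    by_contra! hlt
    have h9 : (‖Ξ x‖ - ‖x‖) ^ 2 ≤ ‖x - Ξ x‖ ^ 2 := by
      apply pow_le_pow_left₀ _ (by linarith)
      nlinarith [norm_nonneg x]
    nlinarith [norm_nonneg x, norm_nonneg (Ξ x)]
  refine ⟨h5, ?_⟩
  have h10 : ‖Ξ x‖ ^ 2 ≤ (3 * ‖x‖) ^ 2 := by gcongr
  have h11 : 0 ≤ α * ‖x - Ξ x‖ ^ 2 := by positivity
  have h12 : 0 ≤ α * ‖x‖ ^ 2 := by positivity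
  rw [abs_le]
  constructor <;> nlinarith

/-- Magic property of sup-convolutions: upper touching is inherited at the maximiser. -/
theorem touch (h : IsSupConv U r α Uh Ξ) {x : E} (hx : ‖Ξ x‖ < r) {g : E → ℝ}
    (hg : ∀ᶠ k in 𝓝 (0 : E), Uh (x + k) ≤ Uh x + g k) :
    ∀ᶠ k in 𝓝 (0 : E), U (Ξ x + k) ≤ U (Ξ x) + g k := by
  have : Metric.ball (0 : E) (r - ‖Ξ x‖) ∈ 𝓝 (0 : E) := Metric.ball_mem_nhds _ (sub_pos.2 hx)
  filter_upwards [hg, this] with k hk hk2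
  have hk3 : ‖k‖ < r - ‖Ξ x‖ := by simpa using hk2
  have h1 := h.le (x + k) (Ξ x + k) ((norm_add_le _ _).trans (by linarith))
  rw [add_sub_add_right_eq_sub] at h1
  have h2 := h.eq x
  linarith

end IsSupConv

theorem norm_sub_sq_le_three (ξ η x y : E) :
    1 / 2 * ‖ξ - η‖ ^ 2 ≤ ‖x - y‖ ^ 2 + 2 * ‖x - ξ‖ ^ 2 + 2 * ‖y - η‖ ^ 2 := by
  have e : ξ - η = -(x - ξ) + ((x - y) + (y - η)) := by abel
  have h1 : ‖ξ - η‖ ≤ ‖x - ξ‖ + (‖x - y‖ + ‖y - η‖) := by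
    rw [e]
    refine (norm_add_le _ _).trans ?_
    rw [norm_neg]
    gcongr
    exact norm_add_le _ _
  have h2 : ‖ξ - η‖ ^ 2 ≤ (‖x - ξ‖ + (‖x - y‖ + ‖y - η‖)) ^ 2 := by gcongr
  nlinarith [sq_nonneg (‖x - ξ‖ + ‖y - η‖ - ‖x - y‖), sq_nonneg (‖x - ξ‖ - ‖y - η‖)]

theorem le_of_eventually_quadratic {E : Type*} [NormedAddCommGroup E] [NormedSpace ℝ E]
    {f : E → ℝ} {a : ℝ} {h : E} (hf : ∀ s : ℝ, f (s • h) = s ^ 2 * f h)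
    (hev : ∀ ε > 0, ∀ᶠ k in 𝓝 (0 : E), f k ≤ (a + ε) * ‖k‖ ^ 2) : f h ≤ a * ‖h‖ ^ 2 := by
  have key : ∀ ε > 0, f h ≤ (a + ε) * ‖h‖ ^ 2 := by
    intro ε hε
    have h1 : Filter.Tendsto (fun s : ℝ => s • h) (𝓝[>] 0) (𝓝 0) := by
      have : Continuous fun s : ℝ => s • h := by fun_prop
      simpa using (this.tendsto 0).mono_left nhdsWithin_le_nhds
    obtain ⟨s, hs, hs0⟩ := ((h1.eventually (hev ε hε)).and self_mem_nhdsWithin).exists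
    rw [hf, norm_smul, Real.norm_eq_abs, mul_pow, sq_abs] at hs
    have hs1 : 0 < s := hs0
    have : s ^ 2 * f h ≤ s ^ 2 * ((a + ε) * ‖h‖ ^ 2) := by linarith
    exact le_of_mul_le_mul_left this (by positivity)
  have ht : Filter.Tendsto (fun ε : ℝ => (a + ε) * ‖h‖ ^ 2) (𝓝[>] 0)
      (𝓝 ((a + 0) * ‖h‖ ^ 2)) := by
    have : Continuous fun ε : ℝ => (a + ε) * ‖h‖ ^ 2 := by fun_prop
    exact (this.tendsto 0).mono_left nhdsWithin_le_nhds
  have := ge_of_tendsto ht (Filter.eventually_of_mem self_mem_nhdsWithin fun ε hε => key ε hε)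
  simpa using this

set_option maxHeartbeats 1000000 in
/-- **Theorem on sums** (approximate form). -/
theorem theorem_on_sums [FiniteDimensional ℝ E] {U V : E → ℝ} {r α : ℝ} (hr : 0 < r)
    (hα : 0 < α) (hU : UpperSemicontinuousOn U (Metric.closedBall 0 r))
    (hV : UpperSemicontinuousOn V (Metric.closedBall 0 r)) (hU0 : U 0 = 0) (hV0 : V 0 = 0)
    (hUV : ∀ ξ η, ‖ξ‖ ≤ r → ‖η‖ ≤ r → U ξ + V η ≤ α / 2 * ‖ξ - η‖ ^ 2) {δ : ℝ} (hδ : 0 < δ) :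
    ∃ (ξ η p p' : E) (X Y : E →L[ℝ] E), ‖ξ‖ < δ ∧ ‖η‖ < δ ∧ |U ξ| < δ ∧ |V η| < δ ∧
      ‖p‖ < δ ∧ ‖p'‖ < δ ∧
      (∀ᶠ h in 𝓝 (0 : E), U (ξ + h) ≤ U ξ + (⟪p, h⟫ + ⟪X h, h⟫ / 2)) ∧
      (∀ᶠ h in 𝓝 (0 : E), V (η + h) ≤ V η + (⟪p', h⟫ + ⟪Y h, h⟫ / 2)) ∧
      ∀ h h', ⟪X h, h⟫ + ⟪Y h', h'⟫ ≤ 2 * α * ‖h - h'‖ ^ 2 + δ * (‖h‖ ^ 2 + ‖h'‖ ^ 2) := by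
  obtain ⟨Uh, Ξ, hUh⟩ := exists_isSupConv hr α hU
  obtain ⟨Vh, H, hVh⟩ := exists_isSupConv hr α hV
  have hUq : ∀ ξ, ‖ξ‖ ≤ r → U ξ ≤ α / 2 * ‖ξ‖ ^ 2 := fun ξ hξ => by
    simpa [hV0] using hUV ξ 0 hξ (by simpa using hr.le)
  have hVq : ∀ ξ, ‖ξ‖ ≤ r → V ξ ≤ α / 2 * ‖ξ‖ ^ 2 := fun ξ hξ => by
    simpa [hU0] using hUV 0 ξ (by simpa using hr.le) hξ
  have hsum : ∀ x y, Uh x + Vh y ≤ α * ‖x - y‖ ^ 2 := by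
    intro x y
    rw [hUh.eq, hVh.eq]
    have h1 := hUV _ _ (hUh.mem x) (hVh.mem y)
    have h2 := mul_le_mul_of_nonneg_left (norm_sub_sq_le_three (Ξ x) (H y) x y) hα.le
    linarith
  have hUh0 : Uh 0 + Vh 0 = 0 := by
    have h1 := hsum 0 0
    have h2 := hUh.ge hr hU0 0
    have h3 := hVh.ge hr hV0 0
    simp only [sub_self, norm_zero] at h1 h2 h3
    linarith
  let G : WithLp 2 (E × E) → ℝ := fun w => Uh w.fst + Vh w.snd - α * ‖w.fst - w.snd‖ ^ 2
  have hns : ∀ w : WithLp 2 (E × E), ‖w‖ ^ 2 = ‖w.fst‖ ^ 2 + ‖w.snd‖ ^ 2 :=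
    fun w => WithLp.prod_norm_sq_eq_of_L2 w
  have hGid : ∀ w : WithLp 2 (E × E), G w + 4 * α * ‖w‖ ^ 2 =
      (Uh w.fst + 2 * α * ‖w.fst‖ ^ 2) + (Vh w.snd + 2 * α * ‖w.snd‖ ^ 2)
        + α * ‖w.fst + w.snd‖ ^ 2 := by
    intro w
    simp only [G]
    rw [hns, norm_sub_sq_real, norm_add_sq_real]; ring
  let P1 : WithLp 2 (E × E) →ₗ[ℝ] E :=
    { toFun := fun w => w.fst, map_add' := fun _ _ => rfl, map_smul' := fun _ _ => rfl }
  let P2 : WithLp 2 (E × E) →ₗ[ℝ] E :=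
    { toFun := fun w => w.snd, map_add' := fun _ _ => rfl, map_smul' := fun _ _ => rfl }
  have hconv : ConvexOn ℝ univ fun w => G w + 4 * α * ‖w‖ ^ 2 := by
    have c1 := hUh.convexOn.comp_linearMap P1
    have c2 := hVh.convexOn.comp_linearMap P2
    have c3 : ConvexOn ℝ univ fun x : E => α * ‖x‖ ^ 2 :=
      ((convexOn_norm convex_univ).pow (fun _ _ => norm_nonneg _) 2).smul hα.le
    have c4 := c3.comp_linearMap (P1 + P2)
    refine ((c1.add c2).add c4).congr fun w _ => ?_
    rw [hGid]; rfl
  obtain ⟨δ', hδ'0, hδ'1, hδ'2, hδ'r⟩ : ∃ δ' > 0, 6 * (1 + α) * δ' ≤ δ ∧ δ' ≤ 1 ∧ 3 * δ' < r := by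
    refine ⟨min (δ / (6 * (1 + α))) (min 1 (r / 4)), by positivity, ?_, ?_, ?_⟩
    · have := min_le_left (δ / (6 * (1 + α))) (min 1 (r / 4))
      rw [le_div_iff₀ (by positivity)] at this; linarith
    · exact (min_le_right _ _).trans (min_le_left _ _)
    · have := (min_le_right (δ / (6 * (1 + α))) (min 1 (r / 4))).trans (min_le_right _ _)
      linarith
  obtain ⟨z, P, B, hz, hP, hup, hexp⟩ := exists_second_order_point_near_max
    (c := 4 * α) (m := 0) (by positivity) hconv (fun w => by
      rw [hGid]
      have h1 := hUh.ge hr hU0 w.fst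
      have h2 := hVh.ge hr hV0 w.snd
      have : 0 ≤ α * ‖w.fst + w.snd‖ ^ 2 := by positivity
      linarith) (fun w => by
      have h1 := hsum w.fst w.snd
      have h2 : G 0 = 0 := by
        simp only [G, WithLp.zero_fst, WithLp.zero_snd, sub_self, norm_zero]; linarith
      rw [h2]; simp only [G]; linarith) hδ'0
  have hfst : ∀ w : WithLp 2 (E × E), ‖w.fst‖ ≤ ‖w‖ := fun w => by
    have := hns w; nlinarith [norm_nonneg w, norm_nonneg w.fst, sq_nonneg ‖w.snd‖]
  have hsnd : ∀ w : WithLp 2 (E × E), ‖w.snd‖ ≤ ‖w‖ := fun w => by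
    have := hns w; nlinarith [norm_nonneg w, norm_nonneg w.snd, sq_nonneg ‖w.fst‖]
  set x := z.fst with hx
  set y := z.snd with hy
  have hxn : ‖x‖ < δ' := (hfst z).trans_lt hz
  have hyn : ‖y‖ < δ' := (hsnd z).trans_lt hz
  have hxy : ‖x - y‖ < 2 * δ' := (norm_sub_le _ _).trans_lt (by linarith)
  have hP1 : ‖P.fst‖ < δ' := (hfst P).trans_lt hP
  have hP2 : ‖P.snd‖ < δ' := (hsnd P).trans_lt hP
  obtain ⟨hξn, hUξ⟩ := hUh.localize hr hα hU0 hUq x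
  obtain ⟨hηn, hVη⟩ := hVh.localize hr hα hV0 hVq y
  let I1 : E →L[ℝ] WithLp 2 (E × E) :=
    (WithLp.prodContinuousLinearEquiv 2 ℝ E E).symm.toContinuousLinearMap.comp
      (ContinuousLinearMap.inl ℝ E E)
  let I2 : E →L[ℝ] WithLp 2 (E × E) :=
    (WithLp.prodContinuousLinearEquiv 2 ℝ E E).symm.toContinuousLinearMap.comp
      (ContinuousLinearMap.inr ℝ E E)
  let Q1 : WithLp 2 (E × E) →L[ℝ] E := (ContinuousLinearMap.fst ℝ E E).comp
    (WithLp.prodContinuousLinearEquiv 2 ℝ E E).toContinuousLinearMap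
  let Q2 : WithLp 2 (E × E) →L[ℝ] E := (ContinuousLinearMap.snd ℝ E E).comp
    (WithLp.prodContinuousLinearEquiv 2 ℝ E E).toContinuousLinearMap
  let X : E →L[ℝ] E := (Q1.comp B).comp I1 + (2 * α) • ContinuousLinearMap.id ℝ E
  let Y : E →L[ℝ] E := (Q2.comp B).comp I2 + (2 * α) • ContinuousLinearMap.id ℝ E
  set p := P.fst + (2 * α) • (x - y) with hp
  set p' := P.snd - (2 * α) • (x - y) with hp'
  have hI1t : Filter.Tendsto I1 (𝓝 0) (𝓝 0) := by simpa using I1.continuous.tendsto 0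
  have hI2t : Filter.Tendsto I2 (𝓝 0) (𝓝 0) := by simpa using I2.continuous.tendsto 0
  have hI1f : ∀ h, (I1 h).fst = h := fun _ => rfl
  have hI1s : ∀ h, (I1 h).snd = 0 := fun _ => rfl
  have hI2f : ∀ h, (I2 h).fst = 0 := fun _ => rfl
  have hI2s : ∀ h, (I2 h).snd = h := fun _ => rfl
  have hin : ∀ w w' : WithLp 2 (E × E), ⟪w, w'⟫ = ⟪w.fst, w'.fst⟫ + ⟪w.snd, w'.snd⟫ :=
    fun w w' => WithLp.prod_inner_apply w w'
  have hXe : ∀ h, ⟪X h, h⟫ = ⟪B (I1 h), I1 h⟫ + 2 * α * ‖h‖ ^ 2 := by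
    intro h
    have : X h = (B (I1 h)).fst + (2 * α) • h := rfl
    rw [this, hin, hI1f, hI1s, inner_zero_right, inner_add_left, inner_smul_left,
      real_inner_self_eq_norm_sq]
    simp
  have hYe : ∀ h, ⟪Y h, h⟫ = ⟪B (I2 h), I2 h⟫ + 2 * α * ‖h‖ ^ 2 := by
    intro h
    have : Y h = (B (I2 h)).snd + (2 * α) • h := rfl
    rw [this, hin, hI2f, hI2s, inner_zero_right, inner_add_left, inner_smul_left,
      real_inner_self_eq_norm_sq]
    simp
  have hUexp : ∀ ε > 0, ∀ᶠ h in 𝓝 (0 : E),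
      |Uh (x + h) - Uh x - ⟪p, h⟫ - ⟪X h, h⟫ / 2| ≤ ε * ‖h‖ ^ 2 := by
    intro ε hε
    filter_upwards [hI1t.eventually (hexp ε hε)] with h hh
    have e1 : ‖I1 h‖ ^ 2 = ‖h‖ ^ 2 := by rw [hns, hI1f, hI1s]; simp
    rw [e1] at hh
    refine le_trans (le_of_eq ?_) hh
    congr 1
    rw [hXe, hin P, hI1f, hI1s, inner_zero_right]
    simp only [G, WithLp.add_fst, WithLp.add_snd, hI1f, hI1s, add_zero, ← hx, ← hy]
    have e2 : x + h - y = (x - y) + h := by abel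
    rw [e2, norm_add_sq_real, hp, inner_add_left, inner_smul_left]
    simp only [conj_trivial]; ring
  have hVexp : ∀ ε > 0, ∀ᶠ h in 𝓝 (0 : E),
      |Vh (y + h) - Vh y - ⟪p', h⟫ - ⟪Y h, h⟫ / 2| ≤ ε * ‖h‖ ^ 2 := by
    intro ε hε
    filter_upwards [hI2t.eventually (hexp ε hε)] with h hh
    have e1 : ‖I2 h‖ ^ 2 = ‖h‖ ^ 2 := by rw [hns, hI2f, hI2s]; simp
    rw [e1] at hh
    refine le_trans (le_of_eq ?_) hh
    congr 1
    rw [hYe, hin P, hI2f, hI2s, inner_zero_right]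
    simp only [G, WithLp.add_fst, WithLp.add_snd, hI2f, hI2s, add_zero, ← hx, ← hy]
    have e2 : x - (y + h) = (x - y) - h := by abel
    rw [e2, norm_sub_sq_real, hp', inner_sub_left, inner_smul_left]
    simp only [conj_trivial]; ring
  have hmat : ∀ h h', ⟪X h, h⟫ + ⟪Y h', h'⟫
      ≤ 2 * α * ‖h - h'‖ ^ 2 + 2 * δ' * (‖h‖ ^ 2 + ‖h'‖ ^ 2) := by
    intro h h'
    have hst : ∀ ε > 0, ∀ᶠ k in 𝓝 (0 : WithLp 2 (E × E)),
        (⟪X k.fst, k.fst⟫ + ⟪Y k.snd, k.snd⟫ - 2 * α * ‖k.fst - k.snd‖ ^ 2)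
          ≤ (2 * δ' + ε) * ‖k‖ ^ 2 := by
      intro ε hε
      have t1 : Filter.Tendsto (fun k : WithLp 2 (E × E) => k.fst) (𝓝 0) (𝓝 0) := by
        have := Q1.continuous.tendsto 0
        rw [map_zero] at this
        exact this
      have t2 : Filter.Tendsto (fun k : WithLp 2 (E × E) => k.snd) (𝓝 0) (𝓝 0) := by
        have := Q2.continuous.tendsto 0
        rw [map_zero] at this
        exact this
      filter_upwards [hup, t1.eventually (hUexp (ε / 2) (by positivity)),
        t2.eventually (hVexp (ε / 2) (by positivity))] with k h1 h2 h3
      have h2' := (abs_le.1 h2).1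
      have h3' := (abs_le.1 h3).1
      rw [hns] at h1 ⊢
      rw [hin] at h1
      simp only [G, WithLp.add_fst, WithLp.add_snd, ← hx, ← hy] at h1
      have e2 : x + k.fst - (y + k.snd) = (x - y) + (k.fst - k.snd) := by abel
      rw [e2, norm_add_sq_real, inner_sub_right] at h1
      rw [hp, inner_add_left, inner_smul_left] at h2'
      rw [hp', inner_sub_left, inner_smul_left] at h3'
      simp only [conj_trivial] at h2' h3'
      nlinarith
    have := le_of_eventually_quadratic (a := 2 * δ') (h := WithLp.toLp 2 (h, h'))
      (f := fun k : WithLp 2 (E × E) =>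
        ⟪X k.fst, k.fst⟫ + ⟪Y k.snd, k.snd⟫ - 2 * α * ‖k.fst - k.snd‖ ^ 2) (by
        intro s
        simp only [WithLp.smul_fst, WithLp.smul_snd, map_smul, inner_smul_left, inner_smul_right,
          ← smul_sub, norm_smul, Real.norm_eq_abs, mul_pow, sq_abs, conj_trivial]
        ring) hst
    rw [hns] at this
    simp only [WithLp.toLp_fst, WithLp.toLp_snd] at this
    linarith
  have hpb : ∀ q : E, ‖q‖ < δ' → ‖q‖ + ‖(2 * α) • (x - y)‖ < δ := by
    intro q hq
    rw [norm_smul, Real.norm_eq_abs, abs_of_pos (by positivity)]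
    have : 2 * α * ‖x - y‖ ≤ 2 * α * (2 * δ') := by gcongr
    nlinarith
  have hsmall : ∀ w : E, ‖w‖ < δ' → 5 * α * ‖w‖ ^ 2 < δ := by
    intro w hw
    have h1 : 5 * α * ‖w‖ ^ 2 ≤ 5 * α * δ' ^ 2 := by gcongr
    have h2 : 5 * α * δ' ^ 2 ≤ 5 * α * δ' := by
      have : δ' ^ 2 ≤ δ' := by nlinarith
      gcongr
    nlinarith
  have hαδ : 0 < α * δ' := by positivity
  have hquad : ∀ (Z : E →L[ℝ] E) (h : E), ⟪(Z + δ' • ContinuousLinearMap.id ℝ E) h, h⟫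
      = ⟪Z h, h⟫ + δ' * ‖h‖ ^ 2 := by
    intro Z h
    simp only [_root_.add_apply, _root_.smul_apply, ContinuousLinearMap.id_apply,
      inner_add_left, inner_smul_left, real_inner_self_eq_norm_sq, conj_trivial]
  refine ⟨Ξ x, H y, p, p', X + δ' • ContinuousLinearMap.id ℝ E,
    Y + δ' • ContinuousLinearMap.id ℝ E, by nlinarith, by nlinarith, hUξ.trans_lt (hsmall x hxn),
    hVη.trans_lt (hsmall y hyn), (norm_add_le _ _).trans_lt (hpb _ hP1),
    (norm_sub_le _ _).trans_lt (hpb _ hP2), ?_, ?_, fun h h' => ?_⟩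
  · refine hUh.touch (by linarith) ?_
    filter_upwards [hUexp (δ' / 2) (by positivity)] with h hh
    rw [hquad]
    linarith [(abs_le.1 hh).2]
  · refine hVh.touch (by linarith) ?_
    filter_upwards [hVexp (δ' / 2) (by positivity)] with h hh
    rw [hquad]
    linarith [(abs_le.1 hh).2]
  · rw [hquad, hquad]
    have := hmat h h'
    have h1 : 3 * δ' * (‖h‖ ^ 2 + ‖h'‖ ^ 2) ≤ δ * (‖h‖ ^ 2 + ‖h'‖ ^ 2) := by
      gcongr; nlinarith
    nlinarith

end Sums

section Calculus

open scoped Topology RealInnerProductSpace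

variable {k d : ℕ}

theorem IsC12.of_contDiff {g : ℝ × Euc k → ℝ} (hg : ContDiff ℝ 2 g) :
    IsC12 fun t x => g (t, x) := by
  have hd : Differentiable ℝ g := hg.differentiable (by norm_num)
  have hg1 : ContDiff ℝ 1 (fderiv ℝ g) := hg.fderiv_right (by norm_num)
  have hd1 : Differentiable ℝ (fderiv ℝ g) := hg1.differentiable (by norm_num)
  have hpair : ∀ (t : ℝ) (x : Euc k), HasFDerivAt (fun y : Euc k => (t, y))
      (ContinuousLinearMap.inr ℝ ℝ (Euc k)) x := fun t x => hasFDerivAt_prodMk_right t x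
  have hx : ∀ (t : ℝ) (x : Euc k), HasFDerivAt (fun y => g (t, y))
      ((fderiv ℝ g (t, x)).comp (ContinuousLinearMap.inr ℝ ℝ (Euc k))) x :=
    fun t x => (hd (t, x)).hasFDerivAt.comp x (hpair t x)
  have ht : ∀ (t : ℝ) (x : Euc k), HasDerivAt (fun s => g (s, x)) (fderiv ℝ g (t, x) (1, 0)) t := by
    intro t x
    have h1 : HasDerivAt (fun s : ℝ => (s, x)) ((1 : ℝ), (0 : Euc k)) t :=
      (hasDerivAt_id t).prodMk (hasDerivAt_const t x)
    exact (hd (t, x)).hasFDerivAt.comp_hasDerivAt t h1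
  have hxe : ∀ t : ℝ, fderiv ℝ (fun y => g (t, y)) =
      fun x => (fderiv ℝ g (t, x)).comp (ContinuousLinearMap.inr ℝ ℝ (Euc k)) :=
    fun t => funext fun x => (hx t x).fderiv
  refine ⟨fun x t => (ht t x).differentiableAt, ?_, fun t => ?_, ?_, ?_⟩
  · have : (fun p : ℝ × Euc k => deriv (fun s => g (s, p.2)) p.1)
        = fun p => fderiv ℝ g p (1, 0) := funext fun p => (ht p.1 p.2).deriv
    rw [this]
    exact hg1.continuous.clm_apply continuous_const
  · exact hg.comp (contDiff_prodMk_right t)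
  · have : (fun p : ℝ × Euc k => fderiv ℝ (fun y => g (p.1, y)) p.2)
        = fun p => (fderiv ℝ g p).comp (ContinuousLinearMap.inr ℝ ℝ (Euc k)) :=
      funext fun p => (hx p.1 p.2).fderiv
    rw [this]
    exact hg1.continuous.clm_comp continuous_const
  · have : (fun p : ℝ × Euc k => fderiv ℝ (fderiv ℝ fun y => g (p.1, y)) p.2)
        = fun p => ((ContinuousLinearMap.compL ℝ (Euc k) (ℝ × Euc k) ℝ).flip
          (ContinuousLinearMap.inr ℝ ℝ (Euc k))).comp
          ((fderiv ℝ (fderiv ℝ g) p).comp (ContinuousLinearMap.inr ℝ ℝ (Euc k))) := by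
      funext p
      rw [hxe]
      have h2 := (hd1 (p.1, p.2)).hasFDerivAt.comp p.2 (hpair p.1 p.2)
      exact (((ContinuousLinearMap.compL ℝ (Euc k) (ℝ × Euc k) ℝ).flip
        (ContinuousLinearMap.inr ℝ ℝ (Euc k))).hasFDerivAt.comp p.2 h2).fderiv
    rw [this]
    exact continuous_const.clm_comp
      ((hg1.continuous_fderiv (by norm_num)).clm_comp continuous_const)

namespace IsC12

variable {φ ψ : ℝ → Euc k → ℝ}

theorem differentiable_space (h : IsC12 φ) (t : ℝ) : Differentiable ℝ (φ t) :=
  (h.2.2.1 t).differentiable (by norm_num)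

theorem differentiable_fderiv (h : IsC12 φ) (t : ℝ) : Differentiable ℝ (fderiv ℝ (φ t)) :=
  ((h.2.2.1 t).fderiv_right (m := 1) (by norm_num)).differentiable (by norm_num)

theorem pd_differentiable (h : IsC12 φ) (t : ℝ) (j : Fin k) :
    Differentiable ℝ fun y => pd j (φ t) y :=
  fun y => (h.differentiable_fderiv t y).clm_apply (differentiableAt_const _)

theorem pd_pd (h : IsC12 φ) (t : ℝ) (x : Euc k) (i j : Fin k) :
    pd i (fun y => pd j (φ t) y) x = fderiv ℝ (fderiv ℝ (φ t)) x (EuclideanSpace.single i 1)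
      (EuclideanSpace.single j 1) := by
  unfold pd
  rw [fderiv_clm_apply (h.differentiable_fderiv t x) (differentiableAt_const _)]
  simp

theorem add (h : IsC12 φ) (h' : IsC12 ψ) : IsC12 fun t x => φ t x + ψ t x := by
  have e1 : ∀ t, (fderiv ℝ fun x => φ t x + ψ t x) = fun x => fderiv ℝ (φ t) x + fderiv ℝ (ψ t) x :=
    fun t => funext fun x => fderiv_fun_add (h.differentiable_space t x) (h'.differentiable_space t x)
  refine ⟨fun x => (h.1 x).add (h'.1 x), ?_, fun t => (h.2.2.1 t).add (h'.2.2.1 t), ?_, ?_⟩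
  · have : (fun p : ℝ × Euc k => deriv (fun s => φ s p.2 + ψ s p.2) p.1)
        = fun p => deriv (fun s => φ s p.2) p.1 + deriv (fun s => ψ s p.2) p.1 :=
      funext fun p => deriv_fun_add (h.1 _ _) (h'.1 _ _)
    rw [this]; exact h.2.1.add h'.2.1
  · simp only [e1]; exact h.2.2.2.1.add h'.2.2.2.1
  · have : (fun p : ℝ × Euc k => fderiv ℝ (fderiv ℝ fun x => φ p.1 x + ψ p.1 x) p.2)
        = fun p => fderiv ℝ (fderiv ℝ (φ p.1)) p.2 + fderiv ℝ (fderiv ℝ (ψ p.1)) p.2 := by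
      funext p; rw [e1]
      exact fderiv_fun_add (h.differentiable_fderiv _ _) (h'.differentiable_fderiv _ _)
    rw [this]; exact h.2.2.2.2.add h'.2.2.2.2

theorem const_mul (h : IsC12 φ) (c : ℝ) : IsC12 fun t x => c * φ t x := by
  have e1 : ∀ t, (fderiv ℝ fun x => c * φ t x) = fun x => c • fderiv ℝ (φ t) x :=
    fun t => funext fun x => fderiv_const_mul (h.differentiable_space t x) c
  refine ⟨fun x => (h.1 x).const_mul c, ?_, fun t => contDiff_const.mul (h.2.2.1 t), ?_, ?_⟩
  · have : (fun p : ℝ × Euc k => deriv (fun s => c * φ s p.2) p.1)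
        = fun p => c * deriv (fun s => φ s p.2) p.1 :=
      funext fun p => deriv_const_mul c (h.1 _ _)
    rw [this]; exact continuous_const.mul h.2.1
  · simp only [e1]; exact h.2.2.2.1.const_smul c
  · have : (fun p : ℝ × Euc k => fderiv ℝ (fderiv ℝ fun x => c * φ p.1 x) p.2)
        = fun p => c • fderiv ℝ (fderiv ℝ (φ p.1)) p.2 := by
      funext p; rw [e1]
      exact fderiv_fun_const_smul (h.differentiable_fderiv _ _) c
    rw [this]; exact h.2.2.2.2.const_smul c

theorem neg (h : IsC12 φ) : IsC12 fun t x => -φ t x := by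
  simpa using h.const_mul (-1)

theorem const (c : ℝ) : IsC12 (k := k) fun _ _ => c :=
  IsC12.of_contDiff (g := fun _ => c) contDiff_const

theorem sub (h : IsC12 φ) (h' : IsC12 ψ) : IsC12 fun t x => φ t x - ψ t x := by
  simpa [sub_eq_add_neg] using h.add h'.neg

end IsC12

variable {φ ψ : ℝ → Euc k → ℝ} (b : ℝ → Euc k → Fin k → ℝ)
  (σm : ℝ → Euc k → Matrix (Fin k) (Fin d) ℝ)

theorem timeDeriv_add (h : IsC12 φ) (h' : IsC12 ψ) (t : ℝ) (x : Euc k) :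
    timeDeriv (fun t x => φ t x + ψ t x) t x = timeDeriv φ t x + timeDeriv ψ t x :=
  deriv_fun_add (h.1 _ _) (h'.1 _ _)

theorem timeDeriv_const_mul (h : IsC12 φ) (c t : ℝ) (x : Euc k) :
    timeDeriv (fun t x => c * φ t x) t x = c * timeDeriv φ t x :=
  deriv_const_mul c (h.1 _ _)

theorem pd_add (h : IsC12 φ) (h' : IsC12 ψ) (t : ℝ) (x : Euc k) (i : Fin k) :
    pd i (fun y => φ t y + ψ t y) x = pd i (φ t) x + pd i (ψ t) x := by
  unfold pd
  rw [fderiv_fun_add (h.differentiable_space t x) (h'.differentiable_space t x)]; rfl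

theorem pd_const_mul (h : IsC12 φ) (c t : ℝ) (x : Euc k) (i : Fin k) :
    pd i (fun y => c * φ t y) x = c * pd i (φ t) x := by
  unfold pd
  rw [fderiv_const_mul (h.differentiable_space t x)]; rfl

theorem sigGrad_add (h : IsC12 φ) (h' : IsC12 ψ) (t : ℝ) (x : Euc k) :
    sigGrad σm (fun t x => φ t x + ψ t x) t x = sigGrad σm φ t x + sigGrad σm ψ t x := by
  funext l
  simp only [sigGrad, Pi.add_apply, pd_add h h', mul_add, Finset.sum_add_distrib]

theorem sigGrad_const_mul (h : IsC12 φ) (c t : ℝ) (x : Euc k) :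
    sigGrad σm (fun t x => c * φ t x) t x = c • sigGrad σm φ t x := by
  funext l
  simp only [sigGrad, Pi.smul_apply, pd_const_mul h, smul_eq_mul, Finset.mul_sum]
  exact Finset.sum_congr rfl fun i _ => by ring

theorem genL_add (h : IsC12 φ) (h' : IsC12 ψ) (t : ℝ) (x : Euc k) :
    genL b σm (fun t x => φ t x + ψ t x) t x = genL b σm φ t x + genL b σm ψ t x := by
  have e : ∀ i j, pd i (fun y => pd j (φ t) y + pd j (ψ t) y) x
      = pd i (fun y => pd j (φ t) y) x + pd i (fun y => pd j (ψ t) y) x := by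
    intro i j
    exact congrArg (fun L : Euc k →L[ℝ] ℝ => L (EuclideanSpace.single i 1))
      (fderiv_fun_add (h.pd_differentiable t j x) (h'.pd_differentiable t j x))
  simp only [genL, pd_add h h', e, mul_add, Finset.sum_add_distrib]
  ring

theorem genL_const_mul (h : IsC12 φ) (c t : ℝ) (x : Euc k) :
    genL b σm (fun t x => c * φ t x) t x = c * genL b σm φ t x := by
  have e : ∀ i j, pd i (fun y => c * pd j (φ t) y) x
      = c * pd i (fun y => pd j (φ t) y) x := by
    intro i j
    exact congrArg (fun L : Euc k →L[ℝ] ℝ => L (EuclideanSpace.single i 1))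
      (fderiv_const_mul (h.pd_differentiable t j x) c)
  simp only [genL, pd_const_mul h, e, mul_add, Finset.mul_sum]
  refine congrArg₂ (· + ·) ?_ ?_
  · exact Finset.sum_congr rfl fun i _ => Finset.sum_congr rfl fun j _ => by ring
  · exact Finset.sum_congr rfl fun i _ => by ring

theorem timeDeriv_neg (t : ℝ) (x : Euc k) :
    timeDeriv (fun t x => -φ t x) t x = -timeDeriv φ t x := by
  unfold timeDeriv; exact deriv.fun_neg

theorem sigGrad_neg (h : IsC12 φ) (t : ℝ) (x : Euc k) :
    sigGrad σm (fun t x => -φ t x) t x = -sigGrad σm φ t x := by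
  have := sigGrad_const_mul σm h (-1) t x
  simpa using this

theorem genL_neg (h : IsC12 φ) (t : ℝ) (x : Euc k) :
    genL b σm (fun t x => -φ t x) t x = -genL b σm φ t x := by
  have := genL_const_mul b σm h (-1) t x
  simpa using this

theorem timeDeriv_sub (h : IsC12 φ) (h' : IsC12 ψ) (t : ℝ) (x : Euc k) :
    timeDeriv (fun t x => φ t x - ψ t x) t x = timeDeriv φ t x - timeDeriv ψ t x :=
  deriv_fun_sub (h.1 _ _) (h'.1 _ _)

theorem sigGrad_sub (h : IsC12 φ) (h' : IsC12 ψ) (t : ℝ) (x : Euc k) :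
    sigGrad σm (fun t x => φ t x - ψ t x) t x = sigGrad σm φ t x - sigGrad σm ψ t x := by
  have := sigGrad_add σm h h'.neg t x
  rw [sigGrad_neg σm h'] at this
  simpa [sub_eq_add_neg] using this

theorem genL_sub (h : IsC12 φ) (h' : IsC12 ψ) (t : ℝ) (x : Euc k) :
    genL b σm (fun t x => φ t x - ψ t x) t x = genL b σm φ t x - genL b σm ψ t x := by
  have := genL_add b σm h h'.neg t x
  rw [genL_neg b σm h'] at this
  simpa [sub_eq_add_neg] using this

theorem timeDeriv_const (c t : ℝ) (x : Euc k) : timeDeriv (fun _ _ => c) t x = 0 := by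
  simp [timeDeriv]

theorem pd_const (c : ℝ) (x : Euc k) (i : Fin k) : pd i (fun _ => c) x = 0 := by
  simp [pd]

theorem sigGrad_const (c t : ℝ) (x : Euc k) : sigGrad σm (fun _ _ => c) t x = 0 := by
  funext l; simp [sigGrad, pd_const]

theorem genL_const (c t : ℝ) (x : Euc k) : genL b σm (fun _ _ => c) t x = 0 := by
  simp [genL, pd_const]

end Calculus

section QuadraticTest

open scoped Topology RealInnerProductSpace

variable {k d : ℕ}

/-- Space-time with its Euclidean structure. -/
abbrev STime (k : ℕ) : Type := WithLp 2 (ℝ × Euc k)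

/-- Space-time with time rescaled by `lam`. -/
def stretch (k : ℕ) (lam : ℝ) : ℝ × Euc k →L[ℝ] STime k :=
  (WithLp.prodContinuousLinearEquiv 2 ℝ ℝ (Euc k)).symm.toContinuousLinearMap.comp
    ((lam • ContinuousLinearMap.fst ℝ ℝ (Euc k)).prod (ContinuousLinearMap.snd ℝ ℝ (Euc k)))

@[simp] theorem stretch_fst (lam : ℝ) (z : ℝ × Euc k) : (stretch k lam z).fst = lam * z.1 := rfl
@[simp] theorem stretch_snd (lam : ℝ) (z : ℝ × Euc k) : (stretch k lam z).snd = z.2 := rfl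

/-- A quadratic polynomial on space-time. -/
def quadTest (κ lam : ℝ) (z₀ z₁ : ℝ × Euc k) (P : STime k) (X : STime k →L[ℝ] STime k)
    (z : ℝ × Euc k) : ℝ :=
  κ * ((z.1 - z₀.1) ^ 2 + ‖z.2 - z₀.2‖ ^ 2) + ⟪P, stretch k lam (z - z₁)⟫
    + ⟪X (stretch k lam (z - z₁)), stretch k lam (z - z₁)⟫ / 2

theorem contDiff_quadTest (κ lam : ℝ) (z₀ z₁ : ℝ × Euc k) (P : STime k)
    (X : STime k →L[ℝ] STime k) : ContDiff ℝ 2 (quadTest κ lam z₀ z₁ P X) := by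
  unfold quadTest
  have h1 : ContDiff ℝ 2 fun z : ℝ × Euc k => stretch k lam (z - z₁) := by fun_prop
  have h2 : ContDiff ℝ 2 fun z : ℝ × Euc k => ‖z.2 - z₀.2‖ ^ 2 :=
    ContDiff.norm_sq ℝ (by fun_prop)
  have h3 := (contDiff_const (c := P)).inner ℝ h1
  have h4 := (X.contDiff.comp h1).inner ℝ h1
  exact ((contDiff_const.mul (ContDiff.add (by fun_prop) h2)).add h3).add (h4.div_const 2)

/-- Embedding of a space direction into space-time. -/
def spaceDir (k : ℕ) : Euc k →L[ℝ] STime k :=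
  (WithLp.prodContinuousLinearEquiv 2 ℝ ℝ (Euc k)).symm.toContinuousLinearMap.comp
    (ContinuousLinearMap.inr ℝ ℝ (Euc k))

@[simp] theorem spaceDir_fst (v : Euc k) : (spaceDir k v).fst = 0 := rfl
@[simp] theorem spaceDir_snd (v : Euc k) : (spaceDir k v).snd = v := rfl

theorem stime_inner (w w' : STime k) : ⟪w, w'⟫ = w.fst * w'.fst + ⟪w.snd, w'.snd⟫ := by
  rw [WithLp.prod_inner_apply, real_inner_comm]; rfl

theorem stime_norm_sq (w : STime k) : ‖w‖ ^ 2 = w.fst ^ 2 + ‖w.snd‖ ^ 2 := by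
  rw [WithLp.prod_norm_sq_eq_of_L2, Real.norm_eq_abs, sq_abs]

theorem norm_spaceDir (v : Euc k) : ‖spaceDir k v‖ ^ 2 = ‖v‖ ^ 2 := by
  rw [stime_norm_sq]; simp

/-- The `l`-th column of `σ`. -/
def sigCol (σm : ℝ → Euc k → Matrix (Fin k) (Fin d) ℝ) (z : ℝ × Euc k) (l : Fin d) : Euc k :=
  WithLp.toLp 2 fun i => σm z.1 z.2 i l

variable (κ lam : ℝ) (z₀ z₁ : ℝ × Euc k) (P : STime k) (X : STime k →L[ℝ] STime k)

theorem timeDeriv_quadTest :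
    timeDeriv (fun t x => quadTest κ lam z₀ z₁ P X (t, x)) z₁.1 z₁.2
      = 2 * κ * (z₁.1 - z₀.1) + lam * P.fst := by
  unfold timeDeriv
  set a := ⟪X (stretch k lam (1, 0)), stretch k lam (1, 0)⟫ / 2
  have h : (fun s => quadTest κ lam z₀ z₁ P X (s, z₁.2)) = fun s =>
      κ * ((s - z₀.1) ^ 2 + ‖z₁.2 - z₀.2‖ ^ 2) + (s - z₁.1) * (lam * P.fst)
        + (s - z₁.1) ^ 2 * a := by
    funext s
    have e : stretch k lam ((s, z₁.2) - z₁) = (s - z₁.1) • stretch k lam (1, 0) := by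
      rw [← map_smul]; congr 1; ext <;> simp
    simp only [quadTest, e, map_smul, inner_smul_left, inner_smul_right, a]
    rw [stime_inner P]
    simp
    ring
  rw [h]
  have h1 : HasDerivAt (fun s : ℝ => s - z₀.1) 1 z₁.1 := (hasDerivAt_id _).sub_const _
  have h2 : HasDerivAt (fun s : ℝ => s - z₁.1) 1 z₁.1 := (hasDerivAt_id _).sub_const _
  have h3 := ((((h1.pow 2).add_const (‖z₁.2 - z₀.2‖ ^ 2)).const_mul κ).add
    (h2.mul_const (lam * P.fst))).add ((h2.pow 2).mul_const a)
  refine (HasDerivAt.deriv h3).trans ?_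
  simp; ring

/-- Space part of a quadratic form on space-time. -/
def spacePart (X : STime k →L[ℝ] STime k) : Euc k →L[ℝ] Euc k :=
  ((ContinuousLinearMap.snd ℝ ℝ (Euc k)).comp
    (WithLp.prodContinuousLinearEquiv 2 ℝ ℝ (Euc k)).toContinuousLinearMap).comp
    (X.comp (spaceDir k))

theorem spacePart_inner (v w : Euc k) : ⟪spacePart X v, w⟫ = ⟪X (spaceDir k v), spaceDir k w⟫ := by
  rw [stime_inner]; simp; rfl

theorem pd_quadTest (y : Euc k) (i : Fin k) :
    pd i (fun y => quadTest κ lam z₀ z₁ P X (z₁.1, y)) y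
      = 2 * κ * (y - z₀.2) i + P.snd i
        + (⟪spacePart X (EuclideanSpace.single i 1), y - z₁.2⟫
          + ⟪spacePart X (y - z₁.2), EuclideanSpace.single i 1⟫) / 2 := by
  have h : (fun y => quadTest κ lam z₀ z₁ P X (z₁.1, y)) = fun y =>
      κ * ((z₁.1 - z₀.1) ^ 2 + ‖y - z₀.2‖ ^ 2) + ⟪P.snd, y - z₁.2⟫
        + ⟪spacePart X (y - z₁.2), y - z₁.2⟫ / 2 := by
    funext y
    have e : stretch k lam ((z₁.1, y) - z₁) = spaceDir k (y - z₁.2) := by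
      have : ((z₁.1, y) - z₁ : ℝ × Euc k) = (0, y - z₁.2) := by ext <;> simp
      rw [this]
      unfold stretch spaceDir
      simp
    rw [quadTest, e, spacePart_inner, stime_inner P]
    simp
  unfold pd
  rw [h]
  have h1 : HasFDerivAt (fun y : Euc k => y - z₀.2) (ContinuousLinearMap.id ℝ (Euc k)) y :=
    (hasFDerivAt_id _).sub_const _
  have h2 : HasFDerivAt (fun y : Euc k => y - z₁.2) (ContinuousLinearMap.id ℝ (Euc k)) y :=
    (hasFDerivAt_id _).sub_const _
  have h3 := (((h1.norm_sq.const_add ((z₁.1 - z₀.1) ^ 2)).const_mul κ).add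
    ((hasFDerivAt_const P.snd y).inner ℝ h2)).add
    ((((spacePart X).hasFDerivAt.comp y h2).inner ℝ h2).mul_const (2⁻¹ : ℝ))
  have h4 : HasFDerivAt (fun y : Euc k => κ * ((z₁.1 - z₀.1) ^ 2 + ‖y - z₀.2‖ ^ 2)
      + ⟪P.snd, y - z₁.2⟫ + ⟪spacePart X (y - z₁.2), y - z₁.2⟫ / 2) _ y := h3
  rw [h4.fderiv]
  simp only [_root_.add_apply, _root_.smul_apply, ContinuousLinearMap.comp_apply,
    fderivInnerCLM_apply, ContinuousLinearMap.prod_apply, ContinuousLinearMap.id_apply,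
    _root_.zero_apply, inner_zero_left, add_zero, smul_eq_mul, innerSL_apply_apply,
    EuclideanSpace.inner_single_right]
  simp
  ring

theorem pd_quadTest_base (i : Fin k) :
    pd i (fun y => quadTest κ lam z₀ z₁ P X (z₁.1, y)) z₁.2
      = 2 * κ * (z₁.2 - z₀.2) i + P.snd i := by
  rw [pd_quadTest]; simp

theorem pd_pd_quadTest (y : Euc k) (i j : Fin k) :
    pd i (fun y => pd j (fun y => quadTest κ lam z₀ z₁ P X (z₁.1, y)) y) y
      = 2 * κ * (if i = j then 1 else 0)
        + (⟪spacePart X (EuclideanSpace.single j 1), EuclideanSpace.single i 1⟫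
          + ⟪spacePart X (EuclideanSpace.single i 1), EuclideanSpace.single j 1⟫) / 2 := by
  simp only [pd_quadTest]
  set ei : Euc k := EuclideanSpace.single i 1 with hei
  set ej : Euc k := EuclideanSpace.single j 1 with hej
  let L : Euc k →L[ℝ] ℝ := (2 * κ) • innerSL ℝ ej
    + (2⁻¹ : ℝ) • (innerSL ℝ (spacePart X ej) + (innerSL ℝ ej).comp (spacePart X))
  have h : (fun y : Euc k => 2 * κ * (y - z₀.2) j + P.snd j + (⟪spacePart X ej, y - z₁.2⟫
      + ⟪spacePart X (y - z₁.2), ej⟫) / 2) = fun y => L y + (-(2 * κ * z₀.2 j) + P.snd j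
        - (⟪spacePart X ej, z₁.2⟫ + ⟪spacePart X z₁.2, ej⟫) / 2) := by
    funext y
    have e : y j = ⟪ej, y⟫ := by rw [hej, EuclideanSpace.inner_single_left]; simp
    simp only [L, _root_.add_apply, _root_.smul_apply, ContinuousLinearMap.comp_apply,
      innerSL_apply_apply, smul_eq_mul, ← e, map_sub, inner_sub_right,
      real_inner_comm ej]
    simp
    ring
  unfold pd
  rw [h, (L.hasFDerivAt.add_const _).fderiv]
  have e : ⟪ej, ei⟫ = if i = j then (1 : ℝ) else 0 := by
    rw [hej, EuclideanSpace.inner_single_left, hei]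
    simp [eq_comm]
  simp only [L, _root_.add_apply, _root_.smul_apply, ContinuousLinearMap.comp_apply,
    innerSL_apply_apply, smul_eq_mul]
  rw [← hei, e, real_inner_comm (spacePart X ei) ej]
  ring

theorem sigCol_eq_sum (σm : ℝ → Euc k → Matrix (Fin k) (Fin d) ℝ) (z : ℝ × Euc k) (l : Fin d) :
    sigCol σm z l = ∑ i, σm z.1 z.2 i l • EuclideanSpace.single i (1 : ℝ) := by
  ext j
  rw [WithLp.ofLp_sum, Finset.sum_apply]
  simp [sigCol]

theorem sum_mul_transpose_eq (σm : ℝ → Euc k → Matrix (Fin k) (Fin d) ℝ) (z : ℝ × Euc k)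
    (q : Euc k →L[ℝ] Euc k) :
    ∑ i, ∑ j, (σm z.1 z.2 * (σm z.1 z.2)ᵀ) i j
      * ⟪q (EuclideanSpace.single i 1), EuclideanSpace.single j 1⟫
      = ∑ l, ⟪q (sigCol σm z l), sigCol σm z l⟫ := by
  simp only [sigCol_eq_sum, map_sum, map_smul, sum_inner, inner_sum, inner_smul_left,
    inner_smul_right, Matrix.mul_apply, Matrix.transpose_apply, Finset.sum_mul, conj_trivial]
  rw [Finset.sum_comm_cycle]
  refine Finset.sum_congr rfl fun l _ => ?_
  rw [Finset.sum_comm]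
  refine Finset.sum_congr rfl fun i _ => ?_
  rw [Finset.mul_sum]
  exact Finset.sum_congr rfl fun j _ => by ring

theorem genL_quadTest (b : ℝ → Euc k → Fin k → ℝ)
    (σm : ℝ → Euc k → Matrix (Fin k) (Fin d) ℝ) :
    genL b σm (fun t x => quadTest κ lam z₀ z₁ P X (t, x)) z₁.1 z₁.2
      = ∑ l, (κ * ‖sigCol σm z₁ l‖ ^ 2
          + ⟪X (spaceDir k (sigCol σm z₁ l)), spaceDir k (sigCol σm z₁ l)⟫ / 2)
        + ∑ i, b z₁.1 z₁.2 i * (2 * κ * (z₁.2 - z₀.2) i + P.snd i) := by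
  unfold genL
  simp only [pd_pd_quadTest, pd_quadTest_base]
  congr 1
  have h1 := sum_mul_transpose_eq σm z₁ (spacePart X)
  have h2 := sum_mul_transpose_eq σm z₁ (ContinuousLinearMap.id ℝ (Euc k))
  have hsym : ∀ i j, (σm z₁.1 z₁.2 * (σm z₁.1 z₁.2)ᵀ) i j
      = (σm z₁.1 z₁.2 * (σm z₁.1 z₁.2)ᵀ) j i := by
    intro i j
    simp only [Matrix.mul_apply, Matrix.transpose_apply]
    exact Finset.sum_congr rfl fun l _ => mul_comm _ _
  have h3 : ∑ i, ∑ j, (σm z₁.1 z₁.2 * (σm z₁.1 z₁.2)ᵀ) i j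
      * ⟪spacePart X (EuclideanSpace.single j 1), EuclideanSpace.single i 1⟫
      = ∑ l, ⟪spacePart X (sigCol σm z₁ l), sigCol σm z₁ l⟫ := by
    rw [← h1, Finset.sum_comm]
    exact Finset.sum_congr rfl fun i _ => Finset.sum_congr rfl fun j _ => by rw [hsym]
  have h4 : ∀ i j : Fin k, (if i = j then (1 : ℝ) else 0)
      = ⟪ContinuousLinearMap.id ℝ (Euc k) (EuclideanSpace.single i 1),
        EuclideanSpace.single j 1⟫ := by
    intro i j
    rw [ContinuousLinearMap.id_apply, EuclideanSpace.inner_single_left]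
    simp
  simp only [h4]
  have h5 : ∀ i j : Fin k, ∀ A B C : ℝ, (σm z₁.1 z₁.2 * (σm z₁.1 z₁.2)ᵀ) i j
      * (2 * κ * A + (B + C) / 2)
      = 2 * κ * ((σm z₁.1 z₁.2 * (σm z₁.1 z₁.2)ᵀ) i j * A)
        + ((σm z₁.1 z₁.2 * (σm z₁.1 z₁.2)ᵀ) i j * B / 2
          + (σm z₁.1 z₁.2 * (σm z₁.1 z₁.2)ᵀ) i j * C / 2) := fun i j A B C => by ring
  simp only [h5, Finset.sum_add_distrib, ← Finset.mul_sum, ← Finset.sum_div]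
  rw [h1, h2, h3]
  simp only [spacePart_inner, ContinuousLinearMap.id_apply, real_inner_self_eq_norm_sq]
  ring

theorem sigGrad_quadTest (σm : ℝ → Euc k → Matrix (Fin k) (Fin d) ℝ) (l : Fin d) :
    sigGrad σm (fun t x => quadTest κ lam z₀ z₁ P X (t, x)) z₁.1 z₁.2 l
      = ∑ i, σm z₁.1 z₁.2 i l * (2 * κ * (z₁.2 - z₀.2) i + P.snd i) := by
  simp only [sigGrad, pd_quadTest_base]

end QuadraticTest

section Penalization

open Filter Topology

/-- Maximizers of doubled, penalized functionals concentrate at a strict contact point. -/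
theorem exists_penalized_maximizers {Z : Type*} [MetricSpace Z] {B : Set Z} (hB : IsCompact B)
    {z₀ : Z} (hz₀ : z₀ ∈ B) {U V : Z → ℝ} (hU : UpperSemicontinuousOn U B)
    (hV : UpperSemicontinuousOn V B) (h0 : U z₀ + V z₀ = 0)
    (hneg : ∀ z ∈ B, z ≠ z₀ → U z + V z < 0) (pen : ℕ → Z → Z → ℝ)
    (hpc : ∀ n, Continuous fun q : Z × Z => pen n q.1 q.2) (hp0 : ∀ n, pen n z₀ z₀ = 0)
    (ρ : Z → Z → ℝ) (hρc : Continuous fun q : Z × Z => ρ q.1 q.2)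
    (hρ : ∀ z z', ρ z z' = 0 → z = z') (hρ0 : ∀ z z', 0 ≤ ρ z z')
    (hpen : ∀ (n : ℕ) z z', (n + 1 : ℝ) * ρ z z' ≤ pen n z z') :
    ∃ z z' : ℕ → Z, (∀ n, z n ∈ B ∧ z' n ∈ B) ∧
      (∀ n, ∀ y ∈ B, ∀ y' ∈ B, U y + V y' - pen n y y'
        ≤ U (z n) + V (z' n) - pen n (z n) (z' n)) ∧
      Tendsto z atTop (𝓝 z₀) ∧ Tendsto z' atTop (𝓝 z₀) ∧
      Tendsto (fun n => U (z n)) atTop (𝓝 (U z₀)) ∧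
      Tendsto (fun n => V (z' n)) atTop (𝓝 (V z₀)) ∧
      Tendsto (fun n => pen n (z n) (z' n)) atTop (𝓝 0) := by
  have hBB : IsCompact (B ×ˢ B) := hB.prod hB
  have hU2 : UpperSemicontinuousOn (fun q : Z × Z => U q.1) (B ×ˢ B) := fun q hq a ha =>
    ((continuous_fst.continuousWithinAt).tendsto_nhdsWithin fun p hp => hp.1).eventually
      (hU q.1 hq.1 a ha)
  have hV2 : UpperSemicontinuousOn (fun q : Z × Z => V q.2) (B ×ˢ B) := fun q hq a ha =>
    ((continuous_snd.continuousWithinAt).tendsto_nhdsWithin fun p hp => hp.2).eventually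
      (hV q.2 hq.2 a ha)
  have hUV : UpperSemicontinuousOn (fun q : Z × Z => U q.1 + V q.2) (B ×ˢ B) := hU2.add hV2
  have hmax : ∀ n, ∃ q ∈ B ×ˢ B, IsMaxOn (fun q : Z × Z => U q.1 + V q.2 + -pen n q.1 q.2)
      (B ×ˢ B) q := fun n =>
    UpperSemicontinuousOn.exists_isMaxOn ⟨(z₀, z₀), hz₀, hz₀⟩ hBB
      (hUV.add (hpc n).neg.continuousOn.upperSemicontinuousOn)
  choose q hqB hq using hmax
  have hq0 : ∀ n, pen n (q n).1 (q n).2 ≤ U (q n).1 + V (q n).2 := by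
    intro n
    have := isMaxOn_iff.1 (hq n) (z₀, z₀) ⟨hz₀, hz₀⟩
    simp only [hp0, h0] at this
    linarith
  obtain ⟨M, hM⟩ := hUV.bddAbove_of_isCompact hBB
  have hM' : ∀ n, pen n (q n).1 (q n).2 ≤ M := fun n =>
    (hq0 n).trans (hM (mem_image_of_mem _ (hqB n)))
  have hpen0 : ∀ n, 0 ≤ pen n (q n).1 (q n).2 := fun n =>
    (mul_nonneg (by positivity) (hρ0 _ _)).trans (hpen n _ _)
  have hρlim : Tendsto (fun n => ρ (q n).1 (q n).2) atTop (𝓝 0) := by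
    refine squeeze_zero (fun n => hρ0 _ _) (fun n => ?_)
      (by simpa using tendsto_one_div_add_atTop_nhds_zero_nat.const_mul M)
    have h1 := (hpen n _ _).trans (hM' n)
    rw [← div_eq_mul_inv, le_div_iff₀ (by positivity)]
    linarith
  have hlim : Tendsto q atTop (𝓝 (z₀, z₀)) := by
    refine hBB.tendsto_nhds_of_unique_mapClusterPt (Eventually.of_forall hqB) fun y hy hcl => ?_
    have h1 : ρ y.1 y.2 = 0 := by
      have h2 : MapClusterPt (ρ y.1 y.2) atTop (fun n => ρ (q n).1 (q n).2) :=
        hcl.continuousAt_comp hρc.continuousAt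
      exact eq_of_nhds_neBot (h2.clusterPt.mono hρlim)
    have h2 := hρ _ _ h1
    by_contra hne
    have h3 : y.1 ≠ z₀ := fun h => hne (Prod.ext h (h2 ▸ h))
    have h4 : U y.1 + V y.2 < 0 := h2 ▸ hneg y.1 hy.1 h3
    have h5 := hUV y hy 0 h4
    rw [eventually_nhdsWithin_iff] at h5
    obtain ⟨n, hn⟩ := (hcl.frequently h5).exists
    have := hn (hqB n)
    linarith [hq0 n, hpen0 n]
  have hz : Tendsto (fun n => (q n).1) atTop (𝓝 z₀) := (continuous_fst.tendsto _).comp hlim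
  have hz' : Tendsto (fun n => (q n).2) atTop (𝓝 z₀) := (continuous_snd.tendsto _).comp hlim
  have hzw : Tendsto (fun n => (q n).1) atTop (𝓝[B] z₀) :=
    tendsto_nhdsWithin_iff.2 ⟨hz, Eventually.of_forall fun n => (hqB n).1⟩
  have hzw' : Tendsto (fun n => (q n).2) atTop (𝓝[B] z₀) :=
    tendsto_nhdsWithin_iff.2 ⟨hz', Eventually.of_forall fun n => (hqB n).2⟩
  have hUe : ∀ a > U z₀, ∀ᶠ n in atTop, U (q n).1 < a := fun a ha =>
    hzw.eventually (hU z₀ hz₀ a ha)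
  have hVe : ∀ a > V z₀, ∀ᶠ n in atTop, V (q n).2 < a := fun a ha =>
    hzw'.eventually (hV z₀ hz₀ a ha)
  have hUt : Tendsto (fun n => U (q n).1) atTop (𝓝 (U z₀)) := by
    refine tendsto_order.2 ⟨fun a ha => ?_, hUe⟩
    filter_upwards [hVe (-a) (by linarith)] with n hn
    linarith [hq0 n, hpen0 n]
  have hVt : Tendsto (fun n => V (q n).2) atTop (𝓝 (V z₀)) := by
    refine tendsto_order.2 ⟨fun a ha => ?_, hVe⟩
    filter_upwards [hUe (-a) (by linarith)] with n hn
    linarith [hq0 n, hpen0 n]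
  refine ⟨fun n => (q n).1, fun n => (q n).2, hqB, fun n y hy y' hy' => ?_, hz, hz', hUt, hVt,
    squeeze_zero hpen0 hq0 (h0 ▸ hUt.add hVt)⟩
  have := isMaxOn_iff.1 (hq n) (y, y') ⟨hy, hy'⟩
  linarith

end Penalization

section TouchingQuadratics

open Filter Topology
open scoped RealInnerProductSpace

variable {k : ℕ}

/-- Inverse of `stretch`. -/
def unstretch (k : ℕ) (lam : ℝ) : STime k →L[ℝ] ℝ × Euc k :=
  ((lam⁻¹ • ContinuousLinearMap.fst ℝ ℝ (Euc k)).prod (ContinuousLinearMap.snd ℝ ℝ (Euc k))).comp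
    (WithLp.prodContinuousLinearEquiv 2 ℝ ℝ (Euc k)).toContinuousLinearMap

theorem unstretch_apply (lam : ℝ) (w : STime k) : unstretch k lam w = (lam⁻¹ * w.fst, w.snd) := rfl

theorem stretch_unstretch {lam : ℝ} (h : lam ≠ 0) (w : STime k) :
    stretch k lam (unstretch k lam w) = w := by
  apply (WithLp.equiv 2 _).injective
  refine Prod.ext ?_ rfl
  change lam * (lam⁻¹ * w.fst) = w.fst
  field_simp

theorem unstretch_stretch {lam : ℝ} (h : lam ≠ 0) (z : ℝ × Euc k) :
    unstretch k lam (stretch k lam z) = z := by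
  rw [unstretch_apply]
  refine Prod.ext ?_ rfl
  simp only [stretch_fst]
  field_simp

theorem norm_unstretch_le {lam : ℝ} (h : 1 ≤ lam) (w : STime k) :
    ‖unstretch k lam w‖ ≤ ‖w‖ := by
  have h1 : ‖w.fst‖ ≤ ‖w‖ := by
    apply abs_le_of_sq_le_sq' _ (norm_nonneg _) |>.2
    rw [stime_norm_sq]
    simp only [Real.norm_eq_abs, sq_abs]
    nlinarith [sq_nonneg ‖w.snd‖]
  have h2 : ‖w.snd‖ ≤ ‖w‖ := by
    apply abs_le_of_sq_le_sq' _ (norm_nonneg _) |>.2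
    rw [stime_norm_sq]
    nlinarith [sq_nonneg w.fst]
  rw [unstretch_apply, Prod.norm_def]
  refine max_le ?_ h2
  rw [norm_mul, norm_inv]
  have h3 : ‖lam‖⁻¹ ≤ 1 := inv_le_one_of_one_le₀ (by rw [Real.norm_eq_abs]; exact h.trans (le_abs_self _))
  exact (mul_le_of_le_one_left (norm_nonneg _) h3).trans h1

theorem exists_touching_quadratics {α lam r : ℝ} (hα : 0 < α) (hlam : 1 ≤ lam)
    {z₀ a b : ℝ × Euc k} {U V : ℝ × Euc k → ℝ}
    (hU : UpperSemicontinuousOn U (Metric.closedBall z₀ r))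
    (hV : UpperSemicontinuousOn V (Metric.closedBall z₀ r))
    (ha : a ∈ Metric.ball z₀ r) (hb : b ∈ Metric.ball z₀ r)
    (hmax : ∀ y ∈ Metric.closedBall z₀ r, ∀ y' ∈ Metric.closedBall z₀ r,
      U y + V y' - α / 2 * ‖stretch k lam (y - y')‖ ^ 2
        ≤ U a + V b - α / 2 * ‖stretch k lam (a - b)‖ ^ 2) {δ : ℝ} (hδ : 0 < δ) :
    ∃ (z₁ z₂ : ℝ × Euc k) (p p' : STime k) (X Y : STime k →L[ℝ] STime k),
      dist z₁ a < δ ∧ dist z₂ b < δ ∧ |U z₁ - U a| < δ ∧ |V z₂ - V b| < δ ∧ ‖p‖ < δ ∧ ‖p'‖ < δ ∧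
      (∀ᶠ z in 𝓝 z₁, U z ≤ U z₁ + (⟪α • stretch k lam (a - b) + p, stretch k lam (z - z₁)⟫
        + ⟪X (stretch k lam (z - z₁)), stretch k lam (z - z₁)⟫ / 2)) ∧
      (∀ᶠ z in 𝓝 z₂, V z ≤ V z₂ + (⟪-(α • stretch k lam (a - b)) + p', stretch k lam (z - z₂)⟫
        + ⟪Y (stretch k lam (z - z₂)), stretch k lam (z - z₂)⟫ / 2)) ∧
      ∀ h h', ⟪X h, h⟫ + ⟪Y h', h'⟫ ≤ 2 * α * ‖h - h'‖ ^ 2 + δ * (‖h‖ ^ 2 + ‖h'‖ ^ 2) := by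
  have hl0 : lam ≠ 0 := by positivity
  set D : STime k := α • stretch k lam (a - b) with hD
  rw [Metric.mem_ball] at ha hb
  set s : ℝ := min (r - dist a z₀) (r - dist b z₀) with hs
  have hs0 : 0 < s := lt_min (by linarith) (by linarith)
  have hmem : ∀ c, dist c z₀ + s ≤ r → ∀ ξ : STime k, ‖ξ‖ ≤ s →
      c + unstretch k lam ξ ∈ Metric.closedBall z₀ r := by
    intro c hc ξ hξ
    rw [Metric.mem_closedBall]
    calc dist (c + unstretch k lam ξ) z₀ ≤ dist (c + unstretch k lam ξ) c + dist c z₀ :=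
          dist_triangle _ _ _
      _ ≤ s + dist c z₀ := by
          gcongr
          rw [dist_eq_norm, add_sub_cancel_left]
          exact (norm_unstretch_le hlam ξ).trans hξ
      _ ≤ r := by linarith
  have hsa : dist a z₀ + s ≤ r := by linarith [min_le_left (r - dist a z₀) (r - dist b z₀)]
  have hsb : dist b z₀ + s ≤ r := by linarith [min_le_right (r - dist a z₀) (r - dist b z₀)]
  have husc : ∀ (W : ℝ × Euc k → ℝ), UpperSemicontinuousOn W (Metric.closedBall z₀ r) →
      ∀ c, dist c z₀ + s ≤ r → ∀ Q : STime k,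
      UpperSemicontinuousOn (fun ξ : STime k => W (c + unstretch k lam ξ) + (-W c - ⟪Q, ξ⟫))
        (Metric.closedBall 0 s) := by
    intro W hW c hc Q
    refine UpperSemicontinuousOn.add (fun ξ hξ y hy => ?_)
      (Continuous.continuousOn (by fun_prop)).upperSemicontinuousOn
    have h1 : Tendsto (fun ξ : STime k => c + unstretch k lam ξ)
        (𝓝[Metric.closedBall 0 s] ξ) (𝓝[Metric.closedBall z₀ r] (c + unstretch k lam ξ)) := by
      refine Continuous.continuousWithinAt (by fun_prop) |>.tendsto_nhdsWithin fun ζ hζ => ?_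
      exact hmem c hc ζ (by simpa using hζ)
    exact h1.eventually (hW _ (hmem c hc ξ (by simpa using hξ)) y hy)
  set δ' : ℝ := δ / (1 + ‖D‖) with hδ'
  have hD0 : 0 < 1 + ‖D‖ := by positivity
  have hδ0 : 0 < δ' := by positivity
  have hδ1 : δ' * (1 + ‖D‖) = δ := div_mul_cancel₀ _ hD0.ne'
  have hδ2 : δ' ≤ δ := by nlinarith [norm_nonneg D]
  obtain ⟨ξ, η, p, p', X, Y, h1, h2, h3, h4, h5, h6, h7, h8, h9⟩ :=
    theorem_on_sums hs0 hα (husc U hU a hsa D) (husc V hV b hsb (-D)) (by simp) (by simp)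
      (by
        intro ξ η hξ hη
        have e := hmax _ (hmem a hsa ξ hξ) _ (hmem b hsb η hη)
        have e2 : stretch k lam (a + unstretch k lam ξ - (b + unstretch k lam η))
            = stretch k lam (a - b) + (ξ - η) := by
          rw [add_sub_add_comm, map_add, ← map_sub, stretch_unstretch hl0]
        rw [e2, norm_add_sq_real] at e
        have e3 : ⟪D, ξ⟫ - ⟪D, η⟫ = α * ⟪stretch k lam (a - b), ξ - η⟫ := by
          rw [← inner_sub_right, hD, real_inner_smul_left]
        rw [inner_neg_left]
        linarith) hδ0
  have hval : ∀ (Q ζ : STime k) (A : ℝ), ‖Q‖ = ‖D‖ → ‖ζ‖ < δ' → |A - ⟪Q, ζ⟫| < δ' → |A| < δ := by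
    intro Q ζ A hQ hζ hA
    have e1 := abs_real_inner_le_norm Q ζ
    have e2 : ‖Q‖ * ‖ζ‖ ≤ ‖D‖ * δ' := by rw [hQ]; gcongr
    have e3 := abs_add_le (A - ⟪Q, ζ⟫) ⟪Q, ζ⟫
    rw [sub_add_cancel] at e3
    nlinarith
  have hdist : ∀ (c : ℝ × Euc k) (ζ : STime k), ‖ζ‖ < δ' → dist (c + unstretch k lam ζ) c < δ := by
    intro c ζ hζ
    rw [dist_eq_norm, add_sub_cancel_left]
    exact ((norm_unstretch_le hlam ζ).trans_lt hζ).trans_le hδ2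
  have hlift : ∀ (c : ℝ × Euc k) (ζ : STime k),
      Tendsto (fun z => stretch k lam (z - (c + unstretch k lam ζ)))
        (𝓝 (c + unstretch k lam ζ)) (𝓝 0) := by
    intro c ζ
    have : Continuous fun z => stretch k lam (z - (c + unstretch k lam ζ)) := by fun_prop
    simpa using this.tendsto (c + unstretch k lam ζ)
  have hback : ∀ (c z : ℝ × Euc k) (ζ : STime k),
      c + unstretch k lam (ζ + stretch k lam (z - (c + unstretch k lam ζ))) = z := by
    intro c z ζ
    rw [map_add, unstretch_stretch hl0]; abel
  refine ⟨a + unstretch k lam ξ, b + unstretch k lam η, p, p', X, Y, hdist _ _ h1, hdist _ _ h2,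
    hval D ξ _ rfl h1 ?_, hval (-D) η _ (norm_neg _) h2 ?_, h5.trans_le hδ2, h6.trans_le hδ2,
    ?_, ?_, fun h h' => (h9 h h').trans (by gcongr)⟩
  · convert h3 using 2; ring
  · convert h4 using 2; ring
  · filter_upwards [(hlift a ξ).eventually h7] with z hz
    rw [hback] at hz
    rw [inner_add_left]
    rw [inner_add_right] at hz
    linarith
  · filter_upwards [(hlift b η).eventually h8] with z hz
    rw [hback] at hz
    rw [inner_add_left]
    rw [inner_add_right] at hz
    linarith

end TouchingQuadratics

section LocalComparison

open Filter Topology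
open scoped RealInnerProductSpace

variable {k d : ℕ}

/-- Drift and diffusion coefficients gathered in one map on space-time. -/
def coeffMap (b : ℝ → Euc k → Fin k → ℝ) (σm : ℝ → Euc k → Matrix (Fin k) (Fin d) ℝ)
    (z : ℝ × Euc k) : (Fin k → ℝ) × (Fin d → Euc k) :=
  (b z.1 z.2, fun l => sigCol σm z l)

theorem continuous_sigCol {σm : ℝ → Euc k → Matrix (Fin k) (Fin d) ℝ}
    (hσ : Continuous fun p : ℝ × Euc k => σm p.1 p.2) (l : Fin d) :
    Continuous fun z => sigCol σm z l := by
  unfold sigCol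
  exact (PiLp.continuous_toLp 2 _).comp (continuous_pi fun i => hσ.matrix_elem i l)

theorem continuous_coeffMap {b : ℝ → Euc k → Fin k → ℝ}
    {σm : ℝ → Euc k → Matrix (Fin k) (Fin d) ℝ} (hb : Continuous fun p : ℝ × Euc k => b p.1 p.2)
    (hσ : Continuous fun p : ℝ × Euc k => σm p.1 p.2) : Continuous (coeffMap b σm) :=
  hb.prodMk (continuous_pi fun l => continuous_sigCol hσ l)

theorem coeffMap_lipschitz {b : ℝ → Euc k → Fin k → ℝ}
    {σm : ℝ → Euc k → Matrix (Fin k) (Fin d) ℝ} {C : ℝ} (hC : 0 ≤ C)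
    (hLip : ∀ t (x x' : Euc k), (∀ i, |b t x i - b t x' i| ≤ C * ‖x - x'‖) ∧
      (∀ i l, |σm t x i l - σm t x' i l| ≤ C * ‖x - x'‖)) (t : ℝ) (x x' : Euc k) :
    ‖coeffMap b σm (t, x) - coeffMap b σm (t, x')‖ ≤ (k + 1) * C * ‖x - x'‖ := by
  have hk : (0 : ℝ) ≤ k := k.cast_nonneg
  have hCx : 0 ≤ C * ‖x - x'‖ := by positivity
  rw [Prod.norm_def]
  refine max_le ?_ ?_
  · rw [pi_norm_le_iff_of_nonneg (by positivity)]
    intro i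
    have := (hLip t x x').1 i
    simp only [coeffMap, Prod.fst_sub, Pi.sub_apply, Real.norm_eq_abs]
    nlinarith
  · rw [pi_norm_le_iff_of_nonneg (by positivity)]
    intro l
    simp only [coeffMap, Prod.snd_sub, Pi.sub_apply, sigCol_eq_sum, ← Finset.sum_sub_distrib,
      ← sub_smul]
    calc _ ≤ ∑ i : Fin k, ‖(σm t x i l - σm t x' i l) • EuclideanSpace.single i (1 : ℝ)‖ :=
          norm_sum_le _ _
      _ ≤ ∑ _i : Fin k, C * ‖x - x'‖ := by
          refine Finset.sum_le_sum fun i _ => ?_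
          rw [norm_smul, PiLp.norm_single]
          simpa using (hLip t x x').2 i l
      _ ≤ _ := by simp; nlinarith

/-- Upper bound for the difference of the generators of two touching quadratics. -/
def genGap (b : ℝ → Euc k → Fin k → ℝ) (σm : ℝ → Euc k → Matrix (Fin k) (Fin d) ℝ)
    (κ lam α : ℝ) (z₀ : ℝ × Euc k) (D : STime k)
    (q : (ℝ × Euc k) × (ℝ × Euc k) × STime k × STime k × ℝ) : ℝ :=
  2 * κ * (q.1.1 - z₀.1) + 2 * κ * (q.2.1.1 - z₀.1) + lam * (q.2.2.1.fst + q.2.2.2.1.fst)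
    + ∑ l, (κ * (‖sigCol σm q.1 l‖ ^ 2 + ‖sigCol σm q.2.1 l‖ ^ 2)
        + α * ‖sigCol σm q.1 l - sigCol σm q.2.1 l‖ ^ 2
        + q.2.2.2.2 / 2 * (‖sigCol σm q.1 l‖ ^ 2 + ‖sigCol σm q.2.1 l‖ ^ 2))
    + ∑ i, (b q.1.1 q.1.2 i * (2 * κ * (q.1.2 - z₀.2) i + (D + q.2.2.1).snd i)
        - b q.2.1.1 q.2.1.2 i * (2 * -κ * (q.2.1.2 - z₀.2) i + (D - q.2.2.2.1).snd i))

/-- Difference of the gradients, seen through `σ`, of two touching quadratics. -/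
def gradGap (σm : ℝ → Euc k → Matrix (Fin k) (Fin d) ℝ)
    (κ : ℝ) (z₀ : ℝ × Euc k) (D : STime k) (l : Fin d)
    (q : (ℝ × Euc k) × (ℝ × Euc k) × STime k × STime k × ℝ) : ℝ :=
  ∑ i, (σm q.1.1 q.1.2 i l * (2 * κ * (q.1.2 - z₀.2) i + (D + q.2.2.1).snd i)
        - σm q.2.1.1 q.2.1.2 i l * (2 * -κ * (q.2.1.2 - z₀.2) i + (D - q.2.2.2.1).snd i))

theorem continuous_stime_fst : Continuous fun w : STime k => w.fst :=
  continuous_fst.comp (WithLp.prod_continuous_ofLp 2 ℝ (Euc k))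

theorem continuous_stime_snd : Continuous fun w : STime k => w.snd :=
  continuous_snd.comp (WithLp.prod_continuous_ofLp 2 ℝ (Euc k))

theorem continuous_gradGap {σm : ℝ → Euc k → Matrix (Fin k) (Fin d) ℝ}
    (hσ : Continuous fun p : ℝ × Euc k => σm p.1 p.2)
    (κ : ℝ) (z₀ : ℝ × Euc k) (D : STime k) (l : Fin d) : Continuous (gradGap σm κ z₀ D l) := by
  unfold gradGap
  have h2 : ∀ i, Continuous fun z : ℝ × Euc k => σm z.1 z.2 i l := fun i => hσ.matrix_elem i l
  refine continuous_finsetSum _ fun i _ => ?_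
  have h3 : Continuous fun w : STime k => (D + w).snd i :=
    (EuclideanSpace.proj i).continuous.comp (continuous_stime_snd.comp (continuous_const_add D))
  have h4 : Continuous fun w : STime k => (D - w).snd i :=
    (EuclideanSpace.proj i).continuous.comp (continuous_stime_snd.comp (continuous_sub_left D))
  exact (((h2 i).comp continuous_fst).mul (Continuous.add (by fun_prop)
      (h3.comp (by fun_prop)))).sub (((h2 i).comp (by fun_prop)).mul
      (Continuous.add (by fun_prop) (h4.comp (by fun_prop))))

theorem continuous_genGap {b : ℝ → Euc k → Fin k → ℝ}
    {σm : ℝ → Euc k → Matrix (Fin k) (Fin d) ℝ} (hb : Continuous fun p : ℝ × Euc k => b p.1 p.2)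
    (hσ : Continuous fun p : ℝ × Euc k => σm p.1 p.2)
    (κ lam α : ℝ) (z₀ : ℝ × Euc k) (D : STime k) : Continuous (genGap b σm κ lam α z₀ D) := by
  unfold genGap
  have h1 := fun l => continuous_sigCol hσ l
  have h2 : ∀ i, Continuous fun z : ℝ × Euc k => b z.1 z.2 i := fun i => (continuous_apply i).comp hb
  have h0 := continuous_stime_fst (k := k)
  refine (((Continuous.add (by fun_prop) (by fun_prop)).add
    (continuous_const.mul ((h0.comp (by fun_prop)).add (h0.comp (by fun_prop))))).add
    (continuous_finsetSum _ fun l _ => ?_)).add (continuous_finsetSum _ fun i _ => ?_)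
  · have := h1 l
    fun_prop
  · have h3 : Continuous fun w : STime k => (D + w).snd i :=
      (EuclideanSpace.proj i).continuous.comp (continuous_stime_snd.comp (continuous_const_add D))
    have h4 : Continuous fun w : STime k => (D - w).snd i :=
      (EuclideanSpace.proj i).continuous.comp (continuous_stime_snd.comp (continuous_sub_left D))
    exact (((h2 i).comp continuous_fst).mul (Continuous.add (by fun_prop)
      (h3.comp (by fun_prop)))).sub (((h2 i).comp (by fun_prop)).mul
      (Continuous.add (by fun_prop) (h4.comp (by fun_prop))))

theorem quadTest_gen_sub_le (b : ℝ → Euc k → Fin k → ℝ)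
    (σm : ℝ → Euc k → Matrix (Fin k) (Fin d) ℝ) {κ lam α δ : ℝ} (z₀ z₁ z₂ : ℝ × Euc k)
    (D p p' : STime k) (X Y : STime k →L[ℝ] STime k)
    (hXY : ∀ h h', ⟪X h, h⟫ + ⟪Y h', h'⟫ ≤ 2 * α * ‖h - h'‖ ^ 2 + δ * (‖h‖ ^ 2 + ‖h'‖ ^ 2)) :
    (timeDeriv (fun t x => quadTest κ lam z₀ z₁ (D + p) X (t, x)) z₁.1 z₁.2
      + genL b σm (fun t x => quadTest κ lam z₀ z₁ (D + p) X (t, x)) z₁.1 z₁.2)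
    - (timeDeriv (fun t x => quadTest (-κ) lam z₀ z₂ (D - p') (-Y) (t, x)) z₂.1 z₂.2
      + genL b σm (fun t x => quadTest (-κ) lam z₀ z₂ (D - p') (-Y) (t, x)) z₂.1 z₂.2)
    ≤ genGap b σm κ lam α z₀ D (z₁, z₂, p, p', δ) := by
  simp only [timeDeriv_quadTest, genL_quadTest, genGap]
  have h1 : ∑ l, (κ * ‖sigCol σm z₁ l‖ ^ 2
          + ⟪X (spaceDir k (sigCol σm z₁ l)), spaceDir k (sigCol σm z₁ l)⟫ / 2)
      - ∑ l, (-κ * ‖sigCol σm z₂ l‖ ^ 2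
          + ⟪(-Y) (spaceDir k (sigCol σm z₂ l)), spaceDir k (sigCol σm z₂ l)⟫ / 2)
      ≤ ∑ l, (κ * (‖sigCol σm z₁ l‖ ^ 2 + ‖sigCol σm z₂ l‖ ^ 2)
        + α * ‖sigCol σm z₁ l - sigCol σm z₂ l‖ ^ 2
        + δ / 2 * (‖sigCol σm z₁ l‖ ^ 2 + ‖sigCol σm z₂ l‖ ^ 2)) := by
    rw [← Finset.sum_sub_distrib]
    refine Finset.sum_le_sum fun l _ => ?_
    have := hXY (spaceDir k (sigCol σm z₁ l)) (spaceDir k (sigCol σm z₂ l))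
    rw [← map_sub, norm_spaceDir, norm_spaceDir, norm_spaceDir] at this
    rw [_root_.neg_apply, inner_neg_left]
    linarith
  rw [Finset.sum_sub_distrib (f := fun i => b z₁.1 z₁.2 i * _)]
  have e1 : (D + p).fst = D.fst + p.fst := rfl
  have e2 : (D - p').fst = D.fst - p'.fst := rfl
  rw [e1, e2]
  linarith

theorem quadTest_grad_sub (σm : ℝ → Euc k → Matrix (Fin k) (Fin d) ℝ) {κ lam δ : ℝ}
    (z₀ z₁ z₂ : ℝ × Euc k) (D p p' : STime k) (X Y : STime k →L[ℝ] STime k) (l : Fin d) :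
    sigGrad σm (fun t x => quadTest κ lam z₀ z₁ (D + p) X (t, x)) z₁.1 z₁.2 l
      - sigGrad σm (fun t x => quadTest (-κ) lam z₀ z₂ (D - p') (-Y) (t, x)) z₂.1 z₂.2 l
    = gradGap σm κ z₀ D l (z₁, z₂, p, p', δ) := by
  simp only [sigGrad_quadTest, gradGap, Finset.sum_sub_distrib]

end LocalComparison

section LocalComparisonMain

open Filter Topology
open scoped RealInnerProductSpace

variable {k d : ℕ}

theorem exists_time_scale {W : Type*} [NormedAddCommGroup W] {c : ℝ × Euc k → W}
    (hc : Continuous c) {C : ℝ}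
    (hLip : ∀ t (x x' : Euc k), ‖c (t, x) - c (t, x')‖ ≤ C * ‖x - x'‖) (z₀ : ℝ × Euc k) (r : ℝ)
    {η : ℝ} (hη : 0 < η) :
    ∃ lam : ℝ, 1 ≤ lam ∧ ∀ z ∈ Metric.closedBall z₀ r, ∀ z' ∈ Metric.closedBall z₀ r,
      ‖stretch k lam (z - z')‖ ^ 2 ≤ 2 → ‖c z - c z'‖ ≤ η + C * ‖z.2 - z'.2‖ := by
  have huc := (isCompact_closedBall z₀ r).uniformContinuousOn_of_continuous hc.continuousOn
  rw [Metric.uniformContinuousOn_iff] at huc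
  obtain ⟨ρ, hρ, h⟩ := huc η hη
  refine ⟨1 + 2 / ρ, by simp; positivity, fun z hz z' hz' hle => ?_⟩
  have h1 : (z.1, z'.2) ∈ Metric.closedBall z₀ r := by
    rw [Metric.mem_closedBall, Prod.dist_eq, max_le_iff] at *
    exact ⟨hz.1, hz'.2⟩
  rw [stime_norm_sq] at hle
  simp only [stretch_fst, Prod.fst_sub] at hle
  have h2 : |z.1 - z'.1| < ρ := by
    by_contra! hcon
    have e1 : ((1 + 2 / ρ) * (z.1 - z'.1)) ^ 2 ≤ 2 := by
      nlinarith [sq_nonneg ‖(stretch k (1 + 2 / ρ) (z - z')).snd‖]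
    have e2 : (1 + 2 / ρ) * ρ = ρ + 2 := by field_simp
    have e3 : ρ + 2 ≤ (1 + 2 / ρ) * |z.1 - z'.1| := by rw [← e2]; gcongr
    have e4 : ((1 + 2 / ρ) * (z.1 - z'.1)) ^ 2 = ((1 + 2 / ρ) * |z.1 - z'.1|) ^ 2 := by
      rw [mul_pow, mul_pow, sq_abs]
    nlinarith
  have h3 : ‖c z - c (z.1, z'.2)‖ ≤ C * ‖z.2 - z'.2‖ := hLip z.1 z.2 z'.2
  have h4 : ‖c (z.1, z'.2) - c z'‖ ≤ η := by
    rw [← dist_eq_norm]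
    refine (h _ h1 _ hz' ?_).le
    rw [Prod.dist_eq]
    simpa [Real.dist_eq] using h2
  calc ‖c z - c z'‖ = ‖(c z - c (z.1, z'.2)) + (c (z.1, z'.2) - c z')‖ := by congr 1; abel
    _ ≤ _ := norm_add_le _ _
    _ ≤ _ := by linarith

theorem euc_coord_abs_le (x : Euc k) (i : Fin k) : |x i| ≤ ‖x‖ := by
  simpa using PiLp.norm_apply_le x i

theorem local_comparison {b : ℝ → Euc k → Fin k → ℝ}
    {σm : ℝ → Euc k → Matrix (Fin k) (Fin d) ℝ} (hb : Continuous fun p : ℝ × Euc k => b p.1 p.2)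
    (hσ : Continuous fun p : ℝ × Euc k => σm p.1 p.2) {C : ℝ} (hC : 0 ≤ C)
    (hLip : ∀ t (x x' : Euc k), (∀ i, |b t x i - b t x' i| ≤ C * ‖x - x'‖) ∧
      (∀ i l, |σm t x i l - σm t x' i l| ≤ C * ‖x - x'‖))
    {z₀ : ℝ × Euc k} {r : ℝ} (hr : 0 < r) {U V : ℝ × Euc k → ℝ}
    (hU : UpperSemicontinuousOn U (Metric.closedBall z₀ r))
    (hV : UpperSemicontinuousOn V (Metric.closedBall z₀ r))
    (h0 : U z₀ + V z₀ = 0) (hle : ∀ z ∈ Metric.closedBall z₀ r, U z + V z ≤ 0)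
    {ε : ℝ} (hε : 0 < ε) :
    ∃ (z₁ z₂ : ℝ × Euc k) (φ ψ : ℝ → Euc k → ℝ), dist z₁ z₀ < ε ∧ dist z₂ z₀ < ε ∧
      |U z₁ - U z₀| < ε ∧ |V z₂ - V z₀| < ε ∧ IsC12 φ ∧ IsC12 ψ ∧
      IsLocalMax (fun z : ℝ × Euc k => U z - φ z.1 z.2) z₁ ∧
      IsLocalMax (fun z : ℝ × Euc k => V z + ψ z.1 z.2) z₂ ∧
      (timeDeriv φ z₁.1 z₁.2 + genL b σm φ z₁.1 z₁.2)
        - (timeDeriv ψ z₂.1 z₂.2 + genL b σm ψ z₂.1 z₂.2) < ε ∧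
      ∀ l, |sigGrad σm φ z₁.1 z₁.2 l - sigGrad σm ψ z₂.1 z₂.2 l| < ε := by
  set c := coeffMap b σm with hc
  have hcc : Continuous c := continuous_coeffMap hb hσ
  have hclip : ∀ t (x x' : Euc k), ‖c (t, x) - c (t, x')‖ ≤ (k + 1) * C * ‖x - x'‖ :=
    coeffMap_lipschitz hC hLip
  set C' : ℝ := (k + 1) * C with hC'
  have hC'0 : 0 ≤ C' := by positivity
  -- weight of the localization
  set S : ℝ := ∑ l, (‖sigCol σm z₀ l‖ ^ 2 + ‖sigCol σm z₀ l‖ ^ 2) with hS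
  have hS0 : 0 ≤ S := Finset.sum_nonneg fun l _ => by positivity
  obtain ⟨κ, hκ, hκS⟩ : ∃ κ : ℝ, 0 < κ ∧ κ * S < ε := by
    refine ⟨ε / (S + 1), by positivity, ?_⟩
    rw [div_mul_eq_mul_div, div_lt_iff₀ (by positivity)]
    nlinarith
  set N : ℝ × Euc k → ℝ := fun z => κ * ((z.1 - z₀.1) ^ 2 + ‖z.2 - z₀.2‖ ^ 2) with hN
  have hNc : Continuous N := by fun_prop
  have hN0 : N z₀ = 0 := by simp [hN]
  have hNpos : ∀ z, z ≠ z₀ → 0 < N z := by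
    intro z hz
    have h1 : 0 ≤ (z.1 - z₀.1) ^ 2 := sq_nonneg _
    have h2 : 0 ≤ ‖z.2 - z₀.2‖ ^ 2 := sq_nonneg _
    refine mul_pos hκ (lt_of_le_of_ne (by positivity) fun h => hz ?_)
    have h3 : (z.1 - z₀.1) ^ 2 = 0 := by linarith
    have h4 : ‖z.2 - z₀.2‖ ^ 2 = 0 := by linarith
    rw [sq_eq_zero_iff, sub_eq_zero] at h3
    rw [sq_eq_zero_iff, norm_eq_zero, sub_eq_zero] at h4
    exact Prod.ext h3 h4
  choose lam hlam1 hlam using fun n : ℕ =>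
    exists_time_scale hcc hclip z₀ r (η := 1 / ((n : ℝ) + 1)) (by positivity)
  set U' : ℝ × Euc k → ℝ := fun z => U z + -N z with hU'
  set V' : ℝ × Euc k → ℝ := fun z => V z + -N z with hV'
  have hU'c : UpperSemicontinuousOn U' (Metric.closedBall z₀ r) :=
    hU.add hNc.neg.continuousOn.upperSemicontinuousOn
  have hV'c : UpperSemicontinuousOn V' (Metric.closedBall z₀ r) :=
    hV.add hNc.neg.continuousOn.upperSemicontinuousOn
  have hstr : ∀ l : ℝ, 1 ≤ l → ∀ z : ℝ × Euc k,
      ‖stretch k 1 z‖ ^ 2 ≤ ‖stretch k l z‖ ^ 2 := by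
    intro l hl z
    rw [stime_norm_sq, stime_norm_sq]
    simp only [stretch_fst, stretch_snd, one_mul, mul_pow]
    nlinarith [sq_nonneg z.1, mul_le_mul hl hl zero_le_one (by linarith)]
  obtain ⟨z, z', hB, hmax, hz, hz', hUz, hVz, hpen⟩ :=
    exists_penalized_maximizers (isCompact_closedBall z₀ r) (Metric.mem_closedBall_self hr.le)
      hU'c hV'c (by simp [hU', hV', hN0, h0])
      (fun y hy hne => by have := hle y hy; have := hNpos y hne; simp only [hU', hV']; linarith)
      (fun n y y' => ((n : ℝ) + 1) / 2 * ‖stretch k (lam n) (y - y')‖ ^ 2)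
      (fun n => by fun_prop) (fun n => by simp)
      (fun y y' => 1 / 2 * ‖stretch k 1 (y - y')‖ ^ 2) (by fun_prop)
      (fun y y' h => by
        have h1 : stretch k 1 (y - y') = 0 := by simpa using h
        have h2 := congrArg (unstretch k 1) h1
        rw [unstretch_stretch one_ne_zero, map_zero] at h2
        exact sub_eq_zero.1 h2)
      (fun y y' => by positivity)
      (fun n y y' => by
        have := hstr _ (hlam1 n) (y - y')
        have h2 : (0 : ℝ) < n + 1 := by positivity
        nlinarith)
  -- asymptotics of the doubled variables
  set α : ℕ → ℝ := fun n => (n : ℝ) + 1 with hα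
  have hα0 : ∀ n, 0 < α n := fun n => by positivity
  set e : ℕ → ℝ := fun n => ‖c (z n) - c (z' n)‖ with he
  set dd : ℕ → ℝ := fun n => ‖(z n).2 - (z' n).2‖ with hdd
  have hdlim : Tendsto (fun n => α n * dd n ^ 2) atTop (𝓝 0) := by
    refine squeeze_zero (fun n => by have := hα0 n; positivity) (fun n => ?_)
      ((mul_zero (2 : ℝ)) ▸ hpen.const_mul 2)
    have : dd n ^ 2 ≤ ‖stretch k (lam n) (z n - z' n)‖ ^ 2 := by
      rw [stime_norm_sq]
      simp only [stretch_snd, Prod.snd_sub, hdd]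
      nlinarith [sq_nonneg (stretch k (lam n) (z n - z' n)).fst]
    have h2 := hα0 n
    simp only [hα] at h2 ⊢
    nlinarith
  have helim : Tendsto (fun n => α n * e n ^ 2) atTop (𝓝 0) := by
    have h1 : Tendsto (fun n => 2 * (1 / α n) + 2 * C' ^ 2 * (α n * dd n ^ 2)) atTop (𝓝 0) := by
      simpa using (tendsto_one_div_add_atTop_nhds_zero_nat.const_mul 2).add
        (hdlim.const_mul (2 * C' ^ 2))
    refine squeeze_zero' (Eventually.of_forall fun n => by have := hα0 n; positivity) ?_ h1
    filter_upwards [hpen.eventually (ge_mem_nhds (show (0 : ℝ) < 1 by norm_num))] with n hn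
    have h2 : ‖stretch k (lam n) (z n - z' n)‖ ^ 2 ≤ 2 := by
      have : (0 : ℝ) ≤ n := n.cast_nonneg
      nlinarith [sq_nonneg ‖stretch k (lam n) (z n - z' n)‖]
    have h3 : e n ≤ 1 / α n + C' * dd n := hlam n _ (hB n).1 _ (hB n).2 h2
    have h4 : e n ^ 2 ≤ 2 * (1 / α n) ^ 2 + 2 * (C' * dd n) ^ 2 := by
      have : 0 ≤ e n := norm_nonneg _
      nlinarith [sq_nonneg (1 / α n - C' * dd n)]
    have h5 : α n * (1 / α n) ^ 2 = 1 / α n := by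
      have := (hα0 n).ne'
      field_simp
    calc α n * e n ^ 2 ≤ α n * (2 * (1 / α n) ^ 2 + 2 * (C' * dd n) ^ 2) :=
          mul_le_mul_of_nonneg_left h4 (hα0 n).le
      _ = 2 * (α n * (1 / α n) ^ 2) + 2 * C' ^ 2 * (α n * dd n ^ 2) := by ring
      _ = _ := by rw [h5]
  have hcross : ∀ (A : ℕ → ℝ), (∀ n, |A n| ≤ e n) → ∀ i,
      Tendsto (fun n => α n * (A n * ((z n).2 - (z' n).2) i)) atTop (𝓝 0) := by
    intro A hA i
    have h1 : Tendsto (fun n => (α n * e n ^ 2 + α n * dd n ^ 2) / 2) atTop (𝓝 0) := by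
      simpa using (helim.add hdlim).div_const 2
    refine squeeze_zero_norm (fun n => ?_) h1
    rw [norm_mul, norm_mul, Real.norm_of_nonneg (hα0 n).le, Real.norm_eq_abs, Real.norm_eq_abs]
    have h2 := euc_coord_abs_le ((z n).2 - (z' n).2) i
    have h3 : |A n| * |((z n).2 - (z' n).2) i| ≤ e n * dd n :=
      mul_le_mul (hA n) h2 (abs_nonneg _) ((abs_nonneg _).trans (hA n))
    nlinarith [hα0 n, sq_nonneg (e n - dd n), mul_le_mul_of_nonneg_left h3 (hα0 n).le,
      mul_nonneg (hα0 n).le (sq_nonneg (e n - dd n))]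
  have hcol : ∀ n l, ‖sigCol σm (z n) l - sigCol σm (z' n) l‖ ≤ e n := fun n l =>
    (norm_le_pi_norm (c (z n) - c (z' n)).2 l).trans (norm_snd_le _)
  have hbcol : ∀ n i, |b (z n).1 (z n).2 i - b (z' n).1 (z' n).2 i| ≤ e n := fun n i =>
    (norm_le_pi_norm (c (z n) - c (z' n)).1 i).trans (norm_fst_le _)
  have hscol : ∀ n i l, |σm (z n).1 (z n).2 i l - σm (z' n).1 (z' n).2 i l| ≤ e n := fun n i l =>
    (euc_coord_abs_le (sigCol σm (z n) l - sigCol σm (z' n) l) i).trans (hcol n l)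
  set Dn : ℕ → STime k := fun n => α n • stretch k (lam n) (z n - z' n) with hDn
  have hDn2 : ∀ n i, (Dn n).snd i = α n * ((z n).2 - (z' n).2) i := fun n i => rfl
  have hbz : ∀ i, Continuous fun y : ℝ × Euc k => b y.1 y.2 i := fun i =>
    (continuous_apply i).comp hb
  have hsz : ∀ i l, Continuous fun y : ℝ × Euc k => σm y.1 y.2 i l := fun i l =>
    hσ.matrix_elem i l
  have hzt : Tendsto (fun n => (z n).1 - z₀.1) atTop (𝓝 0) := by
    simpa using ((continuous_fst.tendsto _).comp hz).sub_const z₀.1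
  have hzt' : Tendsto (fun n => (z' n).1 - z₀.1) atTop (𝓝 0) := by
    simpa using ((continuous_fst.tendsto _).comp hz').sub_const z₀.1
  have hcoord : ∀ i, Continuous fun y : ℝ × Euc k => (y.2 - z₀.2) i := fun i => by fun_prop
  have hzx : ∀ i, Tendsto (fun n => ((z n).2 - z₀.2) i) atTop (𝓝 0) := fun i => by
    have := ((hcoord i).tendsto z₀).comp hz
    rwa [sub_self] at this
  have hzx' : ∀ i, Tendsto (fun n => ((z' n).2 - z₀.2) i) atTop (𝓝 0) := fun i => by
    have := ((hcoord i).tendsto z₀).comp hz'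
    rwa [sub_self] at this
  have hmix : ∀ (a : ℝ × Euc k → ℝ), Continuous a →
      (∀ n, |a (z n) - a (z' n)| ≤ e n) → ∀ i, Tendsto (fun n =>
      a (z n) * (2 * κ * ((z n).2 - z₀.2) i + (Dn n + 0).snd i)
        - a (z' n) * (2 * -κ * ((z' n).2 - z₀.2) i + (Dn n - 0).snd i)) atTop (𝓝 0) := by
    intro a ha hae i
    have h1 := (((ha.tendsto z₀).comp hz).mul ((hzx i).const_mul (2 * κ))).add
      ((((ha.tendsto z₀).comp hz').mul ((hzx' i).const_mul (2 * κ))).add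
        (hcross (fun n => a (z n) - a (z' n)) hae i))
    simp only [mul_zero, add_zero] at h1
    refine h1.congr fun n => ?_
    rw [add_zero, sub_zero, hDn2]
    simp only [Function.comp_apply]
    ring
  have hgen : Tendsto (fun n => genGap b σm κ (lam n) (α n) z₀ (Dn n) (z n, z' n, 0, 0, 0))
      atTop (𝓝 (κ * S)) := by
    have h1 : Tendsto (fun n => ∑ l, (κ * (‖sigCol σm (z n) l‖ ^ 2 + ‖sigCol σm (z' n) l‖ ^ 2)
        + α n * ‖sigCol σm (z n) l - sigCol σm (z' n) l‖ ^ 2)) atTop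
        (𝓝 (∑ l, (κ * (‖sigCol σm z₀ l‖ ^ 2 + ‖sigCol σm z₀ l‖ ^ 2) + 0))) := by
      refine tendsto_finsetSum _ fun l _ => Tendsto.add ?_ ?_
      · have h2 := (continuous_sigCol hσ l).norm.pow 2
        exact (((h2.tendsto z₀).comp hz).add ((h2.tendsto z₀).comp hz')).const_mul κ
      · refine squeeze_zero (fun n => by have := hα0 n; positivity) (fun n => ?_) helim
        have := hα0 n
        gcongr
        exact hcol n l
    have h2 := (((hzt.const_mul (2 * κ)).add (hzt'.const_mul (2 * κ))).add h1).add
      (tendsto_finsetSum Finset.univ fun i _ => hmix _ (hbz i) (fun n => hbcol n i) i)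
    have h3 : (2 * κ * 0 + 2 * κ * 0 + ∑ l, (κ * (‖sigCol σm z₀ l‖ ^ 2 + ‖sigCol σm z₀ l‖ ^ 2) + 0)
        + ∑ _i : Fin k, (0 : ℝ)) = κ * S := by
      simp [hS, Finset.mul_sum]
    rw [h3] at h2
    refine h2.congr fun n => ?_
    have e0 : (0 : STime k).fst = 0 := rfl
    simp [genGap, e0]
  have hgrad : ∀ l, Tendsto (fun n => gradGap σm κ z₀ (Dn n) l (z n, z' n, 0, 0, 0))
      atTop (𝓝 0) := by
    intro l
    have := tendsto_finsetSum Finset.univ fun i _ =>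
      hmix _ (hsz i l) (fun n => hscol n i l) i
    simpa [gradGap] using this
  -- choice of the penalization parameter
  have hNz : Tendsto (fun n => N (z n)) atTop (𝓝 0) := by
    exact hN0 ▸ (hNc.tendsto z₀).comp hz
  have hNz' : Tendsto (fun n => N (z' n)) atTop (𝓝 0) := by
    exact hN0 ▸ (hNc.tendsto z₀).comp hz'
  have hUl : Tendsto (fun n => |U' (z n) - U z₀| + |N (z n)|) atTop (𝓝 0) := by
    simpa [hU', hN0] using (hUz.sub_const (U z₀)).abs.add hNz.abs
  have hVl : Tendsto (fun n => |V' (z' n) - V z₀| + |N (z' n)|) atTop (𝓝 0) := by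
    simpa [hV', hN0] using (hVz.sub_const (V z₀)).abs.add hNz'.abs
  have hmin : 0 < min r (ε / 2) := by positivity
  have hev : ∀ᶠ n in atTop, dist (z n) z₀ < min r (ε / 2) ∧ dist (z' n) z₀ < min r (ε / 2) ∧
      |U' (z n) - U z₀| + |N (z n)| < ε / 2 ∧ |V' (z' n) - V z₀| + |N (z' n)| < ε / 2 ∧
      genGap b σm κ (lam n) (α n) z₀ (Dn n) (z n, z' n, 0, 0, 0) < ε ∧
      ∀ l, |gradGap σm κ z₀ (Dn n) l (z n, z' n, 0, 0, 0)| < ε := by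
    refine (Metric.tendsto_nhds.1 hz _ hmin).and ((Metric.tendsto_nhds.1 hz' _ hmin).and
      ((hUl.eventually_lt_const (by positivity)).and ((hVl.eventually_lt_const (by positivity)).and
      ((hgen.eventually_lt_const hκS).and (eventually_all.2 fun l => ?_)))))
    exact (hgrad l).abs.eventually_lt_const (by simpa using hε)
  obtain ⟨n, hn1, hn2, hn3, hn4, hn5, hn6⟩ := hev.exists
  have hcont : ∀ᶠ q in 𝓝 ((z n, z' n, 0, 0, 0) :
      (ℝ × Euc k) × (ℝ × Euc k) × STime k × STime k × ℝ),
      genGap b σm κ (lam n) (α n) z₀ (Dn n) q < ε ∧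
      (∀ l, |gradGap σm κ z₀ (Dn n) l q| < ε) ∧
      |N q.1 - N (z n)| < ε / 4 ∧ |N q.2.1 - N (z' n)| < ε / 4 := by
    have hε4 : 0 < ε / 4 := by positivity
    refine (((continuous_genGap hb hσ κ (lam n) (α n) z₀ (Dn n)).tendsto _).eventually_lt_const
      hn5).and ((eventually_all.2 fun l => ((continuous_gradGap hσ κ z₀ (Dn n) l).abs.tendsto
      _).eventually_lt_const (hn6 l)).and (?_))
    have h1 : Continuous fun q : (ℝ × Euc k) × (ℝ × Euc k) × STime k × STime k × ℝ =>
      |N q.1 - N (z n)| := by fun_prop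
    have h2 : Continuous fun q : (ℝ × Euc k) × (ℝ × Euc k) × STime k × STime k × ℝ =>
      |N q.2.1 - N (z' n)| := by fun_prop
    exact ((h1.tendsto _).eventually_lt_const (by simpa using hε4)).and
      ((h2.tendsto _).eventually_lt_const (by simpa using hε4))
  obtain ⟨ρ, hρ, hball⟩ := Metric.eventually_nhds_iff.1 hcont
  set δ : ℝ := min (ρ / 2) (ε / 4) with hδ
  have hδ0 : 0 < δ := by positivity
  have hδρ : δ < ρ := (min_le_left _ _).trans_lt (by linarith)
  have hδε : δ ≤ ε / 4 := min_le_right _ _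
  obtain ⟨z₁, z₂, p, p', X, Y, k1, k2, k3, k4, k5, k6, k7, k8, k9⟩ :=
    exists_touching_quadratics (hα0 n) (hlam1 n) hU'c hV'c
      (Metric.mem_ball.2 (hn1.trans_le (min_le_left _ _)))
      (Metric.mem_ball.2 (hn2.trans_le (min_le_left _ _))) (hmax n) hδ0
  obtain ⟨g1, g2, g3, g4⟩ := @hball (z₁, z₂, p, p', δ) (by
    refine max_lt (k1.trans hδρ) (max_lt (k2.trans hδρ) (max_lt ?_ (max_lt ?_ ?_)))
    · rw [dist_zero_right]; exact k5.trans hδρ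
    · rw [dist_zero_right]; exact k6.trans hδρ
    · rw [dist_zero_right, Real.norm_of_nonneg hδ0.le]; exact hδρ)
  simp only at g3 g4
  refine ⟨z₁, z₂, fun t x => quadTest κ (lam n) z₀ z₁ (Dn n + p) X (t, x),
    fun t x => quadTest (-κ) (lam n) z₀ z₂ (Dn n - p') (-Y) (t, x), ?_, ?_, ?_, ?_,
    IsC12.of_contDiff (contDiff_quadTest _ _ _ _ _ _),
    IsC12.of_contDiff (contDiff_quadTest _ _ _ _ _ _), ?_, ?_,
    (quadTest_gen_sub_le b σm z₀ z₁ z₂ (Dn n) p p' X Y k9).trans_lt g1, fun l => ?_⟩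
  · have := dist_triangle z₁ (z n) z₀
    have := min_le_right r (ε / 2)
    linarith
  · have := dist_triangle z₂ (z' n) z₀
    have := min_le_right r (ε / 2)
    linarith
  · have e1 : U z₁ - U z₀ = (U' z₁ - U' (z n)) + (U' (z n) - U z₀) + (N z₁ - N (z n)) + N (z n) := by
      simp only [hU']; ring
    rw [e1]
    refine ((abs_add_le _ _).trans (add_le_add_left ((abs_add_le _ _).trans
      (add_le_add_left (abs_add_le _ _) _)) _)).trans_lt ?_
    linarith
  · have e1 : V z₂ - V z₀ = (V' z₂ - V' (z' n)) + (V' (z' n) - V z₀) + (N z₂ - N (z' n))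
        + N (z' n) := by
      simp only [hV']; ring
    rw [e1]
    refine ((abs_add_le _ _).trans (add_le_add_left ((abs_add_le _ _).trans
      (add_le_add_left (abs_add_le _ _) _)) _)).trans_lt ?_
    linarith
  · filter_upwards [k7] with y hy
    simp only [quadTest, sub_self, map_zero, inner_zero_right, hU', hN] at hy ⊢
    linarith
  · filter_upwards [k8] with y hy
    simp only [quadTest, sub_self, map_zero, inner_zero_right, hV', hN, _root_.neg_apply,
      inner_neg_left] at hy ⊢
    have e2 : ⟪Dn n - p', stretch k (lam n) (y - z₂)⟫
        = -⟪-(Dn n) + p', stretch k (lam n) (y - z₂)⟫ := by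
      rw [← inner_neg_left]; congr 1; abel
    rw [e2]
    linarith
  · rw [quadTest_grad_sub (δ := δ)]
    exact g2 l

end LocalComparisonMain

section System

open scoped Topology

variable {k d : ℕ} {Γ1 Γ2 : Type} [Fintype Γ1] [Fintype Γ2] [DecidableEq Γ1] [DecidableEq Γ2]
  [Nontrivial Γ1] [Nontrivial Γ2]

/-- Coefficients of a switching system whose hypotheses hold for all times. -/
structure Sys (k d : ℕ) (Γ1 Γ2 : Type) [Fintype Γ1] [Fintype Γ2] [DecidableEq Γ1]
    [DecidableEq Γ2] where
  b : ℝ → Euc k → Fin k → ℝ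
  σm : ℝ → Euc k → Matrix (Fin k) (Fin d) ℝ
  f : Γ1 → Γ2 → ℝ → Euc k → ((Γ1 × Γ2) → ℝ) → (Fin d → ℝ) → ℝ
  gL : Γ1 → Γ1 → ℝ → Euc k → ℝ
  gU : Γ2 → Γ2 → ℝ → Euc k → ℝ
  b_cont : Continuous fun p : ℝ × Euc k => b p.1 p.2
  σ_cont : Continuous fun p : ℝ × Euc k => σm p.1 p.2
  lip : ∃ C : ℝ, 0 ≤ C ∧ ∀ t (x x' : Euc k), (∀ i, |b t x i - b t x' i| ≤ C * ‖x - x'‖) ∧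
    (∀ i l, |σm t x i l - σm t x' i l| ≤ C * ‖x - x'‖)
  growth : ∃ C : ℝ, 0 ≤ C ∧ ∀ t (x : Euc k), (∀ i, |b t x i| ≤ C * (1 + ‖x‖)) ∧
    (∀ i l, |σm t x i l| ≤ C * (1 + ‖x‖))
  f_cont : ∀ i j t (x : Euc k), ∀ ε > (0 : ℝ), ∃ η > (0 : ℝ), ∀ t' (x' : Euc k),
    dist (t', x') (t, x) < η → ∀ y z, |f i j t' x' y z - f i j t x y z| < ε
  f_growth : ∃ (C : ℝ) (m : ℕ), 0 ≤ C ∧ ∀ i j t x, |f i j t x 0 0| ≤ C * (1 + ‖x‖ ^ 2) ^ m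
  f_lip : ∃ C : ℝ, 0 ≤ C ∧ ∀ i j t x y y' z z',
    |f i j t x y z - f i j t x y' z'| ≤ C * (‖y - y'‖ + ‖z - z'‖)
  f_mono : ∀ i j t x y y' z, y ≤ y' → y (i, j) = y' (i, j) → f i j t x y z ≤ f i j t x y' z
  gL_nonneg : ∀ i i' t x, 0 ≤ gL i i' t x
  gU_nonneg : ∀ j j' t x, 0 ≤ gU j j' t x
  gL_cont : ∀ i i', Continuous fun p : ℝ × Euc k => gL i i' p.1 p.2
  gU_cont : ∀ j j', Continuous fun p : ℝ × Euc k => gU j j' p.1 p.2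
  nfl : ∀ M : ℕ, 2 ≤ M → ∀ p : ℕ → Γ1 × Γ2, p M = p 0 →
    (∀ q q', q < M → q' < M → p q = p q' → q = q') →
    (∀ q < M, (p q).1 = (p (q + 1)).1 ∨ (p q).2 = (p (q + 1)).2) →
    ∀ (t : ℝ) (x : Euc k), (∑ q ∈ Finset.range M,
        ((if (p q).1 = (p (q + 1)).1 then 0 else -gL (p q).1 (p (q + 1)).1 t x) +
          (if (p q).2 = (p (q + 1)).2 then 0 else gU (p q).2 (p (q + 1)).2 t x))) ≠ 0

/-- The parabolic operator `∂ₜ + 𝓛`. -/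
def parab (b : ℝ → Euc k → Fin k → ℝ) (σm : ℝ → Euc k → Matrix (Fin k) (Fin d) ℝ)
    (φ : ℝ → Euc k → ℝ) (z : ℝ × Euc k) : ℝ :=
  timeDeriv φ z.1 z.2 + genL b σm φ z.1 z.2

/-- Subsolutions in `(a, T) × ℝ^k` of a degenerate elliptic system, without terminal data. -/
def SubOn {Γ : Type} (b : ℝ → Euc k → Fin k → ℝ) (σm : ℝ → Euc k → Matrix (Fin k) (Fin d) ℝ)
    (F : Γ → ℝ × Euc k → (Γ → ℝ) → ℝ → (Fin d → ℝ) → ℝ) (a T : ℝ) (u : Γ → ℝ × Euc k → ℝ) : Prop :=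
  ∀ p z, z.1 ∈ Ioo a T → ∀ φ : ℝ → Euc k → ℝ, IsC12 φ →
    IsLocalMax (fun w => u p w - φ w.1 w.2) z →
    F p z (fun q => u q z) (parab b σm φ z) (sigGrad σm φ z.1 z.2) ≤ 0

/-- Supersolutions in `(a, T) × ℝ^k` of a degenerate elliptic system, without terminal data. -/
def SuperOn {Γ : Type} (b : ℝ → Euc k → Fin k → ℝ) (σm : ℝ → Euc k → Matrix (Fin k) (Fin d) ℝ)
    (F : Γ → ℝ × Euc k → (Γ → ℝ) → ℝ → (Fin d → ℝ) → ℝ) (a T : ℝ) (v : Γ → ℝ × Euc k → ℝ) : Prop :=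
  ∀ p z, z.1 ∈ Ioo a T → ∀ φ : ℝ → Euc k → ℝ, IsC12 φ →
    IsLocalMin (fun w => v p w - φ w.1 w.2) z →
    0 ≤ F p z (fun q => v q z) (parab b σm φ z) (sigGrad σm φ z.1 z.2)

namespace Sys

/-- The max-min operator of the system, as a function of `∂ₜφ + 𝓛φ`. -/
def F (S : Sys k d Γ1 Γ2) (p : Γ1 × Γ2) (z : ℝ × Euc k) (y : Γ1 × Γ2 → ℝ) (P : ℝ)
    (q : Fin d → ℝ) : ℝ :=
  FmaxMin S.f S.gL S.gU p z.1 z.2 y 0 P q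

variable (S : Sys k d Γ1 Γ2)

theorem F_nonpos_iff {p : Γ1 × Γ2} {z : ℝ × Euc k} {y : Γ1 × Γ2 → ℝ} {P : ℝ} {q : Fin d → ℝ} :
    S.F p z y P q ≤ 0 ↔ (∀ l, l ≠ p.2 → y p ≤ y (p.1, l) + S.gU p.2 l z.1 z.2) ∧
      ((∃ i, i ≠ p.1 ∧ y p ≤ y (i, p.2) - S.gL p.1 i z.1 z.2) ∨
        0 ≤ P + S.f p.1 p.2 z.1 z.2 y q) := by
  unfold F FmaxMin
  rw [max_le_iff, min_le_iff, sub_nonpos, sub_nonpos, upperObst, lowerObst, Finset.le_inf'_iff,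
    Finset.le_sup'_iff]
  simp only [Finset.mem_erase, Finset.mem_univ, and_true]
  have : (-0 - P - S.f p.1 p.2 z.1 z.2 y q ≤ 0) ↔ 0 ≤ P + S.f p.1 p.2 z.1 z.2 y q := by
    constructor <;> intro h <;> linarith
  rw [this]

theorem F_nonneg_iff {p : Γ1 × Γ2} {z : ℝ × Euc k} {y : Γ1 × Γ2 → ℝ} {P : ℝ} {q : Fin d → ℝ} :
    0 ≤ S.F p z y P q ↔ (∃ l, l ≠ p.2 ∧ y (p.1, l) + S.gU p.2 l z.1 z.2 ≤ y p) ∨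
      ((∀ i, i ≠ p.1 → y (i, p.2) - S.gL p.1 i z.1 z.2 ≤ y p) ∧
        P + S.f p.1 p.2 z.1 z.2 y q ≤ 0) := by
  unfold F FmaxMin
  rw [le_max_iff, le_min_iff, sub_nonneg, sub_nonneg, upperObst, lowerObst, Finset.inf'_le_iff,
    Finset.sup'_le_iff]
  simp only [Finset.mem_erase, Finset.mem_univ, and_true]
  have : (0 ≤ -0 - P - S.f p.1 p.2 z.1 z.2 y q) ↔ P + S.f p.1 p.2 z.1 z.2 y q ≤ 0 := by
    constructor <;> intro h <;> linarith
  rw [this]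

theorem f_continuous (i : Γ1) (j : Γ2) : Continuous fun w :
    (ℝ × Euc k) × (Γ1 × Γ2 → ℝ) × (Fin d → ℝ) => S.f i j w.1.1 w.1.2 w.2.1 w.2.2 := by
  obtain ⟨C, hC0, hC⟩ := S.f_lip
  rw [continuous_iff_continuousAt]
  rintro ⟨⟨t, x⟩, y, q⟩
  rw [ContinuousAt, Metric.tendsto_nhds]
  intro ε hε
  obtain ⟨η, hη, h⟩ := S.f_cont i j t x (ε / 2) (half_pos hε)
  have h1 : ∀ᶠ w : (ℝ × Euc k) × (Γ1 × Γ2 → ℝ) × (Fin d → ℝ) in 𝓝 ((t, x), y, q),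
      dist w.1 (t, x) < η := by
    have : Continuous fun w : (ℝ × Euc k) × (Γ1 × Γ2 → ℝ) × (Fin d → ℝ) => dist w.1 (t, x) := by
      fun_prop
    exact (this.tendsto' _ 0 (by simp)).eventually_lt_const hη
  have h2 : ∀ᶠ w : (ℝ × Euc k) × (Γ1 × Γ2 → ℝ) × (Fin d → ℝ) in 𝓝 ((t, x), y, q),
      C * (‖w.2.1 - y‖ + ‖w.2.2 - q‖) < ε / 2 := by
    have : Continuous fun w : (ℝ × Euc k) × (Γ1 × Γ2 → ℝ) × (Fin d → ℝ) =>
      C * (‖w.2.1 - y‖ + ‖w.2.2 - q‖) := by fun_prop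
    exact (this.tendsto' _ 0 (by simp)).eventually_lt_const (half_pos hε)
  filter_upwards [h1, h2] with w hw1 hw2
  rw [Real.dist_eq]
  have e1 := h w.1.1 w.1.2 hw1 w.2.1 w.2.2
  have e2 := hC i j t x w.2.1 y w.2.2 q
  calc _ ≤ |S.f i j w.1.1 w.1.2 w.2.1 w.2.2 - S.f i j t x w.2.1 w.2.2|
        + |S.f i j t x w.2.1 w.2.2 - S.f i j t x y q| := abs_sub_le _ _ _
    _ < ε := by linarith

theorem F_continuous (p : Γ1 × Γ2) : Continuous fun w :
    (ℝ × Euc k) × (Γ1 × Γ2 → ℝ) × ℝ × (Fin d → ℝ) => S.F p w.1 w.2.1 w.2.2.1 w.2.2.2 := by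
  unfold F FmaxMin upperObst lowerObst
  have hf : Continuous fun w : (ℝ × Euc k) × (Γ1 × Γ2 → ℝ) × ℝ × (Fin d → ℝ) =>
      S.f p.1 p.2 w.1.1 w.1.2 w.2.1 w.2.2.2 :=
    (S.f_continuous p.1 p.2).comp
      (f := fun w : (ℝ × Euc k) × (Γ1 × Γ2 → ℝ) × ℝ × (Fin d → ℝ) => (w.1, w.2.1, w.2.2.2))
      (by fun_prop)
  have hU : ∀ l, Continuous fun w : (ℝ × Euc k) × (Γ1 × Γ2 → ℝ) × ℝ × (Fin d → ℝ) =>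
      w.2.1 (p.1, l) + S.gU p.2 l w.1.1 w.1.2 := fun l =>
    (by fun_prop : Continuous fun w : (ℝ × Euc k) × (Γ1 × Γ2 → ℝ) × ℝ × (Fin d → ℝ) =>
      w.2.1 (p.1, l)).add ((S.gU_cont p.2 l).comp continuous_fst)
  have hL : ∀ i, Continuous fun w : (ℝ × Euc k) × (Γ1 × Γ2 → ℝ) × ℝ × (Fin d → ℝ) =>
      w.2.1 (i, p.2) - S.gL p.1 i w.1.1 w.1.2 := fun i =>
    (by fun_prop : Continuous fun w : (ℝ × Euc k) × (Γ1 × Γ2 → ℝ) × ℝ × (Fin d → ℝ) =>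
      w.2.1 (i, p.2)).sub ((S.gL_cont p.1 i).comp continuous_fst)
  have hy : Continuous fun w : (ℝ × Euc k) × (Γ1 × Γ2 → ℝ) × ℝ × (Fin d → ℝ) => w.2.1 p := by
    fun_prop
  refine (hy.sub (Continuous.finset_inf'_apply _ fun l _ => hU l)).max
    ((hy.sub (Continuous.finset_sup'_apply _ fun i _ => hL i)).min ?_)
  exact ((continuous_const.sub (by fun_prop)).sub hf)

theorem F_anti {p : Γ1 × Γ2} {z : ℝ × Euc k} {y y' : Γ1 × Γ2 → ℝ} {P P' : ℝ} {q : Fin d → ℝ}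
    (hy : y ≤ y') (hp : y p = y' p) (hP : P ≤ P') : S.F p z y' P' q ≤ S.F p z y P q := by
  unfold F FmaxMin upperObst lowerObst
  rw [hp]
  refine max_le_max (sub_le_sub_left ?_ _) (min_le_min (sub_le_sub_left ?_ _) ?_)
  · exact Finset.inf'_mono_fun fun l _ => add_le_add_left (hy _) _
  · exact Finset.sup'_mono_fun fun l _ => sub_le_sub_right (hy _) _
  · have := S.f_mono p.1 p.2 z.1 z.2 y y' q hy hp
    linarith

end Sys

theorem continuous_pd {φ : ℝ → Euc k → ℝ} (h : IsC12 φ) (i : Fin k) :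
    Continuous fun z : ℝ × Euc k => pd i (φ z.1) z.2 :=
  h.2.2.2.1.clm_apply continuous_const

theorem continuous_parab {b : ℝ → Euc k → Fin k → ℝ} {σm : ℝ → Euc k → Matrix (Fin k) (Fin d) ℝ}
    (hb : Continuous fun p : ℝ × Euc k => b p.1 p.2)
    (hσ : Continuous fun p : ℝ × Euc k => σm p.1 p.2) {φ : ℝ → Euc k → ℝ} (h : IsC12 φ) :
    Continuous (parab b σm φ) := by
  unfold parab genL
  refine h.2.1.add ((continuous_const.mul (continuous_finsetSum _ fun i _ =>
    continuous_finsetSum _ fun j _ => Continuous.mul ?_ ?_)).add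
    (continuous_finsetSum _ fun i _ => Continuous.mul ?_ (continuous_pd h i)))
  · exact (hσ.matrix_mul hσ.matrix_transpose).matrix_elem i j
  · simp only [h.pd_pd]
    exact (h.2.2.2.2.clm_apply continuous_const).clm_apply continuous_const
  · exact (continuous_apply i).comp hb

theorem continuous_sigGrad {σm : ℝ → Euc k → Matrix (Fin k) (Fin d) ℝ}
    (hσ : Continuous fun p : ℝ × Euc k => σm p.1 p.2) {φ : ℝ → Euc k → ℝ} (h : IsC12 φ) :
    Continuous fun z : ℝ × Euc k => sigGrad σm φ z.1 z.2 :=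
  continuous_pi fun l => continuous_finsetSum _ fun i _ =>
    (hσ.matrix_elem i l).mul (continuous_pd h i)

end System

section Weight

open scoped Topology RealInnerProductSpace

variable {k d : ℕ}

/-- Polynomial weights centred at `x₀`. -/
def wt (n : ℕ) (x₀ : Euc k) (x : Euc k) : ℝ := (1 + ‖x - x₀‖ ^ 2) ^ (n + 2)

theorem one_le_wt (n : ℕ) (x₀ x : Euc k) : 1 ≤ wt n x₀ x :=
  one_le_pow₀ (by nlinarith [sq_nonneg ‖x - x₀‖])

theorem wt_self (n : ℕ) (x₀ : Euc k) : wt n x₀ x₀ = 1 := by simp [wt]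

theorem contDiff_wt (n : ℕ) (x₀ : Euc k) : ContDiff ℝ 2 (wt n x₀) :=
  (contDiff_const.add ((contDiff_id.sub contDiff_const).norm_sq ℝ)).pow _

theorem hasFDerivAt_normSq (x₀ x : Euc k) : HasFDerivAt (fun y : Euc k => 1 + ‖y - x₀‖ ^ 2)
    ((2 : ℝ) • innerSL ℝ (x - x₀)) x := by
  have h := ((hasFDerivAt_id x).sub_const x₀).norm_sq
  have h2 := h.const_add 1
  refine h2.congr_fderiv ?_
  ext v; simp

theorem pd_wt (n : ℕ) (x₀ x : Euc k) (i : Fin k) :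
    pd i (wt n x₀) x = 2 * (n + 2) * ((1 + ‖x - x₀‖ ^ 2) ^ (n + 1) * (x - x₀) i) := by
  have h := (hasFDerivAt_normSq x₀ x).pow (n + 2)
  unfold pd wt
  rw [h.fderiv]
  simp [EuclideanSpace.inner_single_right]
  ring

theorem pd_pd_wt (n : ℕ) (x₀ x : Euc k) (i j : Fin k) :
    pd i (fun y => pd j (wt n x₀) y) x = 2 * (n + 2) *
      ((1 + ‖x - x₀‖ ^ 2) ^ (n + 1) * (if i = j then 1 else 0) +
        2 * (n + 1) * ((1 + ‖x - x₀‖ ^ 2) ^ n * ((x - x₀) i * (x - x₀) j))) := by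
  have h := (hasFDerivAt_normSq x₀ x).pow (n + 1)
  have hj : HasFDerivAt (fun y : Euc k => (y - x₀) j) (EuclideanSpace.proj (𝕜 := ℝ) j) x :=
    ((EuclideanSpace.proj (𝕜 := ℝ) j : Euc k →L[ℝ] ℝ).hasFDerivAt).comp x
      ((hasFDerivAt_id x).sub_const x₀)
  have h2 := (h.mul hj).const_mul (2 * ((n : ℝ) + 2))
  simp only [pd_wt]
  unfold pd
  erw [h2.fderiv]
  simp [EuclideanSpace.inner_single_right]
  by_cases hij : i = j
  · subst hij; simp; ring
  · simp only [hij, Ne.symm hij]; simp; ring_nf; simp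

theorem exists_wt_bound {b : ℝ → Euc k → Fin k → ℝ} {σm : ℝ → Euc k → Matrix (Fin k) (Fin d) ℝ}
    {C : ℝ} (hC : 0 ≤ C) (hgrow : ∀ t (x : Euc k), (∀ i, |b t x i| ≤ C * (1 + ‖x‖)) ∧
      (∀ i l, |σm t x i l| ≤ C * (1 + ‖x‖))) (n : ℕ) (x₀ : Euc k) :
    ∃ K : ℝ, 0 ≤ K ∧ ∀ t x, |genL b σm (fun _ y => wt n x₀ y) t x| ≤ K * wt n x₀ x ∧
      ∀ l, |sigGrad σm (fun _ y => wt n x₀ y) t x l| ≤ K * wt n x₀ x := by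
  set D := C * (1 + ‖x₀‖) with hD
  have hD0 : 0 ≤ D := by positivity
  set c : ℝ := 2 * (n + 2) * (1 + 2 * (n + 1)) with hc
  have hc0 : 0 ≤ c := by positivity
  set K1 : ℝ := k * (D * (4 * (n + 2))) with hK1
  have hK10 : 0 ≤ K1 := by positivity
  set K2 : ℝ := 1 / 2 * (k * (k * (d * (2 * D ^ 2) * c))) with hK2
  have hK20 : 0 ≤ K2 := by positivity
  have base : ∀ x : Euc k, C * (1 + ‖x‖) ≤ D * (1 + ‖x - x₀‖) := by
    intro x
    have h1 : ‖x‖ ≤ ‖x - x₀‖ + ‖x₀‖ := by simpa using norm_add_le (x - x₀) x₀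
    rw [hD, mul_assoc]
    refine mul_le_mul_of_nonneg_left ?_ hC
    nlinarith [norm_nonneg x₀, norm_nonneg (x - x₀), mul_nonneg (norm_nonneg x₀) (norm_nonneg (x - x₀))]
  have hfirst : ∀ (x : Euc k) (i : Fin k) (β : ℝ), |β| ≤ C * (1 + ‖x‖) →
      |β * pd i (wt n x₀) x| ≤ D * (4 * (n + 2)) * wt n x₀ x := by
    intro x i β hβ
    rw [pd_wt, abs_mul]
    set s := ‖x - x₀‖ with hs
    have hs0 : 0 ≤ s := norm_nonneg _
    have hy : |(x - x₀) i| ≤ s := euc_coord_abs_le _ _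
    set Q := (1 + s ^ 2) ^ (n + 1) with hQ
    have hQ0 : 0 ≤ Q := by positivity
    have e1 : |2 * ((n : ℝ) + 2) * (Q * (x - x₀) i)| ≤ 2 * (n + 2) * (Q * s) := by
      rw [abs_mul _ (Q * _), abs_mul Q, abs_of_nonneg (by positivity : (0 : ℝ) ≤ 2 * (n + 2)),
        abs_of_nonneg hQ0]
      gcongr
    have e2 : wt n x₀ x = Q * (1 + s ^ 2) := by rw [wt, hQ, ← hs, pow_succ]
    calc |β| * |2 * ((n : ℝ) + 2) * (Q * (x - x₀) i)|
        ≤ (D * (1 + s)) * (2 * (n + 2) * (Q * s)) :=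
          mul_le_mul (hβ.trans (base x)) e1 (abs_nonneg _) (by positivity)
      _ = D * (2 * (n + 2)) * Q * ((1 + s) * s) := by ring
      _ ≤ D * (2 * (n + 2)) * Q * (2 * (1 + s ^ 2)) := by
          refine mul_le_mul_of_nonneg_left ?_ (by positivity)
          nlinarith [sq_nonneg (s - 1)]
      _ = _ := by rw [e2]; ring
  have hsecond : ∀ (t : ℝ) (x : Euc k) (i j : Fin k),
      |(σm t x * (σm t x)ᵀ) i j * pd i (fun y => pd j (wt n x₀) y) x|
        ≤ d * (2 * D ^ 2) * c * wt n x₀ x := by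
    intro t x i j
    rw [pd_pd_wt, abs_mul]
    set s := ‖x - x₀‖ with hs
    have hs0 : 0 ≤ s := norm_nonneg _
    have hyi : |(x - x₀) i| ≤ s := euc_coord_abs_le _ _
    have hyj : |(x - x₀) j| ≤ s := euc_coord_abs_le _ _
    have e2 : wt n x₀ x = (1 + s ^ 2) * (1 + s ^ 2) ^ (n + 1) := by rw [wt, ← hs, pow_succ']
    have hσσ : |(σm t x * (σm t x)ᵀ) i j| ≤ d * (2 * D ^ 2) * (1 + s ^ 2) := by
      rw [Matrix.mul_apply]
      refine (Finset.abs_sum_le_sum_abs _ _).trans ?_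
      have : ∀ l ∈ (Finset.univ : Finset (Fin d)), |σm t x i l * (σm t x)ᵀ l j|
          ≤ 2 * D ^ 2 * (1 + s ^ 2) := by
        intro l _
        rw [abs_mul, Matrix.transpose_apply]
        calc _ ≤ (D * (1 + s)) * (D * (1 + s)) := mul_le_mul (((hgrow t x).2 i l).trans (base x))
              (((hgrow t x).2 j l).trans (base x)) (abs_nonneg _) (by positivity)
          _ = D ^ 2 * (1 + s) ^ 2 := by ring
          _ ≤ D ^ 2 * (2 * (1 + s ^ 2)) := by
              refine mul_le_mul_of_nonneg_left ?_ (by positivity)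
              nlinarith [sq_nonneg (s - 1)]
          _ = _ := by ring
      refine (Finset.sum_le_sum this).trans (le_of_eq ?_)
      simp; ring
    have hpp : |2 * ((n : ℝ) + 2) * ((1 + s ^ 2) ^ (n + 1) * (if i = j then 1 else 0) +
        2 * (n + 1) * ((1 + s ^ 2) ^ n * ((x - x₀) i * (x - x₀) j)))| ≤ c * (1 + s ^ 2) ^ (n + 1) := by
      rw [abs_mul (2 * ((n : ℝ) + 2)), abs_of_nonneg (by positivity : (0 : ℝ) ≤ 2 * ((n : ℝ) + 2)),
        hc, mul_assoc (2 * ((n : ℝ) + 2)) (1 + _)]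
      refine mul_le_mul_of_nonneg_left ?_ (by positivity)
      refine (abs_add_le _ _).trans ?_
      have a1 : |(1 + s ^ 2) ^ (n + 1) * (if i = j then (1 : ℝ) else 0)| ≤ (1 + s ^ 2) ^ (n + 1) := by
        split_ifs
        · rw [mul_one, abs_of_nonneg (by positivity)]
        · rw [mul_zero, _root_.abs_zero]; positivity
      have a2 : |2 * ((n : ℝ) + 1) * ((1 + s ^ 2) ^ n * ((x - x₀) i * (x - x₀) j))|
          ≤ 2 * (n + 1) * (1 + s ^ 2) ^ (n + 1) := by
        rw [abs_mul _ ((1 + s ^ 2) ^ n * _), abs_mul ((1 + s ^ 2) ^ n),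
          abs_mul ((x - x₀) i), abs_of_nonneg (by positivity : (0 : ℝ) ≤ 2 * ((n : ℝ) + 1)),
          abs_of_nonneg (by positivity : (0 : ℝ) ≤ (1 + s ^ 2) ^ n), pow_succ]
        have := mul_le_mul hyi hyj (abs_nonneg _) hs0
        refine mul_le_mul_of_nonneg_left (mul_le_mul_of_nonneg_left ?_ (by positivity)) (by positivity)
        nlinarith
      linarith
    calc _ ≤ (d * (2 * D ^ 2) * (1 + s ^ 2)) * (c * (1 + s ^ 2) ^ (n + 1)) :=
          mul_le_mul hσσ hpp (abs_nonneg _) (by positivity)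
      _ = _ := by rw [e2]; ring
  refine ⟨K2 + K1, by positivity, fun t x => ⟨?_, fun l => ?_⟩⟩
  · unfold genL
    have hw : 0 ≤ wt n x₀ x := zero_le_one.trans (one_le_wt n x₀ x)
    refine (abs_add_le _ _).trans ?_
    rw [add_mul]
    refine add_le_add ?_ ?_
    · rw [abs_mul, abs_of_nonneg (by norm_num : (0 : ℝ) ≤ 1 / 2), hK2, mul_assoc]
      refine mul_le_mul_of_nonneg_left ?_ (by norm_num)
      refine (Finset.abs_sum_le_sum_abs _ _).trans ?_
      have : ∀ i ∈ (Finset.univ : Finset (Fin k)),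
          |∑ j, (σm t x * (σm t x)ᵀ) i j * pd i (fun y => pd j (fun y => wt n x₀ y) y) x|
            ≤ k * (d * (2 * D ^ 2) * c * wt n x₀ x) := by
        intro i _
        refine (Finset.abs_sum_le_sum_abs _ _).trans
          ((Finset.sum_le_sum fun j _ => hsecond t x i j).trans (le_of_eq ?_))
        simp
      refine (Finset.sum_le_sum this).trans (le_of_eq ?_)
      simp; ring
    · refine (Finset.abs_sum_le_sum_abs _ _).trans
        ((Finset.sum_le_sum fun i _ => hfirst x i _ ((hgrow t x).1 i)).trans (le_of_eq ?_))
      simp [hK1]; ring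
  · have hw : 0 ≤ wt n x₀ x := zero_le_one.trans (one_le_wt n x₀ x)
    unfold sigGrad
    refine (Finset.abs_sum_le_sum_abs _ _).trans
        ((Finset.sum_le_sum fun i _ => hfirst x i _ ((hgrow t x).2 i l)).trans ?_)
    have : ∑ i : Fin k, D * (4 * ((n : ℝ) + 2)) * wt n x₀ x = K1 * wt n x₀ x := by simp [hK1]; ring
    rw [this]
    exact mul_le_mul_of_nonneg_right (by linarith) hw

/-- Separable functions `E(t) w(x)`. -/
theorem isC12_smul_wt {E : ℝ → ℝ} (hE : ContDiff ℝ 2 E) (n : ℕ) (x₀ : Euc k) :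
    IsC12 fun t x => E t * wt n x₀ x :=
  IsC12.of_contDiff (g := fun z => E z.1 * wt n x₀ z.2)
    ((hE.comp contDiff_fst).mul ((contDiff_wt n x₀).comp contDiff_snd))

theorem isC12_wt (n : ℕ) (x₀ : Euc k) : IsC12 fun _ x => wt n x₀ x :=
  IsC12.of_contDiff (g := fun z => wt n x₀ z.2) ((contDiff_wt n x₀).comp contDiff_snd)

theorem parab_smul_wt (b : ℝ → Euc k → Fin k → ℝ) (σm : ℝ → Euc k → Matrix (Fin k) (Fin d) ℝ)
    {E : ℝ → ℝ} (n : ℕ) (x₀ : Euc k) (hE : Differentiable ℝ E) (z : ℝ × Euc k) :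
    parab b σm (fun t x => E t * wt n x₀ x) z
      = deriv E z.1 * wt n x₀ z.2 + E z.1 * genL b σm (fun _ y => wt n x₀ y) z.1 z.2 := by
  unfold parab
  congr 1
  · exact deriv_mul_const (hE z.1) _
  · exact genL_const_mul b σm (isC12_wt n x₀) (E z.1) z.1 z.2

theorem sigGrad_smul_wt (σm : ℝ → Euc k → Matrix (Fin k) (Fin d) ℝ)
    {E : ℝ → ℝ} (n : ℕ) (x₀ : Euc k) (t : ℝ) (x : Euc k) (l : Fin d) :
    sigGrad σm (fun t x => E t * wt n x₀ x) t x l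
      = E t * sigGrad σm (fun _ y => wt n x₀ y) t x l :=
  congrFun (sigGrad_const_mul σm (isC12_wt n x₀) (E t) t x) l

end Weight

section Selection

/-- A relation without fixed points on a finite set, along which one can always continue,
contains a simple cycle. -/
theorem exists_simple_cycle {α : Type*} [Finite α] {A : Set α} (hA : A.Nonempty)
    {R : α → α → Prop} (hne : ∀ p, ¬R p p) (hR : ∀ p ∈ A, ∃ q ∈ A, R p q) :
    ∃ (M : ℕ) (p : ℕ → α), 2 ≤ M ∧ p M = p 0 ∧
      (∀ q q', q < M → q' < M → p q = p q' → q = q') ∧ ∀ q, R (p q) (p (q + 1)) := by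
  have hR' : ∀ p : A, ∃ q : A, R p q := fun p => by
    obtain ⟨q, hq, h⟩ := hR p p.2
    exact ⟨⟨q, hq⟩, h⟩
  choose g hg using hR'
  obtain ⟨x, hx⟩ := hA
  obtain ⟨m, n, hmn, h⟩ := Finite.exists_ne_map_eq_of_infinite (fun n : ℕ => g^[n] ⟨x, hx⟩)
  wlog hlt : m < n generalizing m n
  · exact this n m hmn.symm h.symm (lt_of_le_of_ne (not_lt.1 hlt) hmn.symm)
  set y := g^[m] ⟨x, hx⟩ with hy
  have hper : Function.IsPeriodicPt g (n - m) y := by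
    show g^[n - m] y = y
    rw [hy, ← Function.iterate_add_apply, Nat.sub_add_cancel hlt.le]
    exact h.symm
  have hpos : 0 < Function.minimalPeriod g y :=
    hper.minimalPeriod_pos (Nat.sub_pos_of_lt hlt)
  have hne1 : Function.minimalPeriod g y ≠ 1 := by
    intro h1
    have := (Function.isPeriodicPt_minimalPeriod g y)
    rw [h1] at this
    have h2 : g y = y := this
    have h3 := hg y
    rw [h2] at h3
    exact hne _ h3
  refine ⟨Function.minimalPeriod g y, fun q => (g^[q] y : A), by omega, ?_, ?_, ?_⟩
  · exact congrArg Subtype.val (Function.isPeriodicPt_minimalPeriod g y)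
  · intro q q' hq hq' h
    exact Function.iterate_injOn_Iio_minimalPeriod hq hq' (Subtype.ext h)
  · intro q
    show R (g^[q] y : A) (g^[q + 1] y : A)
    rw [Function.iterate_succ_apply']
    exact hg _

variable {k d : ℕ} {Γ1 Γ2 : Type} [Fintype Γ1] [Fintype Γ2] [DecidableEq Γ1] [DecidableEq Γ2]

theorem Sys.exists_inactive_index (S : Sys k d Γ1 Γ2) (t : ℝ) (x : Euc k) {u v : Γ1 × Γ2 → ℝ}
    {m : ℝ} (hle : ∀ p, u p - v p ≤ m) (hex : ∃ p, u p - v p = m)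
    (hu : ∀ (p : Γ1 × Γ2) l, l ≠ p.2 → u p ≤ u (p.1, l) + S.gU p.2 l t x)
    (hv : ∀ p : Γ1 × Γ2, (∃ l, l ≠ p.2 ∧ v (p.1, l) + S.gU p.2 l t x ≤ v p) ∨
      ∀ i, i ≠ p.1 → v (i, p.2) - S.gL p.1 i t x ≤ v p) :
    ∃ p, u p - v p = m ∧ (∀ i, i ≠ p.1 → u (i, p.2) - S.gL p.1 i t x < u p) ∧
      ∀ l, l ≠ p.2 → v p < v (p.1, l) + S.gU p.2 l t x := by
  by_contra! hcon
  set cost : Γ1 × Γ2 → Γ1 × Γ2 → ℝ := fun p q =>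
    (if p.1 = q.1 then 0 else -S.gL p.1 q.1 t x) + (if p.2 = q.2 then 0 else S.gU p.2 q.2 t x)
    with hcost
  have hstep : ∀ p ∈ {p | u p - v p = m}, ∃ q ∈ {p | u p - v p = m},
      (p.1 = q.1 ∨ p.2 = q.2) ∧ p ≠ q ∧ u p - u q = cost p q := by
    intro p hp
    simp only [mem_ofPred_eq] at hp
    by_cases hl : ∃ l, l ≠ p.2 ∧ v (p.1, l) + S.gU p.2 l t x ≤ v p
    · obtain ⟨l, hl, h⟩ := hl
      have h1 := hu p l hl
      have h2 := hle (p.1, l)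
      refine ⟨(p.1, l), ?_, Or.inl rfl, ?_, ?_⟩
      · simp only [mem_ofPred_eq]; linarith
      · intro he; exact hl (congrArg Prod.snd he).symm
      · simp only [hcost, if_true, if_neg hl.symm]; linarith
    · have hv' := (hv p).resolve_left hl
      by_cases hi : ∀ i, i ≠ p.1 → u (i, p.2) - S.gL p.1 i t x < u p
      · exact absurd (hcon p hp hi) hl
      · push Not at hi
        obtain ⟨i, hi, h⟩ := hi
        have h1 := hv' i hi
        have h2 := hle (i, p.2)
        refine ⟨(i, p.2), ?_, Or.inr rfl, ?_, ?_⟩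
        · simp only [mem_ofPred_eq]; linarith
        · intro he; exact hi (congrArg Prod.fst he).symm
        · simp only [hcost, if_true, if_neg hi.symm]; linarith
  obtain ⟨M, p, hM, hp0, hinj, hR⟩ := exists_simple_cycle (A := {p | u p - v p = m}) hex
    (R := fun p q => (p.1 = q.1 ∨ p.2 = q.2) ∧ p ≠ q ∧ u p - u q = cost p q)
    (fun p h => h.2.1 rfl) hstep
  refine S.nfl M hM p hp0 hinj (fun q _ => (hR q).1) t x ?_
  have : ∀ q ∈ Finset.range M, ((if (p q).1 = (p (q + 1)).1 then 0
      else -S.gL (p q).1 (p (q + 1)).1 t x) + (if (p q).2 = (p (q + 1)).2 then 0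
      else S.gU (p q).2 (p (q + 1)).2 t x)) = u (p q) - u (p (q + 1)) := fun q _ => (hR q).2.2.symm
  rw [Finset.sum_congr rfl this, Finset.sum_range_sub' (fun q => u (p q)), hp0, sub_self]

theorem Sys.f_le_of_le_add (S : Sys k d Γ1 Γ2) {C : ℝ} (hC0 : 0 ≤ C)
    (hC : ∀ i j t x y y' z z', |S.f i j t x y z - S.f i j t x y' z'| ≤ C * (‖y - y'‖ + ‖z - z'‖))
    (p : Γ1 × Γ2) (t : ℝ) (x : Euc k) {y y' : Γ1 × Γ2 → ℝ} {A : ℝ} (hle : ∀ q, y q ≤ y' q + A)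
    (hp : |y p - y' p| ≤ A) (z z' : Fin d → ℝ) :
    S.f p.1 p.2 t x y z ≤ S.f p.1 p.2 t x y' z' + C * (A + ‖z - z'‖) := by
  have hA : 0 ≤ A := (abs_nonneg _).trans hp
  set w : Γ1 × Γ2 → ℝ := fun q => if q = p then y p else max (y q) (y' q) with hw
  have h1 : S.f p.1 p.2 t x y z ≤ S.f p.1 p.2 t x w z := by
    refine S.f_mono _ _ _ _ _ _ _ (fun q => ?_) (by simp [hw])
    by_cases hq : q = p
    · simp [hw, hq]
    · simp [hw, hq]
  have h2 : ‖w - y'‖ ≤ A := by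
    rw [pi_norm_le_iff_of_nonneg hA]
    intro q
    rw [Real.norm_eq_abs, Pi.sub_apply]
    by_cases hq : q = p
    · simpa [hw, hq] using hp
    · simp only [hw, hq, if_false]
      rw [abs_of_nonneg (sub_nonneg.2 (le_max_right _ _)), sub_le_iff_le_add]
      exact max_le (by linarith [hle q]) (by linarith)
  have h3 := (le_abs_self _).trans (hC p.1 p.2 t x w y' z z')
  have h4 : C * (‖w - y'‖ + ‖z - z'‖) ≤ C * (A + ‖z - z'‖) :=
    mul_le_mul_of_nonneg_left (by linarith) hC0
  linarith

end Selection

section Touching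

open scoped Topology

variable {k d : ℕ}

theorem dist_sq_le_time_space (z z₀ : ℝ × Euc k) :
    dist z z₀ ^ 2 ≤ (z.1 - z₀.1) ^ 2 + ‖z.2 - z₀.2‖ ^ 2 := by
  rw [Prod.dist_eq, Real.dist_eq, dist_eq_norm]
  rcases max_choice |z.1 - z₀.1| ‖z.2 - z₀.2‖ with h | h
  · rw [h, sq_abs]; nlinarith [sq_nonneg ‖z.2 - z₀.2‖]
  · rw [h]; nlinarith [sq_nonneg (z.1 - z₀.1)]

theorem isC12_quadratic (N : ℝ) (z₀ : ℝ × Euc k) :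
    IsC12 fun t x => N * ((t - z₀.1) ^ 2 + ‖x - z₀.2‖ ^ 2) := by
  refine IsC12.of_contDiff (g := fun z => N * ((z.1 - z₀.1) ^ 2 + ‖z.2 - z₀.2‖ ^ 2)) ?_
  exact contDiff_const.mul (((contDiff_fst.sub contDiff_const).pow 2).add
    ((contDiff_snd.sub contDiff_const).norm_sq ℝ))

theorem exists_touching_above {U : ℝ × Euc k → ℝ} (hU : UpperSemicontinuous U) (z₀ : ℝ × Euc k)
    {ε : ℝ} (hε : 0 < ε) : ∃ (z₁ : ℝ × Euc k) (φ : ℝ → Euc k → ℝ), dist z₁ z₀ < ε ∧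
      |U z₁ - U z₀| < ε ∧ IsC12 φ ∧ IsLocalMax (fun z => U z - φ z.1 z.2) z₁ := by
  obtain ⟨r', hr', hball⟩ := Metric.eventually_nhds_iff.1 (hU z₀ (U z₀ + ε) (by linarith))
  set r := min r' ε / 2 with hr
  have hr0 : 0 < r := half_pos (lt_min hr' hε)
  have hrr' : r < r' := by have := min_le_left r' ε; linarith
  have hrε : r < ε := by have := min_le_right r' ε; linarith
  set N := ε / r ^ 2 with hN
  have hN0 : 0 < N := by positivity
  have hφ := isC12_quadratic N z₀
  have hcont : Continuous fun z : ℝ × Euc k => -(N * ((z.1 - z₀.1) ^ 2 + ‖z.2 - z₀.2‖ ^ 2)) := by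
    fun_prop
  have husc : UpperSemicontinuousOn
      (fun z => U z + -(N * ((z.1 - z₀.1) ^ 2 + ‖z.2 - z₀.2‖ ^ 2))) (Metric.closedBall z₀ r) :=
    (hU.add hcont.upperSemicontinuous).upperSemicontinuousOn _
  obtain ⟨z₁, hz₁, hmax⟩ := husc.exists_isMaxOn ⟨z₀, Metric.mem_closedBall_self hr0.le⟩
    (isCompact_closedBall z₀ r)
  have hmax' := isMaxOn_iff.1 hmax
  have h0 := hmax' z₀ (Metric.mem_closedBall_self hr0.le)
  simp only [sub_self, norm_zero, ne_eq, OfNat.ofNat_ne_zero, not_false_eq_true, zero_pow,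
    add_zero, mul_zero, neg_zero] at h0
  have hub := hball (lt_of_le_of_lt (Metric.mem_closedBall.1 hz₁) hrr')
  have hq0 : 0 ≤ N * ((z₁.1 - z₀.1) ^ 2 + ‖z₁.2 - z₀.2‖ ^ 2) := by positivity
  have hq : (z₁.1 - z₀.1) ^ 2 + ‖z₁.2 - z₀.2‖ ^ 2 < r ^ 2 := by
    have : N * ((z₁.1 - z₀.1) ^ 2 + ‖z₁.2 - z₀.2‖ ^ 2) < N * r ^ 2 := by
      have e : N * r ^ 2 = ε := by rw [hN]; field_simp
      rw [e]; linarith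
    exact lt_of_mul_lt_mul_left this hN0.le
  have hd : dist z₁ z₀ < r :=
    lt_of_pow_lt_pow_left₀ 2 hr0.le ((dist_sq_le_time_space _ _).trans_lt hq)
  refine ⟨z₁, _, hd.trans hrε, ?_, hφ, ?_⟩
  · rw [abs_lt]; constructor <;> linarith
  · have hnhds : Metric.closedBall z₀ r ∈ 𝓝 z₁ :=
      Filter.mem_of_superset (Metric.isOpen_ball.mem_nhds hd) Metric.ball_subset_closedBall
    filter_upwards [hnhds] with z hz
    have := hmax' z hz
    simpa only [sub_eq_add_neg] using this

end Touching

section Pointwise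

open scoped Topology

variable {k d : ℕ} {Γ1 Γ2 : Type} [Fintype Γ1] [Fintype Γ2] [DecidableEq Γ1] [DecidableEq Γ2]
  [Nontrivial Γ1] [Nontrivial Γ2]

theorem Sys.le_upper_of_subOn (S : Sys k d Γ1 Γ2) {a T : ℝ} {u : Γ1 × Γ2 → ℝ × Euc k → ℝ}
    (husc : ∀ p, UpperSemicontinuous (u p)) (hsub : SubOn S.b S.σm S.F a T u)
    {z : ℝ × Euc k} (hz : z.1 ∈ Ioo a T) (p : Γ1 × Γ2) {l : Γ2} (hl : l ≠ p.2) :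
    u p z ≤ u (p.1, l) z + S.gU p.2 l z.1 z.2 := by
  by_contra! hlt
  obtain ⟨ρ, hρ0, hρ⟩ : ∃ ρ > 0, u (p.1, l) z + S.gU p.2 l z.1 z.2 < u p z - ρ :=
    ⟨(u p z - (u (p.1, l) z + S.gU p.2 l z.1 z.2)) / 2, by linarith, by linarith⟩
  have h1 : ∀ᶠ w in 𝓝 z, u (p.1, l) w + S.gU p.2 l w.1 w.2 < u p z - ρ :=
    ((husc (p.1, l)).add (S.gU_cont p.2 l).upperSemicontinuous) z _ hρ
  have h2 : ∀ᶠ w : ℝ × Euc k in 𝓝 z, w.1 ∈ Ioo a T :=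
    continuous_fst.continuousAt.eventually (isOpen_Ioo.mem_nhds hz)
  obtain ⟨δ, hδ, hδ'⟩ := Metric.eventually_nhds_iff.1 (h1.and h2)
  obtain ⟨z₁, φ, hd, hU, hφ, hmax⟩ := exists_touching_above (husc p) z (lt_min hδ hρ0)
  obtain ⟨h3, h4⟩ := hδ' (hd.trans_le (min_le_left _ _))
  have h5 := ((S.F_nonpos_iff).1 (hsub p z₁ h4 φ hφ hmax)).1 l hl
  have h6 := (abs_lt.1 (hU.trans_le (min_le_right _ _))).1
  linarith

theorem Sys.obstacle_of_superOn (S : Sys k d Γ1 Γ2) {a T : ℝ} {v : Γ1 × Γ2 → ℝ × Euc k → ℝ}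
    (hlsc : ∀ p, LowerSemicontinuous (v p)) (hsup : SuperOn S.b S.σm S.F a T v)
    {z : ℝ × Euc k} (hz : z.1 ∈ Ioo a T) (p : Γ1 × Γ2) :
    (∃ l, l ≠ p.2 ∧ v (p.1, l) z + S.gU p.2 l z.1 z.2 ≤ v p z) ∨
      ∀ i, i ≠ p.1 → v (i, p.2) z - S.gL p.1 i z.1 z.2 ≤ v p z := by
  by_contra! hcon
  obtain ⟨hl, i, hi, hlt⟩ := hcon
  have e1 : ∀ᶠ ρ in 𝓝[>] (0 : ℝ), ∀ l, l ≠ p.2 →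
      v p z + ρ < v (p.1, l) z + S.gU p.2 l z.1 z.2 := by
    rw [Filter.eventually_all]
    intro l
    by_cases hlp : l = p.2
    · exact Filter.Eventually.of_forall fun _ h => absurd hlp h
    · have : Filter.Tendsto (fun ρ : ℝ => v p z + ρ) (𝓝[>] 0) (𝓝 (v p z)) :=
        ((continuous_const_add (v p z)).tendsto' 0 _ (by simp)).mono_left nhdsWithin_le_nhds
      filter_upwards [this.eventually_lt_const (hl l hlp)] with ρ h _ using h
  have e2 : ∀ᶠ ρ in 𝓝[>] (0 : ℝ), v p z + ρ < v (i, p.2) z - S.gL p.1 i z.1 z.2 := by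
    have : Filter.Tendsto (fun ρ : ℝ => v p z + ρ) (𝓝[>] 0) (𝓝 (v p z)) :=
      ((continuous_const_add (v p z)).tendsto' 0 _ (by simp)).mono_left nhdsWithin_le_nhds
    exact this.eventually_lt_const hlt
  obtain ⟨ρ, ⟨hρl, hρi⟩, hρ0⟩ := ((e1.and e2).and self_mem_nhdsWithin).exists
  have h1 : ∀ᶠ w in 𝓝 z, ∀ l, l ≠ p.2 → v p z + ρ < v (p.1, l) w + S.gU p.2 l w.1 w.2 := by
    rw [Filter.eventually_all]
    intro l
    by_cases hlp : l = p.2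
    · exact Filter.Eventually.of_forall fun _ h => absurd hlp h
    · filter_upwards [((hlsc (p.1, l)).add (S.gU_cont p.2 l).lowerSemicontinuous) z _
        (hρl l hlp)] with w hw _ using hw
  have h2 : ∀ᶠ w in 𝓝 z, v p z + ρ < v (i, p.2) w - S.gL p.1 i w.1 w.2 := by
    have hn : Continuous fun w : ℝ × Euc k => -S.gL p.1 i w.1 w.2 := (S.gL_cont p.1 i).neg
    have := ((hlsc (i, p.2)).add hn.lowerSemicontinuous) z (v p z + ρ)
      (by simpa only [sub_eq_add_neg] using hρi)
    filter_upwards [this] with w hw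
    simpa only [sub_eq_add_neg] using hw
  have h3 : ∀ᶠ w : ℝ × Euc k in 𝓝 z, w.1 ∈ Ioo a T :=
    continuous_fst.continuousAt.eventually (isOpen_Ioo.mem_nhds hz)
  obtain ⟨δ, hδ, hδ'⟩ := Metric.eventually_nhds_iff.1 ((h1.and h2).and h3)
  obtain ⟨z₁, φ, hd, hU, hφ, hmax⟩ := exists_touching_above (U := fun w => -v p w)
    ((hlsc p).neg) z (lt_min hδ hρ0)
  obtain ⟨⟨h4, h5⟩, h6⟩ := hδ' (hd.trans_le (min_le_left _ _))
  have hmin : IsLocalMin (fun w => v p w - (-φ w.1 w.2)) z₁ := by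
    filter_upwards [hmax] with w hw
    linarith
  have h7 := (abs_lt.1 (hU.trans_le (min_le_right _ _))).1
  rcases (S.F_nonneg_iff).1 (hsup p z₁ h6 _ hφ.neg hmin) with ⟨l, hlp, h8⟩ | ⟨h8, -⟩
  · have := h4 l hlp
    linarith
  · have := h8 i hi
    linarith

end Pointwise

section Comparison

open scoped Topology

variable {k d : ℕ} {Γ1 Γ2 : Type} [Fintype Γ1] [Fintype Γ2] [DecidableEq Γ1] [DecidableEq Γ2]
  [Nontrivial Γ1] [Nontrivial Γ2]

theorem eventually_forall_lt_sub {ι : Type*} [Finite ι] {P : ι → Prop} {g : ι → ℝ} {c : ℝ} (M : ℝ)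
    (h : ∀ i, P i → g i < c) : ∀ᶠ ρ in 𝓝[>] (0 : ℝ), ∀ i, P i → g i < c - M * ρ := by
  rw [Filter.eventually_all]
  intro i
  by_cases hi : P i
  · have h1 : Continuous fun ρ : ℝ => c - M * ρ := by fun_prop
    have : Filter.Tendsto (fun ρ : ℝ => c - M * ρ) (𝓝[>] 0) (𝓝 c) :=
      (h1.tendsto' 0 _ (by simp)).mono_left nhdsWithin_le_nhds
    filter_upwards [this.eventually_const_lt (h i hi)] with ρ h _ using h
  · exact Filter.Eventually.of_forall fun _ h => absurd h hi

theorem parab_sub (b : ℝ → Euc k → Fin k → ℝ) (σm : ℝ → Euc k → Matrix (Fin k) (Fin d) ℝ)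
    {φ ψ : ℝ → Euc k → ℝ} (h : IsC12 φ) (h' : IsC12 ψ) (z : ℝ × Euc k) :
    parab b σm (fun t x => φ t x - ψ t x) z = parab b σm φ z - parab b σm ψ z := by
  unfold parab
  rw [timeDeriv_sub h h', genL_sub b σm h h']
  ring

theorem parab_add (b : ℝ → Euc k → Fin k → ℝ) (σm : ℝ → Euc k → Matrix (Fin k) (Fin d) ℝ)
    {φ ψ : ℝ → Euc k → ℝ} (h : IsC12 φ) (h' : IsC12 ψ) (z : ℝ × Euc k) :
    parab b σm (fun t x => φ t x + ψ t x) z = parab b σm φ z + parab b σm ψ z := by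
  unfold parab
  rw [timeDeriv_add h h', genL_add b σm h h']
  ring

theorem parab_const_mul (b : ℝ → Euc k → Fin k → ℝ) (σm : ℝ → Euc k → Matrix (Fin k) (Fin d) ℝ)
    {φ : ℝ → Euc k → ℝ} (h : IsC12 φ) (c : ℝ) (z : ℝ × Euc k) :
    parab b σm (fun t x => c * φ t x) z = c * parab b σm φ z := by
  unfold parab
  rw [timeDeriv_const_mul h, genL_const_mul b σm h]
  ring

theorem Sys.no_interior_contact (S : Sys k d Γ1 Γ2) {a T : ℝ} {u v : Γ1 × Γ2 → ℝ × Euc k → ℝ}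
    (husc : ∀ p, UpperSemicontinuous (u p)) (hlsc : ∀ p, LowerSemicontinuous (v p))
    (hsub : SubOn S.b S.σm S.F a T u) (hsup : SuperOn S.b S.σm S.F a T v)
    {C : ℝ} (hC0 : 0 ≤ C)
    (hC : ∀ i j t x y y' z z', |S.f i j t x y z - S.f i j t x y' z'| ≤ C * (‖y - y'‖ + ‖z - z'‖))
    {χ : ℝ → Euc k → ℝ} (hχ : IsC12 χ) (hχc : Continuous fun z : ℝ × Euc k => χ z.1 z.2)
    (hstrict : ∀ z, parab S.b S.σm χ z + C * (χ z.1 z.2 + ‖sigGrad S.σm χ z.1 z.2‖) ≤ -χ z.1 z.2)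
    {z₀ : ℝ × Euc k} (hz₀ : z₀.1 ∈ Ioo a T) (hpos : 0 < χ z₀.1 z₀.2)
    (hle : ∀ᶠ z in 𝓝 z₀, ∀ p, u p z - v p z ≤ χ z.1 z.2)
    (hcontact : ∃ p, u p z₀ - v p z₀ = χ z₀.1 z₀.2) : False := by
  obtain ⟨p, hp, hpL, hpU⟩ := S.exists_inactive_index z₀.1 z₀.2 (u := fun q => u q z₀)
    (v := fun q => v q z₀) (hle.self_of_nhds) hcontact
    (fun q l hl => S.le_upper_of_subOn husc hsub hz₀ q hl)
    (fun q => S.obstacle_of_superOn hlsc hsup hz₀ q)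
  set m := χ z₀.1 z₀.2 with hm
  have e1 := eventually_forall_lt_sub (P := fun i => i ≠ p.1) 1 hpL
  have e2 := eventually_forall_lt_sub (P := fun l => l ≠ p.2)
    (g := fun l => v p z₀ - (v (p.1, l) z₀ + S.gU p.2 l z₀.1 z₀.2)) (c := 0) 2
    (fun l hl => by have := hpU l hl; linarith)
  have e3 := eventually_forall_lt_sub (ι := Unit) (P := fun _ => True) (g := fun _ => 0) (c := m)
    (4 + 5 * C) (fun _ _ => hpos)
  obtain ⟨ρ, ⟨⟨hρL, hρU⟩, hρm⟩, hρ0⟩ := (((e1.and e2).and e3).and self_mem_nhdsWithin).exists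
  replace hρm := hρm () trivial
  replace hρ0 : 0 < ρ := hρ0
  have n1 : ∀ᶠ w in 𝓝 z₀, ∀ i, i ≠ p.1 → u (i, p.2) w - S.gL p.1 i w.1 w.2 < u p z₀ - ρ := by
    rw [Filter.eventually_all]
    intro i
    by_cases hi : i = p.1
    · exact Filter.Eventually.of_forall fun _ h => absurd hi h
    · have hn : Continuous fun w : ℝ × Euc k => -S.gL p.1 i w.1 w.2 := (S.gL_cont p.1 i).neg
      have := ((husc (i, p.2)).add hn.upperSemicontinuous) z₀ (u p z₀ - ρ)
        (by have := hρL i hi; simp only [one_mul, sub_eq_add_neg] at this ⊢; exact this)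
      filter_upwards [this] with w hw _
      simpa only [sub_eq_add_neg] using hw
  have n2 : ∀ᶠ w in 𝓝 z₀, ∀ l, l ≠ p.2 → v p z₀ + 2 * ρ < v (p.1, l) w + S.gU p.2 l w.1 w.2 := by
    rw [Filter.eventually_all]
    intro l
    by_cases hl : l = p.2
    · exact Filter.Eventually.of_forall fun _ h => absurd hl h
    · filter_upwards [((hlsc (p.1, l)).add (S.gU_cont p.2 l).lowerSemicontinuous) z₀
        (v p z₀ + 2 * ρ) (by have := hρU l hl; dsimp only at this ⊢; linarith)] with w hw _ using hw
  have n3 : ∀ᶠ w in 𝓝 z₀, ∀ q, u q w < u q z₀ + ρ := by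
    rw [Filter.eventually_all]
    exact fun q => husc q z₀ _ (by linarith)
  have n4 : ∀ᶠ w in 𝓝 z₀, ∀ q, v q z₀ - ρ < v q w := by
    rw [Filter.eventually_all]
    exact fun q => hlsc q z₀ _ (by linarith)
  have n5 : ∀ᶠ w in 𝓝 z₀, ∀ y q, |S.f p.1 p.2 w.1 w.2 y q - S.f p.1 p.2 z₀.1 z₀.2 y q| < ρ := by
    obtain ⟨η, hη, h⟩ := S.f_cont p.1 p.2 z₀.1 z₀.2 ρ hρ0
    exact Metric.eventually_nhds_iff.2 ⟨η, hη, fun w hw => h w.1 w.2 hw⟩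
  have n6 : ∀ᶠ w : ℝ × Euc k in 𝓝 z₀, |χ w.1 w.2 - m| < ρ := by
    have := Metric.tendsto_nhds.1 (hχc.tendsto z₀) ρ hρ0
    filter_upwards [this] with w hw
    rwa [Real.dist_eq] at hw
  have n7 : ∀ᶠ w : ℝ × Euc k in 𝓝 z₀, w.1 ∈ Ioo a T :=
    continuous_fst.continuousAt.eventually (isOpen_Ioo.mem_nhds hz₀)
  obtain ⟨δ, hδ, hnear⟩ := Metric.eventually_nhds_iff.1
    (n1.and (n2.and (n3.and (n4.and (n5.and (n6.and n7))))))
  obtain ⟨r', hr', hr⟩ := Metric.eventually_nhds_iff.1 hle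
  obtain ⟨CL, hCL0, hCL⟩ := S.lip
  have hV : UpperSemicontinuous fun z : ℝ × Euc k => -v p z + -χ z.1 z.2 :=
    (hlsc p).neg.add hχc.neg.upperSemicontinuous
  obtain ⟨z₁, z₂, φ, ψ, hd1, hd2, hU1, hV2, hφ, hψ, hmaxU, hmaxV, hgen, hgrad⟩ :=
    local_comparison S.b_cont S.σ_cont hCL0 hCL (half_pos hr') (U := u p)
      (V := fun z => -v p z + -χ z.1 z.2)
      ((husc p).upperSemicontinuousOn _) (hV.upperSemicontinuousOn _)
      (z₀ := z₀) (by show u p z₀ + (-v p z₀ + -χ z₀.1 z₀.2) = 0; linarith)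
      (fun z hz => by
        have := hr (lt_of_le_of_lt (Metric.mem_closedBall.1 hz) (half_lt_self hr')) p
        linarith) (lt_min hδ hρ0)
  obtain ⟨h1L, -, h1u, -, h1f, -, h1t⟩ := hnear (hd1.trans_le (min_le_left _ _))
  obtain ⟨-, h2U, -, h2v, h2f, h2χ, h2t⟩ := hnear (hd2.trans_le (min_le_left _ _))
  replace hU1 := abs_lt.1 (hU1.trans_le (min_le_right _ _))
  replace hV2 := abs_lt.1 (hV2.trans_le (min_le_right _ _))
  rw [abs_lt] at h2χ
  have hmin : IsLocalMin (fun w => v p w - (ψ w.1 w.2 - χ w.1 w.2)) z₂ := by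
    filter_upwards [hmaxV] with w hw
    linarith
  have hs1 := ((S.F_nonpos_iff).1 (hsub p z₁ h1t φ hφ hmaxU)).2
  have hs2 := (S.F_nonneg_iff).1 (hsup p z₂ h2t _ (hψ.sub hχ) hmin)
  have hv2 : v p z₂ < v p z₀ + 2 * ρ := by linarith [hV2.1]
  have hp1 : 0 ≤ parab S.b S.σm φ z₁ + S.f p.1 p.2 z₁.1 z₁.2 (fun q => u q z₁)
      (sigGrad S.σm φ z₁.1 z₁.2) := by
    rcases hs1 with ⟨i, hi, h⟩ | h
    · have := h1L i hi
      linarith [hU1.1]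
    · exact h
  have hp2 : parab S.b S.σm (fun t x => ψ t x - χ t x) z₂ + S.f p.1 p.2 z₂.1 z₂.2
      (fun q => v q z₂) (sigGrad S.σm (fun t x => ψ t x - χ t x) z₂.1 z₂.2) ≤ 0 := by
    rcases hs2 with ⟨l, hl, h⟩ | h
    · have := h2U l hl
      linarith
    · exact h.2
  rw [parab_sub S.b S.σm hψ hχ, sigGrad_sub S.σm hψ hχ] at hp2
  set s1 := sigGrad S.σm φ z₁.1 z₁.2
  set s2 := sigGrad S.σm ψ z₂.1 z₂.2
  set s3 := sigGrad S.σm χ z₂.1 z₂.2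
  have hss : ‖s1 - (s2 - s3)‖ ≤ ρ + ‖s3‖ := by
    have : ‖s1 - s2‖ ≤ ρ := by
      rw [pi_norm_le_iff_of_nonneg hρ0.le]
      exact fun l => ((hgrad l).trans_le (min_le_right _ _)).le
    calc ‖s1 - (s2 - s3)‖ = ‖(s1 - s2) + s3‖ := by congr 1; abel
      _ ≤ ‖s1 - s2‖ + ‖s3‖ := norm_add_le _ _
      _ ≤ _ := by linarith
  have hle0 := hle.self_of_nhds
  have hf := S.f_le_of_le_add hC0 hC p z₀.1 z₀.2 (y := fun q => u q z₁) (y' := fun q => v q z₂)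
    (A := m + 3 * ρ) (fun q => by
      have a1 := h1u q
      have a2 := h2v q
      have a3 := hle0 q
      linarith) (by
      have a1 := h1u p
      have a2 := h2v p
      have a3 := hle0 p
      rw [abs_le]
      constructor <;> linarith [hU1.1]) s1 (s2 - s3)
  have hf1 := (abs_lt.1 (h1f (fun q => u q z₁) s1)).2
  have hf2 := (abs_lt.1 (h2f (fun q => v q z₂) (s2 - s3))).1
  have hg : parab S.b S.σm φ z₁ - parab S.b S.σm ψ z₂ < ρ := hgen.trans_le (min_le_right _ _)
  have hst := hstrict z₂
  have hCb : C * (m + 3 * ρ + ‖s1 - (s2 - s3)‖) ≤ C * (χ z₂.1 z₂.2 + ‖s3‖) + C * (5 * ρ) := by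
    rw [← mul_add]
    exact mul_le_mul_of_nonneg_left (by linarith [h2χ.1]) hC0
  linarith [h2χ.1]

end Comparison

section GlobalComparison

open scoped Topology

variable {k d : ℕ} {Γ1 Γ2 : Type} [Fintype Γ1] [Fintype Γ2] [DecidableEq Γ1] [DecidableEq Γ2]
  [Nontrivial Γ1] [Nontrivial Γ2]

/-- Time factor of the strict supersolution penalising the initial time `a`. -/
def decay (μ N a : ℝ) (t : ℝ) : ℝ := Real.exp (-μ * t) * (1 + N * Real.exp (-N * (t - a)))

theorem contDiff_decay (μ N a : ℝ) : ContDiff ℝ 2 (decay μ N a) := by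
  unfold decay; fun_prop

theorem decay_pos {μ N a : ℝ} (hN : 0 ≤ N) (t : ℝ) : 0 < decay μ N a t := by
  unfold decay; positivity

theorem deriv_decay_le {μ N a : ℝ} (t : ℝ) :
    deriv (decay μ N a) t ≤ -μ * decay μ N a t := by
  have h1 : HasDerivAt (fun t => Real.exp (-μ * t)) (Real.exp (-μ * t) * (-μ)) t := by
    simpa using ((hasDerivAt_id t).const_mul (-μ)).exp
  have h2 : HasDerivAt (fun t => 1 + N * Real.exp (-N * (t - a)))
      (N * (Real.exp (-N * (t - a)) * (-N))) t := by
    have := (((((hasDerivAt_id t).sub_const a).const_mul (-N)).exp).const_mul N).const_add 1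
    simpa using this
  have h3 : HasDerivAt (decay μ N a) _ t := h1.mul h2
  rw [h3.deriv]
  unfold decay
  have : 0 ≤ Real.exp (-μ * t) * (N ^ 2 * Real.exp (-N * (t - a))) := by positivity
  nlinarith

/-- A weight that is a strict supersolution of the linearised equation, with a rate independent
of the penalisation parameter. -/
theorem Sys.exists_strict_weight (S : Sys k d Γ1 Γ2) {C : ℝ} (hC0 : 0 ≤ C) (n : ℕ) :
    ∃ μ : ℝ, 0 ≤ μ ∧ ∀ N a : ℝ, 0 ≤ N → ∀ z,
      parab S.b S.σm (fun t x => decay μ N a t * wt n 0 x) z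
        + C * (decay μ N a z.1 * wt n 0 z.2
          + ‖sigGrad S.σm (fun t x => decay μ N a t * wt n 0 x) z.1 z.2‖)
        ≤ -(decay μ N a z.1 * wt n 0 z.2) := by
  obtain ⟨B, hB0, hB⟩ := S.growth
  obtain ⟨K, hK0, hK⟩ := exists_wt_bound hB0 hB n (0 : Euc k)
  refine ⟨K + C * (1 + K) + 1, by positivity, fun N a hN z => ?_⟩
  set μ := K + C * (1 + K) + 1 with hμ
  have hE := decay_pos (μ := μ) (a := a) hN z.1
  have hw : 0 < wt n 0 z.2 := zero_lt_one.trans_le (one_le_wt n 0 z.2)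
  obtain ⟨h1, h2⟩ := hK z.1 z.2
  rw [parab_smul_wt _ _ n 0 ((contDiff_decay μ N a).differentiable (by norm_num))]
  have e1 : deriv (decay μ N a) z.1 * wt n 0 z.2 ≤ -μ * decay μ N a z.1 * wt n 0 z.2 :=
    mul_le_mul_of_nonneg_right (deriv_decay_le _) hw.le
  have e2 : decay μ N a z.1 * genL S.b S.σm (fun _ y => wt n 0 y) z.1 z.2
      ≤ decay μ N a z.1 * (K * wt n 0 z.2) :=
    mul_le_mul_of_nonneg_left ((le_abs_self _).trans h1) hE.le
  have e3 : ‖sigGrad S.σm (fun t x => decay μ N a t * wt n 0 x) z.1 z.2‖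
      ≤ decay μ N a z.1 * (K * wt n 0 z.2) := by
    rw [pi_norm_le_iff_of_nonneg (by positivity)]
    intro l
    rw [sigGrad_smul_wt, Real.norm_eq_abs, abs_mul, abs_of_pos hE]
    exact mul_le_mul_of_nonneg_left (h2 l) hE.le
  have e4 := mul_le_mul_of_nonneg_left (add_le_add_right e3 (decay μ N a z.1 * wt n 0 z.2)) hC0
  rw [hμ] at e1
  nlinarith

theorem upperSemicontinuous_div {X : Type*} [TopologicalSpace X] {w χ : X → ℝ}
    (hw : UpperSemicontinuous w) (hχ : Continuous χ) (hpos : ∀ z, 0 < χ z) :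
    UpperSemicontinuous fun z => w z / χ z := by
  rw [upperSemicontinuous_iff_isOpen_preimage]
  intro c
  have hc : Continuous fun z => -(c * χ z) := by fun_prop
  have : (fun z => w z / χ z) ⁻¹' Iio c = (fun z => w z + -(c * χ z)) ⁻¹' Iio 0 := by
    ext z
    simp only [mem_preimage, mem_Iio, div_lt_iff₀ (hpos z)]
    constructor <;> intro h <;> linarith
  rw [this]
  exact upperSemicontinuous_iff_isOpen_preimage.1 (hw.add hc.upperSemicontinuous) 0

/-- A ratio dominated by a lower order weight attains its positive maximum over a slab. -/
theorem exists_max_ratio {ι : Type*} [Finite ι] {w : ι → ℝ × Euc k → ℝ}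
    (hw : ∀ p, UpperSemicontinuous (w p)) {χ : ℝ × Euc k → ℝ} (hχ : Continuous χ)
    (hpos : ∀ z, 0 < χ z) {a T B : ℝ}
    (hdecay : ∀ p z, z.1 ∈ Icc a T → w p z * (1 + ‖z.2‖ ^ 2) ≤ B * χ z)
    {p₀ : ι} {z₀ : ℝ × Euc k} (hz₀ : z₀.1 ∈ Icc a T) (h0 : 0 < w p₀ z₀) :
    ∃ p z, z.1 ∈ Icc a T ∧ ∀ q z', z'.1 ∈ Icc a T → w q z' / χ z' ≤ w p z / χ z := by
  set m := w p₀ z₀ / χ z₀ with hm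
  have hm0 : 0 < m := div_pos h0 (hpos z₀)
  set R := max ‖z₀.2‖ (|B| / m) with hR
  have hR0 : 0 ≤ R := (norm_nonneg _).trans (le_max_left _ _)
  set Kc : Set (ℝ × Euc k) := Icc a T ×ˢ Metric.closedBall (0 : Euc k) R with hKc
  have hcpt : IsCompact Kc := isCompact_Icc.prod (isCompact_closedBall _ _)
  have hz₀K : z₀ ∈ Kc := ⟨hz₀, by simp [hR]⟩
  have hmax : ∀ p, ∃ z ∈ Kc, ∀ z' ∈ Kc, w p z' / χ z' ≤ w p z / χ z := fun p => by
    obtain ⟨z, hz, h⟩ := ((upperSemicontinuous_div (hw p) hχ hpos).upperSemicontinuousOn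
      Kc).exists_isMaxOn ⟨z₀, hz₀K⟩ hcpt
    exact ⟨z, hz, fun z' hz' => isMaxOn_iff.1 h z' hz'⟩
  choose zm hzm hzmax using hmax
  have : Nonempty ι := ⟨p₀⟩
  obtain ⟨p, hp⟩ := Finite.exists_max fun p => w p (zm p) / χ (zm p)
  refine ⟨p, zm p, (hzm p).1, fun q z' hz' => ?_⟩
  have hpm : m ≤ w p (zm p) / χ (zm p) := (hzmax p₀ z₀ hz₀K).trans (hp p₀)
  by_cases hin : z' ∈ Kc
  · exact (hzmax q z' hin).trans (hp q)
  · refine le_trans ?_ hpm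
    have hfar : R < ‖z'.2‖ := by
      by_contra! hcon
      exact hin ⟨hz', by simpa using hcon⟩
    have h1 := hdecay q z' hz'
    rw [div_le_iff₀ (hpos z')]
    have h2 : |B| ≤ m * ‖z'.2‖ := by
      have : |B| / m ≤ ‖z'.2‖ := (le_max_right _ _).trans hfar.le
      rwa [div_le_iff₀ hm0, mul_comm] at this
    have h3 : |B| ≤ m * (1 + ‖z'.2‖ ^ 2) :=
      h2.trans (mul_le_mul_of_nonneg_left (by nlinarith [sq_nonneg (‖z'.2‖ - 1)]) hm0.le)
    have h4 : B * χ z' ≤ m * (1 + ‖z'.2‖ ^ 2) * χ z' :=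
      mul_le_mul_of_nonneg_right ((le_abs_self B).trans h3) (hpos z').le
    have h5 : 0 < 1 + ‖z'.2‖ ^ 2 := by positivity
    refine le_of_mul_le_mul_right ?_ h5
    linarith

theorem Sys.comparison (S : Sys k d Γ1 Γ2) {a T : ℝ} {u v : Γ1 × Γ2 → ℝ × Euc k → ℝ}
    (husc : ∀ p, UpperSemicontinuous (u p)) (hlsc : ∀ p, LowerSemicontinuous (v p))
    (hsub : SubOn S.b S.σm S.F a T u) (hsup : SuperOn S.b S.σm S.F a T v)
    {B : ℝ} {n : ℕ} (hu : ∀ p z, z.1 ∈ Icc a T → u p z ≤ B * (1 + ‖z.2‖ ^ 2) ^ n)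
    (hv : ∀ p z, z.1 ∈ Icc a T → -v p z ≤ B * (1 + ‖z.2‖ ^ 2) ^ n)
    (hT : ∀ p x, u p (T, x) ≤ v p (T, x)) :
    ∀ p z, z.1 ∈ Ioc a T → u p z ≤ v p z := by
  by_contra! hcon
  obtain ⟨p₀, z₀, hz₀, hlt⟩ := hcon
  obtain ⟨C, hC0, hC⟩ := S.f_lip
  obtain ⟨μ, hμ0, hμ⟩ := S.exists_strict_weight hC0 n
  set B' := max B 0 with hB'
  have hB'0 : 0 ≤ B' := le_max_right _ _
  have hgap : ∀ p z, z.1 ∈ Icc a T → u p z + -v p z ≤ 2 * B' * (1 + ‖z.2‖ ^ 2) ^ n := by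
    intro p z hz
    have h1 := hu p z hz
    have h2 := hv p z hz
    have h3 : B * (1 + ‖z.2‖ ^ 2) ^ n ≤ B' * (1 + ‖z.2‖ ^ 2) ^ n :=
      mul_le_mul_of_nonneg_right (le_max_left _ _) (by positivity)
    linarith
  have hw : ∀ p, UpperSemicontinuous fun z => u p z + -v p z := fun p => (husc p).add (hlsc p).neg
  set τ := z₀.1 - a with hτ
  have hτ0 : 0 < τ := sub_pos.2 hz₀.1
  have hwt : ∀ x : Euc k, wt n 0 x = (1 + ‖x‖ ^ 2) ^ n * (1 + ‖x‖ ^ 2) ^ 2 := fun x => by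
    simp [wt, pow_add]
  set ε := (u p₀ z₀ - v p₀ z₀) / ((1 + 1 / τ) * wt n 0 z₀.2 * Real.exp (-μ * z₀.1)) with hε
  have hwt0 : ∀ x : Euc k, 0 < wt n 0 x := fun x => zero_lt_one.trans_le (one_le_wt n 0 x)
  have hε0 : 0 < ε := div_pos (sub_pos.2 hlt)
    (mul_pos (mul_pos (by positivity) (hwt0 _)) (Real.exp_pos _))
  set N := 2 * B' / (ε * Real.exp (-μ * a)) with hN
  have hN0 : 0 ≤ N := div_nonneg (by positivity) (mul_pos hε0 (Real.exp_pos _)).le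
  set χ : ℝ × Euc k → ℝ := fun z => decay μ N a z.1 * wt n 0 z.2 with hχ
  have hχpos : ∀ z, 0 < χ z := fun z => mul_pos (decay_pos hN0 _) (hwt0 _)
  have hχc : Continuous χ := ((contDiff_decay μ N a).continuous.comp continuous_fst).mul
    ((contDiff_wt n 0).continuous.comp continuous_snd)
  have hdecay : ∀ p z, z.1 ∈ Icc a T →
      (u p z + -v p z) * (1 + ‖z.2‖ ^ 2) ≤ 2 * B' * Real.exp (μ * T) * χ z := by
    intro p z hz
    have hq : 1 ≤ 1 + ‖z.2‖ ^ 2 := by nlinarith [sq_nonneg ‖z.2‖]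
    have hE : 1 ≤ Real.exp (μ * T) * decay μ N a z.1 := by
      unfold decay
      rw [← mul_assoc, ← Real.exp_add]
      refine one_le_mul_of_one_le_of_one_le (Real.one_le_exp ?_) ?_
      · nlinarith [hz.2]
      · have : 0 ≤ N * Real.exp (-N * (z.1 - a)) := by positivity
        linarith
    calc (u p z + -v p z) * (1 + ‖z.2‖ ^ 2)
        ≤ 2 * B' * (1 + ‖z.2‖ ^ 2) ^ n * (1 + ‖z.2‖ ^ 2) :=
          mul_le_mul_of_nonneg_right (hgap p z hz) (by positivity)
      _ ≤ 2 * B' * (1 + ‖z.2‖ ^ 2) ^ n * (1 + ‖z.2‖ ^ 2) ^ 2 :=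
          mul_le_mul_of_nonneg_left (le_self_pow₀ hq (by norm_num)) (by positivity)
      _ = 2 * B' * 1 * wt n 0 z.2 := by rw [hwt]; ring
      _ ≤ 2 * B' * (Real.exp (μ * T) * decay μ N a z.1) * wt n 0 z.2 :=
          mul_le_mul_of_nonneg_right (mul_le_mul_of_nonneg_left hE (by positivity)) (hwt0 _).le
      _ = _ := by rw [hχ]; ring
  obtain ⟨p₁, z₁, hz₁, hmax⟩ := exists_max_ratio hw hχc hχpos hdecay
    (Ioc_subset_Icc_self hz₀) (p₀ := p₀) (by linarith)
  set θ := (u p₁ z₁ + -v p₁ z₁) / χ z₁ with hθ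
  have hcontact : u p₁ z₁ + -v p₁ z₁ = θ * χ z₁ := by
    rw [hθ, div_mul_cancel₀ _ (hχpos z₁).ne']
  have hle : ∀ p z, z.1 ∈ Icc a T → u p z + -v p z ≤ θ * χ z := fun p z hz => by
    rw [← div_le_iff₀ (hχpos z)]
    exact hmax p z hz
  have hεθ : ε ≤ θ := by
    have h1 : ε ≤ (u p₀ z₀ + -v p₀ z₀) / χ z₀ := by
      rw [hε, ← sub_eq_add_neg]
      refine div_le_div_of_nonneg_left (sub_pos.2 hlt).le (hχpos _) ?_
      have : N * Real.exp (-N * (z₀.1 - a)) ≤ 1 / τ := by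
        rw [le_div_iff₀ hτ0]
        have h2 : N * τ ≤ Real.exp (N * τ) := by linarith [Real.add_one_le_exp (N * τ)]
        have h3 : Real.exp (-N * (z₀.1 - a)) * Real.exp (N * τ) = 1 := by
          rw [← Real.exp_add, hτ]; simp
        have h4 := mul_le_mul_of_nonneg_left h2 (Real.exp_pos (-N * (z₀.1 - a))).le
        linarith
      rw [hχ]
      unfold decay
      have h5 : 0 < wt n 0 z₀.2 * Real.exp (-μ * z₀.1) := mul_pos (hwt0 _) (Real.exp_pos _)
      nlinarith
    exact h1.trans (hmax p₀ z₀ (Ioc_subset_Icc_self hz₀))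
  have hθ0 : 0 < θ := hε0.trans_le hεθ
  have hpos1 : 0 < u p₁ z₁ + -v p₁ z₁ := hcontact ▸ mul_pos hθ0 (hχpos z₁)
  have hneT : z₁.1 ≠ T := by
    intro h
    have := hT p₁ z₁.2
    rw [← h] at this
    linarith
  have hnea : z₁.1 ≠ a := by
    intro h
    have h1 := hgap p₁ z₁ hz₁
    rw [hcontact] at h1
    have h2 : χ z₁ = Real.exp (-μ * a) * (1 + N) * wt n 0 z₁.2 := by
      rw [hχ]; simp [decay, h]
    have h3 : 1 ≤ (1 + ‖z₁.2‖ ^ 2) ^ 2 := one_le_pow₀ (by nlinarith [sq_nonneg ‖z₁.2‖])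
    have h4 : ε * χ z₁ ≤ 2 * B' * wt n 0 z₁.2 := by
      calc ε * χ z₁ ≤ θ * χ z₁ := mul_le_mul_of_nonneg_right hεθ (hχpos _).le
        _ ≤ 2 * B' * (1 + ‖z₁.2‖ ^ 2) ^ n * 1 := by rw [mul_one]; exact h1
        _ ≤ 2 * B' * (1 + ‖z₁.2‖ ^ 2) ^ n * (1 + ‖z₁.2‖ ^ 2) ^ 2 :=
          mul_le_mul_of_nonneg_left h3 (by positivity)
        _ = _ := by rw [hwt]; ring
    have h5 : ε * Real.exp (-μ * a) * (1 + N) ≤ 2 * B' := by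
      refine le_of_mul_le_mul_right ?_ (hwt0 z₁.2)
      rw [h2] at h4
      linarith
    have h6 : ε * Real.exp (-μ * a) * N = 2 * B' := by
      rw [hN]; field_simp
    have h7 : 0 < ε * Real.exp (-μ * a) := mul_pos hε0 (Real.exp_pos _)
    linarith
  have hint : z₁.1 ∈ Ioo a T := ⟨lt_of_le_of_ne hz₁.1 (Ne.symm hnea), lt_of_le_of_ne hz₁.2 hneT⟩
  have hχ12 : IsC12 fun t (x : Euc k) => decay μ N a t * wt n 0 x :=
    isC12_smul_wt (contDiff_decay μ N a) n 0
  refine S.no_interior_contact husc hlsc hsub hsup hC0 hC (hχ12.const_mul θ)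
    (continuous_const.mul hχc) (fun z => ?_) hint (mul_pos hθ0 (hχpos z₁)) ?_
    ⟨p₁, by rw [sub_eq_add_neg]; exact hcontact⟩
  · rw [parab_const_mul _ _ hχ12, sigGrad_const_mul _ hχ12, norm_smul, Real.norm_eq_abs,
      abs_of_pos hθ0]
    have := mul_le_mul_of_nonneg_left (hμ N a hN0 z) hθ0.le
    linarith
  · have : ∀ᶠ w : ℝ × Euc k in 𝓝 z₁, w.1 ∈ Ioo a T :=
      continuous_fst.continuousAt.eventually (isOpen_Ioo.mem_nhds hint)
    filter_upwards [this] with w hw p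
    rw [sub_eq_add_neg]
    exact hle p w (Ioo_subset_Icc_self hw)

end GlobalComparison

section MaximumPrinciple

open scoped Topology RealInnerProductSpace

variable {k d : ℕ}

theorem deriv_deriv_nonpos_of_isLocalMax {g : ℝ → ℝ} {s : ℝ} (hg : ContinuousAt g s)
    (h : IsLocalMax g s) : deriv (deriv g) s ≤ 0 := by
  by_contra! hpos
  have hmin := isLocalMin_of_deriv_deriv_pos hpos h.deriv_eq_zero hg
  have hconst : g =ᶠ[𝓝 s] fun _ => g s := by
    filter_upwards [h, hmin] with r h1 h2
    exact le_antisymm h1 h2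
  rw [hconst.deriv.deriv_eq] at hpos
  simp at hpos

theorem fderiv_fderiv_nonpos_of_isLocalMax {E : Type*} [NormedAddCommGroup E] [NormedSpace ℝ E]
    {g : E → ℝ} (hg : ContDiff ℝ 2 g) {x : E} (h : IsLocalMax g x) (v : E) :
    fderiv ℝ (fderiv ℝ g) x v v ≤ 0 := by
  have hd : Differentiable ℝ g := hg.differentiable (by norm_num)
  have hd2 : Differentiable ℝ (fderiv ℝ g) :=
    (hg.fderiv_right (m := 1) (by norm_num)).differentiable (by norm_num)
  have hline : ∀ r : ℝ, HasDerivAt (fun r : ℝ => x + r • v) v r := fun r => by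
    simpa using ((hasDerivAt_id r).smul_const v).const_add x
  have h1 : deriv (fun r : ℝ => g (x + r • v)) = fun r => fderiv ℝ g (x + r • v) v := by
    funext r
    exact ((hd _).hasFDerivAt.comp_hasDerivAt r (hline r)).deriv
  have h2 : deriv (fun r : ℝ => fderiv ℝ g (x + r • v) v) 0 = fderiv ℝ (fderiv ℝ g) x v v := by
    have e0 : HasFDerivAt (fun y => fderiv ℝ g y v) ((fderiv ℝ (fderiv ℝ g) x).flip v) x := by
      refine ((hd2 x).hasFDerivAt.clm_apply (hasFDerivAt_const v x)).congr_fderiv ?_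
      ext w; simp
    have e1 : HasFDerivAt (fun y => fderiv ℝ g y v) ((fderiv ℝ (fderiv ℝ g) x).flip v)
        (x + (0 : ℝ) • v) := by simpa using e0
    exact (e1.comp_hasDerivAt (0 : ℝ) (hline 0)).deriv
  have hcont : Continuous fun r : ℝ => x + r • v := by fun_prop
  have hmax : IsLocalMax (fun r : ℝ => g (x + r • v)) 0 := by
    have : Filter.Tendsto (fun r : ℝ => x + r • v) (𝓝 0) (𝓝 x) := by
      simpa using hcont.tendsto 0
    have h' := this.eventually h
    filter_upwards [h'] with r hr
    simpa using hr
  have := deriv_deriv_nonpos_of_isLocalMax (g := fun r : ℝ => g (x + r • v))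
    (hd.continuous.comp hcont : Continuous fun r : ℝ => g (x + r • v)).continuousAt hmax
  rwa [h1, h2] at this

theorem IsC12.parab_le_of_isLocalMax (b : ℝ → Euc k → Fin k → ℝ)
    (σm : ℝ → Euc k → Matrix (Fin k) (Fin d) ℝ) {χ : ℝ → Euc k → ℝ} (h : IsC12 χ) {z : ℝ × Euc k}
    (hmax : IsLocalMax (fun w : ℝ × Euc k => χ w.1 w.2) z) :
    parab b σm χ z ≤ 0 ∧ sigGrad σm χ z.1 z.2 = 0 := by
  have ht : IsLocalMax (fun s => χ s z.2) z.1 := by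
    have : Filter.Tendsto (fun s : ℝ => (s, z.2)) (𝓝 z.1) (𝓝 z) :=
      (by fun_prop : Continuous fun s : ℝ => (s, z.2)).tendsto z.1
    exact this.eventually hmax
  have hx : IsLocalMax (χ z.1) z.2 := by
    have : Filter.Tendsto (fun y : Euc k => (z.1, y)) (𝓝 z.2) (𝓝 z) :=
      (by fun_prop : Continuous fun y : Euc k => (z.1, y)).tendsto z.2
    exact this.eventually hmax
  have hpd : ∀ i, pd i (χ z.1) z.2 = 0 := fun i => by
    unfold pd; rw [hx.fderiv_eq_zero]; simp
  refine ⟨?_, funext fun l => by simp [sigGrad, hpd]⟩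
  have h0 : timeDeriv χ z.1 z.2 = 0 := ht.deriv_eq_zero
  unfold parab genL
  simp only [h0, hpd, h.pd_pd, mul_zero, Finset.sum_const_zero, zero_add, add_zero]
  set B := fderiv ℝ (fderiv ℝ (χ z.1)) z.2 with hB
  have hsum : ∑ i, ∑ j, (σm z.1 z.2 * (σm z.1 z.2)ᵀ) i j
      * B (EuclideanSpace.single i 1) (EuclideanSpace.single j 1)
      = ∑ l, B (sigCol σm z l) (sigCol σm z l) := by
    simp only [sigCol_eq_sum, map_sum, map_smul, _root_.sum_apply,
      _root_.smul_apply, Matrix.mul_apply, Matrix.transpose_apply, Finset.sum_mul, smul_eq_mul]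
    rw [Finset.sum_comm_cycle]
    refine Finset.sum_congr rfl fun l _ => ?_
    rw [Finset.sum_comm]
    simp only [Finset.mul_sum]
    refine Finset.sum_congr rfl fun i _ => ?_
    refine Finset.sum_congr rfl fun j _ => ?_
    ring
  rw [hsum]
  have : ∑ l, B (sigCol σm z l) (sigCol σm z l) ≤ 0 := Finset.sum_nonpos fun l _ =>
    fderiv_fderiv_nonpos_of_isLocalMax (h.2.2.1 z.1) hx _
  linarith

theorem IsC12.parab_eq_zero_of_eventually (b : ℝ → Euc k → Fin k → ℝ)
    (σm : ℝ → Euc k → Matrix (Fin k) (Fin d) ℝ) {χ : ℝ → Euc k → ℝ} (h : IsC12 χ) {z : ℝ × Euc k}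
    (h0 : ∀ᶠ w in 𝓝 z, χ w.1 w.2 = 0) : parab b σm χ z = 0 ∧ sigGrad σm χ z.1 z.2 = 0 := by
  have h1 := h.parab_le_of_isLocalMax b σm (z := z) (by
    filter_upwards [h0] with w hw
    rw [hw, h0.self_of_nhds])
  have h2 := h.neg.parab_le_of_isLocalMax b σm (z := z) (by
    filter_upwards [h0] with w hw
    rw [hw, h0.self_of_nhds])
  refine ⟨le_antisymm h1.1 ?_, h1.2⟩
  have h3 := h2.1
  unfold parab at h3 ⊢
  rw [timeDeriv_neg, genL_neg b σm h] at h3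
  linarith

/-- Comparison of the derivatives of two functions at a maximum of their difference. -/
theorem IsC12.parab_le_of_isLocalMax_sub (b : ℝ → Euc k → Fin k → ℝ)
    (σm : ℝ → Euc k → Matrix (Fin k) (Fin d) ℝ) {φ ψ : ℝ → Euc k → ℝ} (h : IsC12 φ) (h' : IsC12 ψ)
    {z : ℝ × Euc k} (hmax : IsLocalMax (fun w : ℝ × Euc k => φ w.1 w.2 - ψ w.1 w.2) z) :
    parab b σm φ z ≤ parab b σm ψ z ∧ sigGrad σm φ z.1 z.2 = sigGrad σm ψ z.1 z.2 := by
  obtain ⟨h1, h2⟩ := (h.sub h').parab_le_of_isLocalMax b σm hmax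
  rw [parab_sub b σm h h'] at h1
  rw [sigGrad_sub σm h h'] at h2
  exact ⟨by linarith, sub_eq_zero.1 h2⟩

end MaximumPrinciple

section Barriers

open scoped Topology

variable {k d : ℕ}

/-- A well-founded relation on a finite type admits a strictly monotone real rank. -/
theorem exists_rank {Γ : Type*} [Finite Γ] {R : Γ → Γ → Prop} (hR : WellFounded R) :
    ∃ c : Γ → ℝ, (∀ p, 0 ≤ c p) ∧ ∀ q p, R q p → c q < c p := by
  refine ⟨fun p => ({q | Relation.TransGen R q p} : Set Γ).ncard, fun p => Nat.cast_nonneg _,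
    fun q p h => Nat.cast_lt.2 (Set.ncard_lt_ncard ?_)⟩
  refine ⟨fun r hr => Relation.TransGen.tail hr h, fun hsub => ?_⟩
  exact hR.transGen.irrefl.irrefl q (hsub (Relation.TransGen.single h))

theorem one_add_sq_le_mul (x x₀ : Euc k) :
    1 + ‖x‖ ^ 2 ≤ 2 * (1 + ‖x₀‖ ^ 2) * (1 + ‖x - x₀‖ ^ 2) := by
  have h1 : ‖x‖ ≤ ‖x - x₀‖ + ‖x₀‖ := by simpa using norm_add_le (x - x₀) x₀
  have h2 := pow_le_pow_left₀ (norm_nonneg x) h1 2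
  nlinarith [sq_nonneg (‖x - x₀‖ - ‖x₀‖), mul_nonneg (sq_nonneg ‖x₀‖) (sq_nonneg ‖x - x₀‖)]

theorem pow_le_wt (m : ℕ) (x x₀ : Euc k) :
    (1 + ‖x‖ ^ 2) ^ m ≤ (2 * (1 + ‖x₀‖ ^ 2)) ^ m * wt m x₀ x := by
  calc _ ≤ (2 * (1 + ‖x₀‖ ^ 2) * (1 + ‖x - x₀‖ ^ 2)) ^ m :=
        pow_le_pow_left₀ (by positivity) (one_add_sq_le_mul x x₀) m
    _ = (2 * (1 + ‖x₀‖ ^ 2)) ^ m * (1 + ‖x - x₀‖ ^ 2) ^ m := mul_pow _ _ _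
    _ ≤ _ := by
        refine mul_le_mul_of_nonneg_left ?_ (by positivity)
        exact pow_le_pow_right₀ (by nlinarith [sq_nonneg ‖x - x₀‖]) (by omega)

theorem wt_le_pow (m : ℕ) (x x₀ : Euc k) :
    wt m x₀ x ≤ (2 * (1 + ‖x₀‖ ^ 2)) ^ (m + 2) * (1 + ‖x‖ ^ 2) ^ (m + 2) := by
  rw [wt, ← mul_pow]
  refine pow_le_pow_left₀ (by positivity) ?_ _
  have h := one_add_sq_le_mul (x - x₀) (-x₀)
  simpa using h

/-- Compactly supported test functions have bounded derivatives. -/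
theorem IsC12.exists_bound_of_support {b : ℝ → Euc k → Fin k → ℝ}
    {σm : ℝ → Euc k → Matrix (Fin k) (Fin d) ℝ}
    (hb : Continuous fun p : ℝ × Euc k => b p.1 p.2)
    (hσ : Continuous fun p : ℝ × Euc k => σm p.1 p.2)
    {χ : ℝ → Euc k → ℝ} (h : IsC12 χ) {z₀ : ℝ × Euc k} {ρ : ℝ}
    (h0 : ∀ w, w ∉ Metric.closedBall z₀ ρ → χ w.1 w.2 = 0) :
    ∃ M, 0 ≤ M ∧ ∀ z, |parab b σm χ z| ≤ M ∧ ‖sigGrad σm χ z.1 z.2‖ ≤ M := by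
  have hK : IsCompact (Metric.closedBall z₀ ρ) := isCompact_closedBall _ _
  obtain ⟨M1, hM1⟩ := hK.exists_bound_of_continuousOn (continuous_parab hb hσ h).continuousOn
  obtain ⟨M2, hM2⟩ := hK.exists_bound_of_continuousOn (continuous_sigGrad hσ h).continuousOn
  refine ⟨max 0 (max M1 M2), le_max_left _ _, fun z => ?_⟩
  by_cases hz : z ∈ Metric.closedBall z₀ ρ
  · exact ⟨(hM1 z hz).trans ((le_max_left _ _).trans (le_max_right _ _)),
      (hM2 z hz).trans ((le_max_right _ _).trans (le_max_right _ _))⟩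
  · obtain ⟨h1, h2⟩ := h.parab_eq_zero_of_eventually b σm (z := z) (by
      filter_upwards [Metric.isClosed_closedBall.isOpen_compl.mem_nhds hz] with w hw
      exact h0 w hw)
    rw [h1, h2]
    simp

theorem exists_barrier_values {Γ : Type} [Fintype Γ] {g : Γ → Γ → ℝ} {h₀ : Γ → ℝ}
    (Adj : Γ → Γ → Prop) (hcons : ∀ p q, Adj p q → h₀ q - g p q ≤ h₀ p)
    (hwf : WellFounded fun q p => Adj p q ∧ h₀ q - g p q = h₀ p) {ε : ℝ} (hε : 0 < ε) :
    ∃ e : Γ → ℝ, (∀ p, h₀ p ≤ e p ∧ e p ≤ h₀ p + ε) ∧ ∀ p q, Adj p q → e q - e p < g p q := by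
  obtain ⟨c, hc0, hc⟩ := exists_rank hwf
  have h1 : ∀ᶠ η in 𝓝[>] (0 : ℝ), ∀ p, h₀ p + η * c p ≤ h₀ p + ε := by
    refine Filter.eventually_all.2 fun p => ?_
    have : Filter.Tendsto (fun η : ℝ => η * c p) (𝓝[>] 0) (𝓝 (0 * c p)) :=
      ((continuous_id.mul continuous_const).tendsto 0).mono_left nhdsWithin_le_nhds
    rw [zero_mul] at this
    filter_upwards [this.eventually_lt_const hε] with η hη
    linarith
  have h2 : ∀ᶠ η in 𝓝[>] (0 : ℝ), ∀ p q, Adj p q →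
      (h₀ q + η * c q) - (h₀ p + η * c p) < g p q := by
    refine Filter.eventually_all.2 fun p => Filter.eventually_all.2 fun q => ?_
    by_cases hpq : Adj p q
    · rcases (hcons p q hpq).eq_or_lt with he | hlt
      · filter_upwards [self_mem_nhdsWithin] with η hη _
        have := mul_lt_mul_of_pos_left (hc q p ⟨hpq, he⟩) (mem_Ioi.1 hη)
        linarith
      · have : Filter.Tendsto (fun η : ℝ => η * (c q - c p)) (𝓝[>] 0) (𝓝 (0 * (c q - c p))) :=
          ((continuous_id.mul continuous_const).tendsto 0).mono_left nhdsWithin_le_nhds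
        rw [zero_mul] at this
        filter_upwards [this.eventually_lt_const
          (show 0 < h₀ p - (h₀ q - g p q) by linarith)] with η hη _
        linarith
    · exact Filter.Eventually.of_forall fun _ h => absurd h hpq
  obtain ⟨η, ⟨h1, h2⟩, hη⟩ := ((h1.and h2).and self_mem_nhdsWithin).exists
  exact ⟨fun p => h₀ p + η * c p,
    fun p => ⟨by have := mul_nonneg (mem_Ioi.1 hη).le (hc0 p); linarith, h1 p⟩, h2⟩

end Barriers

section Barriers

open scoped Topology

variable {k d : ℕ}

theorem parab_const (b : ℝ → Euc k → Fin k → ℝ) (σm : ℝ → Euc k → Matrix (Fin k) (Fin d) ℝ)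
    (c : ℝ) (z : ℝ × Euc k) : parab b σm (fun _ _ => c) z = 0 := by
  unfold parab
  rw [timeDeriv_const, genL_const, add_zero]

/-- Smooth supersolutions of a switching problem, close to the terminal data at a given point. -/
theorem exists_barrier {Γ : Type} [Fintype Γ] {b : ℝ → Euc k → Fin k → ℝ}
    {σm : ℝ → Euc k → Matrix (Fin k) (Fin d) ℝ}
    (hb : Continuous fun p : ℝ × Euc k => b p.1 p.2)
    (hσ : Continuous fun p : ℝ × Euc k => σm p.1 p.2)
    {C : ℝ} (hC : 0 ≤ C) (hgrow : ∀ t (x : Euc k), (∀ i, |b t x i| ≤ C * (1 + ‖x‖)) ∧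
      (∀ i l, |σm t x i l| ≤ C * (1 + ‖x‖)))
    (Adj : Γ → Γ → Prop) {G : Γ → Γ → ℝ × Euc k → ℝ} (hG0 : ∀ p q z, 0 ≤ G p q z)
    (hGc : ∀ p q, Continuous (G p q)) {h : Γ → Euc k → ℝ} (hh : ∀ p, Continuous (h p))
    {A : ℝ} {m : ℕ} (hA : 0 ≤ A) (hgr : ∀ p x, |h p x| ≤ A * (1 + ‖x‖ ^ 2) ^ m)
    (T : ℝ) (x₀ : Euc k) (hcons : ∀ p q, Adj p q → h q x₀ - G p q (T, x₀) ≤ h p x₀)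
    (hwf : WellFounded fun q p => Adj p q ∧ h q x₀ - G p q (T, x₀) = h p x₀)
    {L : ℝ} (hL : 0 ≤ L) {ε : ℝ} (hε : 0 < ε) :
    ∃ Ψ : Γ → ℝ → Euc k → ℝ, (∀ p, IsC12 (Ψ p)) ∧
      (∀ p, Continuous fun z : ℝ × Euc k => Ψ p z.1 z.2) ∧
      (∀ p q z, Adj p q → Ψ q z.1 z.2 - G p q z ≤ Ψ p z.1 z.2) ∧
      (∀ p (z : ℝ × Euc k), z.1 ≤ T → parab b σm (Ψ p) z + (A * (1 + ‖z.2‖ ^ 2) ^ m +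
        L * (‖fun q => Ψ q z.1 z.2‖ + ‖sigGrad σm (Ψ p) z.1 z.2‖)) ≤ 0) ∧
      (∀ p x, h p x ≤ Ψ p T x) ∧ (∀ p, Ψ p T x₀ ≤ h p x₀ + ε) ∧
      ∀ a, ∃ (B : ℝ) (n : ℕ), 0 ≤ B ∧ ∀ p (z : ℝ × Euc k), z.1 ∈ Icc a T →
        |Ψ p z.1 z.2| ≤ B * (1 + ‖z.2‖ ^ 2) ^ n := by
  obtain ⟨e, he, heG⟩ := exists_barrier_values (h₀ := fun p => h p x₀)
    (g := fun p q => G p q (T, x₀)) Adj hcons hwf (half_pos hε)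
  have hnear : ∀ᶠ z in 𝓝 ((T, x₀) : ℝ × Euc k), (∀ p q, Adj p q → e q - e p < G p q z) ∧
      ∀ p, h p z.2 < h p x₀ + ε / 2 := by
    refine (Filter.eventually_all.2 fun p => Filter.eventually_all.2 fun q => ?_).and
      (Filter.eventually_all.2 fun p => ?_)
    · by_cases hpq : Adj p q
      · filter_upwards [((hGc p q).tendsto (T, x₀)).eventually_const_lt (heG p q hpq)] with z hz _
        exact hz
      · exact Filter.Eventually.of_forall fun _ h => absurd h hpq
    · exact (((hh p).comp continuous_snd).tendsto (T, x₀)).eventually_lt_const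
        (show h p x₀ < h p x₀ + ε / 2 by linarith)
  obtain ⟨ρ, hρ, hnear⟩ := Metric.eventually_nhds_iff.1 hnear
  set r := ρ / 2 with hr
  have hr0 : 0 < r := half_pos hρ
  let θ : ContDiffBump ((T, x₀) : ℝ × Euc k) := ⟨r, ρ, hr0, half_lt_self hρ⟩
  have hθ12 : IsC12 fun t x => θ (t, x) := IsC12.of_contDiff θ.contDiff
  have hθ0 : ∀ z, 0 ≤ θ z := fun z => θ.nonneg
  have hθ1 : ∀ z, θ z ≤ 1 := fun z => θ.le_one
  have hθout : ∀ z, ρ ≤ dist z (T, x₀) → θ z = 0 := fun z hz => θ.zero_of_le_dist hz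
  have hθin : ∀ z, dist z (T, x₀) ≤ r → θ z = 1 := fun z hz =>
    θ.one_of_mem_closedBall (Metric.mem_closedBall.2 hz)
  obtain ⟨M, hM0, hM⟩ := hθ12.exists_bound_of_support hb hσ (z₀ := (T, x₀)) (ρ := ρ) (by
    intro w hw
    exact hθout w (le_of_lt (by simpa using hw)))
  obtain ⟨K₀, hK₀, hwt⟩ := exists_wt_bound hC hgrow m x₀
  set D := ‖e‖ with hD
  have hD0 : 0 ≤ D := norm_nonneg _
  have heD : ∀ p, |e p| ≤ D := fun p => norm_le_pi_norm e p
  set A₁ := A * (2 * (1 + ‖x₀‖ ^ 2)) ^ m with hA₁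
  have hA₁0 : 0 ≤ A₁ := by positivity
  have hA₁w : ∀ x : Euc k, A * (1 + ‖x‖ ^ 2) ^ m ≤ A₁ * wt m x₀ x := fun x => by
    rw [hA₁, mul_assoc]
    exact mul_le_mul_of_nonneg_left (pow_le_wt m x x₀) hA
  set M' := D * M + A₁ + L * (D + ε / 2 + D * M) with hM'
  have hM'0 : 0 ≤ M' := by positivity
  set K := M' + (A₁ + D) * (1 + r ^ 2) / r ^ 2 with hK
  have hKM : M' ≤ K := le_add_of_nonneg_right (by positivity)
  have hK0 : 0 ≤ K := hM'0.trans hKM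
  set μ := K₀ + L + L * K₀ + 1 with hμ
  have hμ0 : 0 ≤ μ := by positivity
  set E : ℝ → ℝ := fun t => K * Real.exp (μ * (T - t)) with hE
  have hEc : ContDiff ℝ 2 E := by
    simp only [hE]; fun_prop
  have hEd : ∀ t, deriv E t = -μ * E t := fun t => by
    have h1 : HasDerivAt (fun t => μ * (T - t)) (μ * (-1)) t :=
      ((hasDerivAt_id t).const_sub T).const_mul μ
    rw [(h1.exp.const_mul K).deriv]
    simp only [hE]; ring
  have hET : E T = K := by simp [hE]
  have hEK : ∀ t ≤ T, K ≤ E t := fun t ht =>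
    le_mul_of_one_le_right hK0 (Real.one_le_exp (mul_nonneg hμ0 (sub_nonneg.2 ht)))
  have hw1 : ∀ x, 1 ≤ wt m x₀ x := one_le_wt m x₀
  have h12 : ∀ p, IsC12 fun t x => e p * θ (t, x) + ((ε / 2 - K) + E t * wt m x₀ x) := fun p =>
    (hθ12.const_mul (e p)).add ((IsC12.const _).add (isC12_smul_wt hEc m x₀))
  have hθe : ∀ p z, |e p * θ z| ≤ D := fun p z => by
    rw [abs_mul, abs_of_nonneg (hθ0 z)]
    exact (mul_le_of_le_one_right (abs_nonneg _) (hθ1 z)).trans (heD p)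
  have hbound : ∀ p (z : ℝ × Euc k), z.1 ≤ T → |e p * θ (z.1, z.2) + ((ε / 2 - K) + E z.1 * wt m x₀ z.2)|
      ≤ D + ε / 2 + E z.1 * wt m x₀ z.2 := fun p z hz => by
    have h1 := abs_le.1 (hθe p (z.1, z.2))
    have h2 := hEK z.1 hz
    have h3 := mul_le_mul_of_nonneg_left (hw1 z.2) (hK0.trans h2)
    rw [abs_le]
    constructor <;> linarith [h1.1, h1.2]
  refine ⟨fun p t x => e p * θ (t, x) + ((ε / 2 - K) + E t * wt m x₀ x), h12, fun p => ?_,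
    fun p q z hpq => ?_, fun p z hz => ?_, fun p x => ?_, fun p => ?_, fun a => ?_⟩
  · have h1 : Continuous θ := θ.continuous
    have h2 := hEc.continuous
    have h3 : Continuous (wt m x₀) := (contDiff_wt m x₀).continuous
    exact ((continuous_const.mul (h1.comp (continuous_fst.prodMk continuous_snd))).add
      (continuous_const.add ((h2.comp continuous_fst).mul (h3.comp continuous_snd))))
  · have key : (e q - e p) * θ z ≤ G p q z := by
      rcases le_or_gt ρ (dist z (T, x₀)) with hz | hz
      · rw [hθout z hz, mul_zero]; exact hG0 _ _ _
      · have h1 := (hnear hz).1 p q hpq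
        rcases le_or_gt (e q - e p) 0 with h2 | h2
        · exact (mul_nonpos_of_nonpos_of_nonneg h2 (hθ0 z)).trans (hG0 _ _ _)
        · exact (mul_le_of_le_one_right h2.le (hθ1 z)).trans h1.le
    have : θ (z.1, z.2) = θ z := rfl
    simp only [this]
    linarith
  · set w := wt m x₀ z.2 with hw
    have hw1' : 1 ≤ w := hw1 z.2
    have hEz := hEK z.1 hz
    have hE0 : 0 ≤ E z.1 := hK0.trans hEz
    have eP : parab b σm (fun t x => e p * θ (t, x) + ((ε / 2 - K) + E t * wt m x₀ x)) z
        = e p * parab b σm (fun t x => θ (t, x)) z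
          + (-μ * E z.1 * w + E z.1 * genL b σm (fun _ y => wt m x₀ y) z.1 z.2) := by
      rw [parab_add b σm (hθ12.const_mul (e p)) ((IsC12.const _).add (isC12_smul_wt hEc m x₀)),
        parab_add b σm (IsC12.const _) (isC12_smul_wt hEc m x₀), parab_const,
        parab_const_mul b σm hθ12,
        parab_smul_wt b σm m x₀ (hEc.differentiable (by norm_num)), hEd, zero_add]
    have eS : sigGrad σm (fun t x => e p * θ (t, x) + ((ε / 2 - K) + E t * wt m x₀ x)) z.1 z.2
        = e p • sigGrad σm (fun t x => θ (t, x)) z.1 z.2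
          + sigGrad σm (fun t x => E t * wt m x₀ x) z.1 z.2 := by
      rw [sigGrad_add σm (hθ12.const_mul (e p)) ((IsC12.const _).add (isC12_smul_wt hEc m x₀)),
        sigGrad_add σm (IsC12.const _) (isC12_smul_wt hEc m x₀), sigGrad_const,
        sigGrad_const_mul σm hθ12, zero_add]
    have b1 : e p * parab b σm (fun t x => θ (t, x)) z ≤ D * M := by
      refine (le_abs_self _).trans ?_
      rw [abs_mul]
      exact mul_le_mul (heD p) (hM z).1 (abs_nonneg _) hD0
    have b2 : E z.1 * genL b σm (fun _ y => wt m x₀ y) z.1 z.2 ≤ E z.1 * (K₀ * w) :=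
      mul_le_mul_of_nonneg_left ((le_abs_self _).trans (hwt z.1 z.2).1) hE0
    have b3 : ‖fun q => e q * θ (z.1, z.2) + ((ε / 2 - K) + E z.1 * w)‖
        ≤ D + ε / 2 + E z.1 * w := by
      rw [pi_norm_le_iff_of_nonneg (by positivity)]
      exact fun q => hbound q z hz
    have b4 : ‖sigGrad σm (fun t x => e p * θ (t, x) + ((ε / 2 - K) + E t * wt m x₀ x)) z.1 z.2‖
        ≤ D * M + E z.1 * (K₀ * w) := by
      rw [eS]
      refine (norm_add_le _ _).trans (add_le_add ?_ ?_)
      · rw [norm_smul]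
        exact mul_le_mul (heD p) (hM z).2 (norm_nonneg _) hD0
      · rw [pi_norm_le_iff_of_nonneg (by positivity)]
        intro l
        rw [sigGrad_smul_wt, Real.norm_eq_abs, abs_mul, abs_of_nonneg hE0]
        exact mul_le_mul_of_nonneg_left ((hwt z.1 z.2).2 l) hE0
    have b5 := mul_le_mul_of_nonneg_left (add_le_add b3 b4) hL
    have b6 := hA₁w z.2
    have b7 : M' * 1 ≤ M' * w := mul_le_mul_of_nonneg_left hw1' hM'0
    have b8 : M' * w ≤ E z.1 * w :=
      mul_le_mul_of_nonneg_right (hKM.trans hEz) (zero_le_one.trans hw1')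
    have b9 : (D * M + L * (D + ε / 2 + D * M)) * 1 ≤ (D * M + L * (D + ε / 2 + D * M)) * w :=
      mul_le_mul_of_nonneg_left hw1' (by positivity)
    rw [eP]
    have hid : -μ * E z.1 * w + E z.1 * (K₀ * w) + L * (E z.1 * w + E z.1 * (K₀ * w))
        = -(E z.1 * w) := by rw [hμ]; ring
    have hid2 : M' * w = (D * M + L * (D + ε / 2 + D * M)) * w + A₁ * w := by rw [hM']; ring
    have hid3 : L * (D + ε / 2 + E z.1 * w + (D * M + E z.1 * (K₀ * w)))
        = L * (D + ε / 2 + D * M) + L * (E z.1 * w + E z.1 * (K₀ * w)) := by ring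
    linarith
  · show h p x ≤ e p * θ (T, x) + (ε / 2 - K + E T * wt m x₀ x)
    rw [hET]
    have hw0 := hw1 x
    rcases le_or_gt (dist ((T, x) : ℝ × Euc k) (T, x₀)) r with hx | hx
    · rw [hθin _ hx, mul_one]
      have h1 := (hnear (show dist ((T, x) : ℝ × Euc k) (T, x₀) < ρ from
        hx.trans_lt (half_lt_self hρ))).2 p
      have h2 := (he p).1
      have h3 := mul_le_mul_of_nonneg_left hw0 hK0
      simp only at h1 h2
      linarith
    · have hs : r < ‖x - x₀‖ := by
        rwa [Prod.dist_eq, dist_self, dist_eq_norm, max_eq_right (norm_nonneg _)] at hx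
      have h1 : 1 + r ^ 2 ≤ wt m x₀ x := by
        have h2 : 1 + r ^ 2 ≤ 1 + ‖x - x₀‖ ^ 2 := by gcongr
        exact h2.trans (le_self_pow₀ (by nlinarith [sq_nonneg ‖x - x₀‖]) (by omega))
      have h3 := (abs_le.1 (hθe p (T, x))).1
      have h4 := (le_abs_self _).trans ((hgr p x).trans (hA₁w x))
      have h5 : (A₁ + D) * wt m x₀ x ≤ (A₁ + D) * (1 + r ^ 2) / r ^ 2 * (wt m x₀ x - 1) := by
        rw [div_mul_eq_mul_div, le_div_iff₀ (by positivity), mul_assoc, mul_assoc]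
        refine mul_le_mul_of_nonneg_left ?_ (by positivity)
        linarith
      have h6 : 0 ≤ M' * (wt m x₀ x - 1) := mul_nonneg hM'0 (by linarith)
      have h7 : K * (wt m x₀ x - 1) = M' * (wt m x₀ x - 1)
          + (A₁ + D) * (1 + r ^ 2) / r ^ 2 * (wt m x₀ x - 1) := by rw [hK]; ring
      have h8 : D * 1 ≤ D * wt m x₀ x := mul_le_mul_of_nonneg_left hw0 hD0
      linarith
  · show e p * θ (T, x₀) + (ε / 2 - K + E T * wt m x₀ x₀) ≤ h p x₀ + ε
    rw [hET, wt_self, hθin _ (by rw [dist_self]; exact hr0.le)]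
    have := (he p).2
    linarith
  · refine ⟨D + ε / 2 + K * Real.exp (μ * (T - a)) * (2 * (1 + ‖x₀‖ ^ 2)) ^ (m + 2), m + 2,
      by positivity, fun p z hz => (hbound p z hz.2).trans ?_⟩
    have h1 : E z.1 ≤ K * Real.exp (μ * (T - a)) := by
      simp only [hE]
      gcongr
      exact hz.1
    have h2 : (1 : ℝ) ≤ (1 + ‖z.2‖ ^ 2) ^ (m + 2) :=
      one_le_pow₀ (by nlinarith [sq_nonneg ‖z.2‖])
    have h3 := mul_le_mul h1 (wt_le_pow m z.2 x₀) (zero_le_one.trans (hw1 z.2)) (by positivity)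
    have h4 := mul_le_mul_of_nonneg_left h2 (show 0 ≤ D + ε / 2 by positivity)
    rw [add_mul]
    linarith
end Barriers

section SystemBarriers

open scoped Topology

variable {k d : ℕ} {Γ1 Γ2 : Type} [Fintype Γ1] [Fintype Γ2] [DecidableEq Γ1] [DecidableEq Γ2]
  [Nontrivial Γ1] [Nontrivial Γ2]

/-- Projection of the time variable onto `[a, T]`. -/
def clampTime (a T : ℝ) (z : ℝ × Euc k) : ℝ × Euc k := (max a (min T z.1), z.2)

theorem continuous_clampTime (a T : ℝ) : Continuous (clampTime (k := k) a T) :=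
  (continuous_const.max (continuous_const.min continuous_fst)).prodMk continuous_snd

theorem clampTime_mem {a T : ℝ} (haT : a ≤ T) (z : ℝ × Euc k) : (clampTime a T z).1 ∈ Icc a T :=
  ⟨le_max_left _ _, max_le haT (min_le_left _ _)⟩

theorem clampTime_of_mem {a T : ℝ} {z : ℝ × Euc k} (hz : z.1 ∈ Icc a T) : clampTime a T z = z :=
  Prod.ext (by simp [clampTime, hz.1, hz.2]) rfl

theorem clampTime_of_ge {a T : ℝ} (haT : a ≤ T) {z : ℝ × Euc k} (hz : T ≤ z.1) :
    clampTime a T z = (T, z.2) :=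
  Prod.ext (by simp [clampTime, hz, haT]) rfl

theorem eventually_clampTime {a T : ℝ} {z : ℝ × Euc k} (hz : z.1 ∈ Ioo a T) :
    ∀ᶠ w in 𝓝 z, clampTime a T w = w := by
  have : ∀ᶠ w in 𝓝 z, w.1 ∈ Ioo a T := continuous_fst.continuousAt.eventually (isOpen_Ioo.mem_nhds hz)
  filter_upwards [this] with w hw
  exact clampTime_of_mem ⟨hw.1.le, hw.2.le⟩

namespace Sys

variable (S : Sys k d Γ1 Γ2)

theorem wellFounded_of_cost (t : ℝ) (x : Euc k) {R : Γ1 × Γ2 → Γ1 × Γ2 → Prop} {h : Γ1 × Γ2 → ℝ}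
    (hR : ∀ p q, R p q → p ≠ q ∧ (p.1 = q.1 ∨ p.2 = q.2) ∧
      (if p.1 = q.1 then 0 else -S.gL p.1 q.1 t x) + (if p.2 = q.2 then 0 else S.gU p.2 q.2 t x)
        = h p - h q) :
    WellFounded fun q p => R p q := by
  rw [WellFounded.wellFounded_iff_has_min]
  intro s hs
  by_contra! hcon
  obtain ⟨M, p, hM, hp0, hinj, hRp⟩ := exists_simple_cycle hs (R := R)
    (fun p hp => (hR p p hp).1 rfl) hcon
  refine S.nfl M hM p hp0 hinj (fun q _ => (hR _ _ (hRp q)).2.1) t x ?_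
  rw [Finset.sum_congr rfl fun q _ => (hR _ _ (hRp q)).2.2,
    Finset.sum_range_sub' (fun q => h (p q)), hp0, sub_self]

/-- Consistency of terminal data with the switching costs. -/
structure Terminal (T : ℝ) (h : Γ1 × Γ2 → Euc k → ℝ) : Prop where
  cont : ∀ p, Continuous (h p)
  growth : ∃ (C : ℝ) (m : ℕ), 0 ≤ C ∧ ∀ p x, |h p x| ≤ C * (1 + ‖x‖ ^ 2) ^ m
  lower : ∀ (p : Γ1 × Γ2) x i, i ≠ p.1 → h (i, p.2) x - S.gL p.1 i T x ≤ h p x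
  upper : ∀ (p : Γ1 × Γ2) x l, l ≠ p.2 → h p x ≤ h (p.1, l) x + S.gU p.2 l T x

variable {S} {T : ℝ} {h : Γ1 × Γ2 → Euc k → ℝ}

theorem Terminal.exists_common_bound (H : S.Terminal T h) :
    ∃ (A : ℝ) (m : ℕ) (L : ℝ), 0 ≤ A ∧ 0 ≤ L ∧ (∀ p x, |h p x| ≤ A * (1 + ‖x‖ ^ 2) ^ m) ∧
      ∀ (p : Γ1 × Γ2) t x y z, |S.f p.1 p.2 t x y z| ≤ A * (1 + ‖x‖ ^ 2) ^ m + L * (‖y‖ + ‖z‖) := by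
  obtain ⟨C1, m1, hC1, h1⟩ := H.growth
  obtain ⟨C2, m2, hC2, h2⟩ := S.f_growth
  obtain ⟨L, hL, hL'⟩ := S.f_lip
  have hp1 : ∀ (x : Euc k) {C : ℝ} {m : ℕ}, m ≤ m1 + m2 → 0 ≤ C → C ≤ C1 + C2 →
      C * (1 + ‖x‖ ^ 2) ^ m ≤ (C1 + C2) * (1 + ‖x‖ ^ 2) ^ (m1 + m2) := by
    intro x C m hm hC hle
    exact mul_le_mul hle (pow_le_pow_right₀ (by nlinarith [sq_nonneg ‖x‖]) hm) (by positivity)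
      (by positivity)
  refine ⟨C1 + C2, m1 + m2, L, by positivity, hL,
    fun p x => (h1 p x).trans (hp1 x (by omega) hC1 (by linarith)), fun p t x y z => ?_⟩
  have e1 := hL' p.1 p.2 t x y 0 z 0
  rw [sub_zero, sub_zero] at e1
  have e2 := (h2 p.1 p.2 t x).trans (hp1 x (m := m2) (by omega) hC2 (by linarith))
  have e3 := abs_add_le (S.f p.1 p.2 t x y z - S.f p.1 p.2 t x 0 0) (S.f p.1 p.2 t x 0 0)
  rw [sub_add_cancel] at e3
  linarith

theorem Terminal.exists_super_barrier (H : S.Terminal T h) {a : ℝ} (haT : a ≤ T) (x₀ : Euc k)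
    {ε : ℝ} (hε : 0 < ε) :
    ∃ Ψ : Γ1 × Γ2 → ℝ × Euc k → ℝ, (∀ p, Continuous (Ψ p)) ∧ SuperOn S.b S.σm S.F a T Ψ ∧
      (∀ p z, T ≤ z.1 → h p z.2 ≤ Ψ p z) ∧ (∀ p, Ψ p (T, x₀) ≤ h p x₀ + ε) ∧
      (∃ (B : ℝ) (n : ℕ), 0 ≤ B ∧ ∀ p z, |Ψ p z| ≤ B * (1 + ‖z.2‖ ^ 2) ^ n) ∧
      ∀ p z, Ψ p (clampTime a T z) = Ψ p z := by
  obtain ⟨A, m, L, hA, hL, hh, hf⟩ := H.exists_common_bound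
  obtain ⟨C, hC, hgrow⟩ := S.growth
  obtain ⟨Ψ, h12, hcont, hobs, hpde, hterm, hx₀, hgr⟩ := exists_barrier S.b_cont S.σ_cont hC hgrow
    (fun p q : Γ1 × Γ2 => q.2 = p.2 ∧ q.1 ≠ p.1) (G := fun p q z => S.gL p.1 q.1 z.1 z.2)
    (fun p q z => S.gL_nonneg _ _ _ _) (fun p q => S.gL_cont _ _) H.cont hA hh T x₀
    (by
      rintro p ⟨i, j⟩ ⟨rfl, hi⟩
      exact H.lower p x₀ i hi)
    (S.wellFounded_of_cost T x₀ (h := fun p => h p x₀) (by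
      rintro p q ⟨⟨h2, h1⟩, h3⟩
      refine ⟨fun he => h1 (by rw [he]), Or.inr h2.symm, ?_⟩
      simp only at h3
      rw [if_neg h1.symm, if_pos h2.symm]
      linarith)) hL hε
  obtain ⟨B, n, hB, hBn⟩ := hgr a
  have hT : clampTime a T (T, x₀) = (T, x₀) := clampTime_of_mem (right_mem_Icc.2 haT)
  refine ⟨fun p z => Ψ p (clampTime a T z).1 (clampTime a T z).2,
    fun p => (hcont p).comp (continuous_clampTime a T), ?_, fun p z hz => ?_, fun p => ?_,
    ⟨B, n, hB, fun p z => hBn p (clampTime a T z) (clampTime_mem haT z)⟩,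
    fun p z => by simp only [clampTime_of_mem (clampTime_mem haT z)]⟩
  · intro p z hz φ hφ hmin
    have hev := eventually_clampTime hz
    have hmax : IsLocalMax (fun w : ℝ × Euc k => φ w.1 w.2 - Ψ p w.1 w.2) z := by
      filter_upwards [hmin, hev] with w hw hw'
      simp only [hw', hev.self_of_nhds] at hw
      linarith
    obtain ⟨h1, h2⟩ := hφ.parab_le_of_isLocalMax_sub S.b S.σm (h12 p) hmax
    rw [F_nonneg_iff]
    simp only [hev.self_of_nhds]
    refine Or.inr ⟨fun i hi => hobs p (i, p.2) z ⟨rfl, hi⟩, ?_⟩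
    have h3 := hpde p z hz.2.le
    have h4 := (le_abs_self _).trans (hf p z.1 z.2 (fun q => Ψ q z.1 z.2)
      (sigGrad S.σm φ z.1 z.2))
    rw [h2] at h4 ⊢
    linarith
  · simp only [clampTime_of_ge haT hz]
    exact hterm p z.2
  · simp only [hT]
    exact hx₀ p

theorem Terminal.exists_sub_barrier (H : S.Terminal T h) {a : ℝ} (haT : a ≤ T) (x₀ : Euc k)
    {ε : ℝ} (hε : 0 < ε) :
    ∃ ψ : Γ1 × Γ2 → ℝ × Euc k → ℝ, (∀ p, Continuous (ψ p)) ∧ SubOn S.b S.σm S.F a T ψ ∧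
      (∀ p z, T ≤ z.1 → ψ p z ≤ h p z.2) ∧ (∀ p, h p x₀ - ε ≤ ψ p (T, x₀)) ∧
      (∃ (B : ℝ) (n : ℕ), 0 ≤ B ∧ ∀ p z, |ψ p z| ≤ B * (1 + ‖z.2‖ ^ 2) ^ n) ∧
      ∀ p z, ψ p (clampTime a T z) = ψ p z := by
  obtain ⟨A, m, L, hA, hL, hh, hf⟩ := H.exists_common_bound
  obtain ⟨C, hC, hgrow⟩ := S.growth
  obtain ⟨Ψ, h12, hcont, hobs, hpde, hterm, hx₀, hgr⟩ := exists_barrier S.b_cont S.σ_cont hC hgrow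
    (fun p q : Γ1 × Γ2 => q.1 = p.1 ∧ q.2 ≠ p.2) (G := fun p q z => S.gU p.2 q.2 z.1 z.2)
    (fun p q z => S.gU_nonneg _ _ _ _) (fun p q => S.gU_cont _ _)
    (h := fun p x => -h p x) (fun p => (H.cont p).neg) hA
    (fun p x => by rw [abs_neg]; exact hh p x) T x₀
    (by
      rintro p ⟨i, j⟩ ⟨rfl, hi⟩
      have := H.upper p x₀ j hi
      simp only
      linarith)
    (S.wellFounded_of_cost T x₀ (h := fun p => h p x₀) (by
      rintro p q ⟨⟨h2, h1⟩, h3⟩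
      refine ⟨fun he => h1 (by rw [he]), Or.inl h2.symm, ?_⟩
      simp only at h3
      rw [if_neg h1.symm, if_pos h2.symm]
      linarith)) hL hε
  obtain ⟨B, n, hB, hBn⟩ := hgr a
  have hT : clampTime a T (T, x₀) = (T, x₀) := clampTime_of_mem (right_mem_Icc.2 haT)
  refine ⟨fun p z => -Ψ p (clampTime a T z).1 (clampTime a T z).2,
    fun p => ((hcont p).comp (continuous_clampTime a T)).neg, ?_, fun p z hz => ?_, fun p => ?_,
    ⟨B, n, hB, fun p z => by
      rw [abs_neg]; exact hBn p (clampTime a T z) (clampTime_mem haT z)⟩,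
    fun p z => by simp only [clampTime_of_mem (clampTime_mem haT z)]⟩
  · intro p z hz φ hφ hmax'
    have hev := eventually_clampTime hz
    have hmax : IsLocalMax (fun w : ℝ × Euc k => -Ψ p w.1 w.2 - φ w.1 w.2) z := by
      filter_upwards [hmax', hev] with w hw hw'
      simp only [hw', hev.self_of_nhds] at hw
      linarith
    obtain ⟨h1, h2⟩ := (h12 p).neg.parab_le_of_isLocalMax_sub S.b S.σm hφ hmax
    have e1 : parab S.b S.σm (fun t x => -Ψ p t x) z = -parab S.b S.σm (Ψ p) z := by
      unfold parab
      rw [timeDeriv_neg, genL_neg S.b S.σm (h12 p)]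
      ring
    rw [e1] at h1
    rw [sigGrad_neg S.σm (h12 p)] at h2
    rw [F_nonpos_iff]
    simp only [hev.self_of_nhds]
    refine ⟨fun l hl => ?_, Or.inr ?_⟩
    · have := hobs p (p.1, l) z ⟨rfl, hl⟩
      simp only at this
      linarith
    have h3 := hpde p z hz.2.le
    have h4 := (abs_le.1 (hf p z.1 z.2 (fun q => -Ψ q z.1 z.2) (sigGrad S.σm φ z.1 z.2))).1
    have e3 : ‖fun q => -Ψ q z.1 z.2‖ = ‖fun q => Ψ q z.1 z.2‖ := norm_neg (fun q => Ψ q z.1 z.2)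
    rw [e3, ← h2, norm_neg] at h4
    rw [← h2]
    linarith
  · simp only [clampTime_of_ge haT hz]
    have := hterm p z.2
    linarith
  · simp only [hT]
    have := hx₀ p
    linarith

end Sys
end SystemBarriers

section Perron

open scoped Topology

variable {k d : ℕ}

theorem IsC12.continuous_uncurry {φ : ℝ → Euc k → ℝ} (h : IsC12 φ) :
    Continuous fun w : ℝ × Euc k => φ w.1 w.2 := by
  rw [continuous_iff_continuousAt]
  intro z
  have hd := h.2.1.continuousAt (x := z)
  obtain ⟨r, hr, hball⟩ := Metric.eventually_nhds_iff.1
    (hd.norm.eventually_lt continuousAt_const (lt_add_one _))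
  have h0 : Filter.Tendsto (fun w : ℝ × Euc k => φ w.1 w.2 - φ z.1 w.2) (𝓝 z) (𝓝 0) := by
    have hlim : Filter.Tendsto
        (fun w : ℝ × Euc k => (‖deriv (fun s => φ s z.2) z.1‖ + 1) * ‖w.1 - z.1‖) (𝓝 z) (𝓝 0) := by
      have : Continuous fun w : ℝ × Euc k =>
          (‖deriv (fun s => φ s z.2) z.1‖ + 1) * ‖w.1 - z.1‖ := by fun_prop
      simpa using this.tendsto z
    refine squeeze_zero_norm' ?_ hlim
    filter_upwards [Metric.ball_mem_nhds z hr] with w hw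
    have hw' := Prod.dist_eq (x := w) (y := z) ▸ Metric.mem_ball.1 hw
    refine (convex_ball z.1 r).norm_image_sub_le_of_norm_deriv_le
      (f := fun s => φ s w.2) (fun s _ => h.1 w.2 s) (fun s hs => ?_)
      (Metric.mem_ball_self hr) (max_lt_iff.1 hw').1
    exact (hball (y := (s, w.2)) (by
      rw [Prod.dist_eq]; exact max_lt hs (max_lt_iff.1 hw').2)).le
  have h1 : Filter.Tendsto (fun w : ℝ × Euc k => φ z.1 w.2) (𝓝 z) (𝓝 (φ z.1 z.2)) :=
    ((h.2.2.1 z.1).continuous.comp continuous_snd).tendsto z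
  simpa [ContinuousAt] using h0.add h1

theorem exists_perturbed_test {Γ : Type} [Fintype Γ] {b : ℝ → Euc k → Fin k → ℝ}
    {σm : ℝ → Euc k → Matrix (Fin k) (Fin d) ℝ}
    (hb : Continuous fun z : ℝ × Euc k => b z.1 z.2)
    (hσ : Continuous fun z : ℝ × Euc k => σm z.1 z.2)
    {O : Set ((ℝ × Euc k) × (Γ → ℝ) × ℝ × (Fin d → ℝ))} (hO : IsOpen O) {φ : ℝ → Euc k → ℝ}
    (hφ : IsC12 φ) {z₀ : ℝ × Euc k} {y₀ : Γ → ℝ}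
    (hmem : (z₀, y₀, parab b σm φ z₀, sigGrad σm φ z₀.1 z₀.2) ∈ O) (c : ℝ) :
    ∃ κ > 0, ∃ δ > 0, ∀ (w : ℝ × Euc k) (y : Γ → ℝ), dist w z₀ ≤ δ → (∀ q, |y q - y₀ q| ≤ δ) →
      (w, y, parab b σm (fun t x => φ t x + κ * c * (1 * ((t - z₀.1) ^ 2 + ‖x - z₀.2‖ ^ 2))) w,
        sigGrad σm (fun t x => φ t x + κ * c * (1 * ((t - z₀.1) ^ 2 + ‖x - z₀.2‖ ^ 2))) w.1 w.2)
        ∈ O := by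
  have hQ := isC12_quadratic 1 z₀
  set Q : ℝ → Euc k → ℝ := fun t x => 1 * ((t - z₀.1) ^ 2 + ‖x - z₀.2‖ ^ 2) with hQdef
  have e1 : ∀ (N : ℝ) w, parab b σm (fun t x => φ t x + N * Q t x) w
      = parab b σm φ w + N * parab b σm Q w := fun N w => by
    rw [parab_add b σm hφ (hQ.const_mul N), parab_const_mul b σm hQ]
  have e2 : ∀ (N : ℝ) (w : ℝ × Euc k), sigGrad σm (fun t x => φ t x + N * Q t x) w.1 w.2
      = sigGrad σm φ w.1 w.2 + N • sigGrad σm Q w.1 w.2 := fun N w => by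
    rw [sigGrad_add σm hφ (hQ.const_mul N), sigGrad_const_mul σm hQ]
  have c1 := continuous_parab hb hσ hφ
  have c2 := continuous_parab hb hσ hQ
  have c3 := continuous_sigGrad hσ hφ
  have c4 := continuous_sigGrad hσ hQ
  have hG : Continuous fun v : ℝ × (ℝ × Euc k) × (Γ → ℝ) =>
      (v.2.1, v.2.2, parab b σm φ v.2.1 + v.1 * c * parab b σm Q v.2.1,
        sigGrad σm φ v.2.1.1 v.2.1.2 + (v.1 * c) • sigGrad σm Q v.2.1.1 v.2.1.2) := by
    have h21 : Continuous fun v : ℝ × (ℝ × Euc k) × (Γ → ℝ) => v.2.1 := by fun_prop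
    have hN : Continuous fun v : ℝ × (ℝ × Euc k) × (Γ → ℝ) => v.1 * c := by fun_prop
    exact h21.prodMk ((by fun_prop : Continuous fun v : ℝ × (ℝ × Euc k) × (Γ → ℝ) => v.2.2).prodMk
      (((c1.comp h21).add (hN.mul (c2.comp h21))).prodMk
        ((c3.comp h21).add (hN.smul (c4.comp h21)))))
  obtain ⟨ε, hε, hball⟩ := Metric.isOpen_iff.1 (hO.preimage hG) (0, z₀, y₀) (by
    simpa using hmem)
  refine ⟨ε / 2, half_pos hε, ε / 2, half_pos hε, fun w y hw hy => ?_⟩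
  have := @hball (ε / 2, w, y) (by
    rw [Metric.mem_ball, Prod.dist_eq, Prod.dist_eq]
    refine max_lt ?_ (max_lt (by linarith) ?_)
    · rw [Real.dist_eq, sub_zero, abs_of_pos (half_pos hε)]; linarith
    · refine lt_of_le_of_lt ((dist_pi_le_iff (half_pos hε).le).2 fun q => ?_) (half_lt_self hε)
      rw [Real.dist_eq]; exact hy q)
  rw [e1, e2]
  exact this

variable {Γ1 Γ2 : Type} [Fintype Γ1] [Fintype Γ2] [DecidableEq Γ1] [DecidableEq Γ2]
  [Nontrivial Γ1] [Nontrivial Γ2]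

/-- The upper semicontinuous envelope of a family of subsolutions is a subsolution. -/
theorem Sys.subOn_of_envelope (S : Sys k d Γ1 Γ2) {a T : ℝ}
    {𝒰 : Set (Γ1 × Γ2 → ℝ × Euc k → ℝ)} {V : Γ1 × Γ2 → ℝ × Euc k → ℝ}
    (hsub : ∀ u ∈ 𝒰, SubOn S.b S.σm S.F a T u)
    (husc : ∀ u ∈ 𝒰, ∀ p, UpperSemicontinuous (u p)) (hV : ∀ p, UpperSemicontinuous (V p))
    (hle : ∀ u ∈ 𝒰, ∀ p z, u p z ≤ V p z)
    (happ : ∀ p z, ∀ ε > 0, ∃ᶠ w in 𝓝 z, ∃ u ∈ 𝒰, V p z - ε < u p w) :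
    SubOn S.b S.σm S.F a T V := by
  intro p z₀ hz₀ φ hφ hmax
  by_contra! hpos
  obtain ⟨κ, hκ, δ, hδ, hO⟩ := exists_perturbed_test S.b_cont S.σ_cont
    (isOpen_lt continuous_const (S.F_continuous p)) hφ (y₀ := fun q => V q z₀) hpos 1
  have hφκ := hφ.add ((isC12_quadratic 1 z₀).const_mul (κ * 1))
  set ψ : ℝ → Euc k → ℝ :=
    fun t x => φ t x + κ * 1 * (1 * ((t - z₀.1) ^ 2 + ‖x - z₀.2‖ ^ 2)) with hψ
  have hψc : Continuous fun w : ℝ × Euc k => ψ w.1 w.2 := hφκ.continuous_uncurry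
  have hψ0 : ψ z₀.1 z₀.2 = φ z₀.1 z₀.2 := by simp [hψ]
  have hev : ∀ᶠ w in 𝓝 z₀, V p w - φ w.1 w.2 ≤ V p z₀ - φ z₀.1 z₀.2 ∧
      (∀ q, V q w < V q z₀ + δ) ∧ w.1 ∈ Ioo a T ∧ |ψ w.1 w.2 - ψ z₀.1 z₀.2| < δ / 2 ∧
        dist w z₀ < δ := by
    refine hmax.and ((Filter.eventually_all.2 fun q => hV q z₀ _ (by linarith)).and
      ((continuous_fst.continuousAt.eventually (isOpen_Ioo.mem_nhds hz₀)).and ?_))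
    refine Filter.Eventually.and ?_ (Metric.ball_mem_nhds z₀ hδ)
    exact Metric.tendsto_nhds.1 (hψc.tendsto z₀) (δ / 2) (half_pos hδ)
  obtain ⟨r', hr', hball⟩ := Metric.eventually_nhds_iff.1 hev
  set r := r' / 2 with hr
  have hr0 : 0 < r := half_pos hr'
  have hcl : ∀ w ∈ Metric.closedBall z₀ r, dist w z₀ < r' := fun w hw =>
    lt_of_le_of_lt (Metric.mem_closedBall.1 hw) (half_lt_self hr')
  set η := min (κ * r ^ 2 / 2) (δ / 4) with hη
  have hη0 : 0 < η := lt_min (by positivity) (by positivity)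
  have hη1 : 2 * η ≤ κ * r ^ 2 := by have := min_le_left (κ * r ^ 2 / 2) (δ / 4); linarith
  have hη2 : 2 * η ≤ δ / 2 := by have := min_le_right (κ * r ^ 2 / 2) (δ / 4); linarith
  obtain ⟨w₁, ⟨u, hu, hw₁⟩, hw₁r, hw₁ψ⟩ := ((happ p z₀ η hη0).and_eventually
    (Filter.Eventually.and
      (p := fun w => w ∈ Metric.ball z₀ r) (Metric.ball_mem_nhds z₀ hr0)
      (Metric.tendsto_nhds.1 (hψc.tendsto z₀) η hη0))).exists
  have hn : Continuous fun w : ℝ × Euc k => -ψ w.1 w.2 := hψc.neg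
  obtain ⟨w, hw, hwmax⟩ := (((husc u hu p).add hn.upperSemicontinuous).upperSemicontinuousOn
    _).exists_isMaxOn ⟨z₀, Metric.mem_closedBall_self hr0.le⟩ (isCompact_closedBall z₀ r)
  have hwmax' := isMaxOn_iff.1 hwmax
  obtain ⟨h1, h2, h3, h4, h5⟩ := hball (hcl w hw)
  have h6 := hwmax' w₁ (Metric.ball_subset_closedBall hw₁r)
  rw [Real.dist_eq] at hw₁ψ
  have h7 := (abs_lt.1 hw₁ψ).2
  have h8 := hle u hu p w
  have h9 : ψ w.1 w.2 = φ w.1 w.2 + κ * ((w.1 - z₀.1) ^ 2 + ‖w.2 - z₀.2‖ ^ 2) := by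
    simp [hψ]
  have h10 : κ * dist w z₀ ^ 2 ≤ κ * ((w.1 - z₀.1) ^ 2 + ‖w.2 - z₀.2‖ ^ 2) :=
    mul_le_mul_of_nonneg_left (dist_sq_le_time_space w z₀) hκ.le
  have hd : dist w z₀ < r := by
    refine lt_of_pow_lt_pow_left₀ 2 hr0.le (lt_of_mul_lt_mul_left ?_ hκ.le)
    linarith
  have hloc : IsLocalMax (fun w => u p w - ψ w.1 w.2) w := by
    filter_upwards [Metric.isOpen_ball.mem_nhds hd] with v hv
    simpa only [sub_eq_add_neg] using hwmax' v (Metric.ball_subset_closedBall hv)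
  have hsubw := hsub u hu p w h3 ψ hφκ hloc
  have h12 := (abs_lt.1 h4).1
  have hO' := hO w (fun q => if q = p then u p w else V q z₀ + δ) h5.le (fun q => by
    by_cases hq : q = p
    · subst hq
      simp only [if_true]
      have := h2 q
      rw [abs_le]; constructor <;> linarith
    · simp [hq, abs_of_pos hδ])
  have hanti := S.F_anti (p := p) (z := w) (P := parab S.b S.σm ψ w)
    (q := sigGrad S.σm ψ w.1 w.2) (y := fun q => u q w)
    (y' := fun q => if q = p then u p w else V q z₀ + δ) (fun q => by
      by_cases hq : q = p
      · simp [hq]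
      · simp only [hq, if_false]
        exact (hle u hu q w).trans (h2 q).le) (by simp) le_rfl
  exact absurd (hO'.trans_le hanti) (not_lt.2 hsubw)

end Perron

section Bump

open scoped Topology

variable {k d : ℕ} {Γ1 Γ2 : Type} [Fintype Γ1] [Fintype Γ2] [DecidableEq Γ1] [DecidableEq Γ2]
  [Nontrivial Γ1] [Nontrivial Γ2]

/-- A subsolution whose lower envelope is not a supersolution can be enlarged locally. -/
theorem Sys.exists_bump (S : Sys k d Γ1 Γ2) {a T : ℝ} {W L : Γ1 × Γ2 → ℝ × Euc k → ℝ}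
    (hsub : SubOn S.b S.σm S.F a T W) (husc : ∀ p, UpperSemicontinuous (W p))
    (hlsc : ∀ p, LowerSemicontinuous (L p)) (hLW : ∀ p z, L p z ≤ W p z)
    (happ : ∀ p z, ∀ ε > 0, ∃ᶠ w in 𝓝 z, W p w < L p z + ε)
    {p : Γ1 × Γ2} {z₀ : ℝ × Euc k} {φ : ℝ → Euc k → ℝ} (hφ : IsC12 φ)
    (hmin : IsLocalMin (fun w => L p w - φ w.1 w.2) z₀)
    (hneg : S.F p z₀ (fun q => L q z₀) (parab S.b S.σm φ z₀) (sigGrad S.σm φ z₀.1 z₀.2) < 0)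
    {R : ℝ} (hR : 0 < R) :
    ∃ U : Γ1 × Γ2 → ℝ × Euc k → ℝ, (∀ q, UpperSemicontinuous (U q)) ∧
      SubOn S.b S.σm S.F a T U ∧ (∀ q w, W q w ≤ U q w) ∧
      (∀ q w, R ≤ dist w z₀ → U q w = W q w) ∧ ∃ w, W p w < U p w := by
  obtain ⟨κ, hκ, δ, hδ, hO⟩ := exists_perturbed_test S.b_cont S.σ_cont
    (isOpen_lt (S.F_continuous p) continuous_const) hφ (y₀ := fun q => L q z₀) hneg (-1)
  have hφκ := hφ.add ((isC12_quadratic 1 z₀).const_mul (κ * (-1)))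
  set ψ : ℝ → Euc k → ℝ :=
    fun t x => φ t x + κ * (-1) * (1 * ((t - z₀.1) ^ 2 + ‖x - z₀.2‖ ^ 2)) with hψ
  have hψc : Continuous fun w : ℝ × Euc k => ψ w.1 w.2 := hφκ.continuous_uncurry
  set m := L p z₀ - φ z₀.1 z₀.2 with hm
  have hψ0 : ψ z₀.1 z₀.2 + m = L p z₀ := by simp [hψ, hm]
  have hev : ∀ᶠ w in 𝓝 z₀, L p z₀ - φ z₀.1 z₀.2 ≤ L p w - φ w.1 w.2 ∧
      (∀ q, L q z₀ - δ < L q w) ∧ |ψ w.1 w.2 - ψ z₀.1 z₀.2| < δ / 2 ∧ dist w z₀ < δ := by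
    refine hmin.and ((Filter.eventually_all.2 fun q => hlsc q z₀ _ (by linarith)).and
      (Filter.Eventually.and ?_ (Metric.ball_mem_nhds z₀ hδ)))
    exact Metric.tendsto_nhds.1 (hψc.tendsto z₀) (δ / 2) (half_pos hδ)
  obtain ⟨r', hr', hball⟩ := Metric.eventually_nhds_iff.1 hev
  set r := min r' R with hr
  have hr0 : 0 < r := lt_min hr' hR
  set η := min (κ * r ^ 2 / 8) (δ / 2) with hη
  have hη0 : 0 < η := lt_min (by positivity) (by positivity)
  have hη1 : η ≤ κ * r ^ 2 / 8 := min_le_left _ _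
  have hη2 : η ≤ δ / 2 := min_le_right _ _
  set B : ℝ × Euc k → ℝ := fun w => ψ w.1 w.2 + (m + η) with hB
  have hBc : Continuous B := hψc.add continuous_const
  have hann : ∀ w, r / 2 < dist w z₀ → dist w z₀ < r → B w ≤ W p w := by
    intro w hw1 hw2
    have h1 := (hball (hw2.trans_le (min_le_left _ _))).1
    have h2 : ψ w.1 w.2 = φ w.1 w.2 - κ * ((w.1 - z₀.1) ^ 2 + ‖w.2 - z₀.2‖ ^ 2) := by
      simp [hψ]; ring
    have h3 : κ * (r / 2) ^ 2 ≤ κ * ((w.1 - z₀.1) ^ 2 + ‖w.2 - z₀.2‖ ^ 2) :=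
      mul_le_mul_of_nonneg_left ((pow_le_pow_left₀ (by positivity) hw1.le 2).trans
        (dist_sq_le_time_space w z₀)) hκ.le
    have h4 := hLW p w
    have h5 : 0 < κ * r ^ 2 := by positivity
    simp only [hB]
    nlinarith
  set U : Γ1 × Γ2 → ℝ × Euc k → ℝ :=
    fun q w => if q = p ∧ dist w z₀ < r then max (W q w) (B w) else W q w with hU
  have hUne : ∀ q, q ≠ p → U q = W q := fun q hq => by
    funext w; simp [hU, hq]
  have hWU : ∀ q w, W q w ≤ U q w := fun q w => by
    simp only [hU]; split_ifs
    · exact le_max_left _ _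
    · exact le_rfl
  have hUin : ∀ w, dist w z₀ < r → U p w = max (W p w) (B w) := fun w hw => by simp [hU, hw]
  have hUout : ∀ w, r / 2 < dist w z₀ → U p w = W p w := fun w hw => by
    by_cases h : dist w z₀ < r
    · rw [hUin w h, max_eq_left (hann w hw h)]
    · simp [hU, h]
  have hUsc : ∀ q, UpperSemicontinuous (U q) := by
    intro q
    by_cases hq : q = p
    · subst hq
      intro w y hy
      by_cases hw : dist w z₀ < r
      · rw [hUin w hw] at hy
        have hopen : ∀ᶠ v in 𝓝 w, dist v z₀ < r := Metric.isOpen_ball.mem_nhds hw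
        filter_upwards [hopen, husc q w y (max_lt_iff.1 hy).1,
          hBc.upperSemicontinuous w y (max_lt_iff.1 hy).2] with v h1 h2 h3
        rw [hUin v h1]; exact max_lt h2 h3
      · have hw' : r / 2 < dist w z₀ := by linarith [not_lt.1 hw]
        rw [hUout w hw'] at hy
        have hopen : ∀ᶠ v in 𝓝 w, r / 2 < dist v z₀ :=
          (continuous_id.dist continuous_const).continuousAt.eventually (isOpen_Ioi.mem_nhds hw')
        filter_upwards [hopen, husc q w y hy] with v h1 h2
        rwa [hUout v h1]
    · rw [hUne q hq]; exact husc q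
  refine ⟨U, hUsc, ?_, hWU, fun q w hw => ?_, ?_⟩
  · intro q w hw χ hχ hmax
    by_cases hqw : U q w = W q w
    · refine (S.F_anti (fun i => hWU i w) hqw.symm le_rfl).trans (hsub q w hw χ hχ ?_)
      filter_upwards [hmax] with v hv
      have := hWU q v
      linarith
    · have hq : q = p := by
        by_contra h
        exact hqw (by rw [hUne q h])
      subst hq
      have hd : dist w z₀ < r := by
        by_contra h
        exact hqw (hUout w (by linarith [not_lt.1 h]))
      have hUw := hUin w hd
      have hUB : U q w = B w := by
        rcases max_choice (W q w) (B w) with h | h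
        · exact absurd (hUw.trans h) hqw
        · exact hUw.trans h
      have hloc : IsLocalMax (fun v => ψ v.1 v.2 - χ v.1 v.2) w := by
        have hopen : ∀ᶠ v in 𝓝 w, dist v z₀ < r := Metric.isOpen_ball.mem_nhds hd
        filter_upwards [hmax, hopen] with v h1 h2
        have h3 := (le_max_right (W q v) (B v)).trans_eq (hUin v h2).symm
        rw [hUB] at h1
        simp only [hB] at h1 h3
        linarith
      obtain ⟨hP, hG⟩ := hφκ.parab_le_of_isLocalMax_sub S.b S.σm hχ hloc
      obtain ⟨-, h2, h3, h4⟩ := hball (hd.trans_le (min_le_left _ _))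
      have hO' := hO w (fun i => if i = q then B w else L i z₀ - δ) h4.le (fun i => by
        by_cases hi : i = q
        · subst hi
          simp only [if_true, hB]
          have := abs_lt.1 h3
          rw [abs_le]; constructor <;> linarith [this.1, this.2]
        · simp [hi, abs_of_pos hδ])
      rw [← hG]
      refine (S.F_anti (y := fun i => if i = q then B w else L i z₀ - δ) (fun i => ?_)
        (by simp [hUB]) hP).trans (le_of_lt hO')
      by_cases hi : i = q
      · subst hi; simp [hUB]
      · simp only [hi, if_false]
        exact (h2 i).le.trans ((hLW i w).trans (hWU i w))
  · by_cases hq : q = p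
    · subst hq
      exact hUout w (by linarith [min_le_right r' R])
    · rw [hUne q hq]
  · obtain ⟨w, hw1, hw2, hw3⟩ := ((happ p z₀ (η / 2) (half_pos hη0)).and_eventually
      (Filter.Eventually.and (p := fun w => w ∈ Metric.ball z₀ r) (Metric.ball_mem_nhds z₀ hr0)
        (Metric.tendsto_nhds.1 (hψc.tendsto z₀) (η / 2) (half_pos hη0)))).exists
    refine ⟨w, ?_⟩
    rw [hUin w hw2, lt_max_iff]
    right
    rw [Real.dist_eq] at hw3
    have := (abs_lt.1 hw3).1
    simp only [hB]
    linarith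

end Bump

section Envelope

open scoped Topology

theorem exists_upper_envelope {X : Type*} [TopologicalSpace X] {W g : X → ℝ} (hg : Continuous g)
    (hWg : ∀ z, W z ≤ g z) : ∃ V : X → ℝ, UpperSemicontinuous V ∧ (∀ z, W z ≤ V z) ∧
      ∀ z, ∀ ε > 0, ∃ᶠ w in 𝓝 z, V z - ε < W w := by
  have hbdd : ∀ z, Filter.IsBoundedUnder (· ≤ ·) (𝓝 z) W := fun z =>
    Filter.isBoundedUnder_of_eventually_le (a := g z + 1) (by
      filter_upwards [hg.continuousAt.eventually_lt continuousAt_const (lt_add_one (g z))] with w hw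
      exact (hWg w).trans hw.le)
  have hcob : ∀ z, Filter.IsCoboundedUnder (· ≤ ·) (𝓝 z) W := fun z =>
    ⟨W z, fun _ ha => (Filter.eventually_map.1 ha).self_of_nhds⟩
  refine ⟨fun z => Filter.limsup W (𝓝 z), fun z c hc => ?_, fun z => ?_, fun z ε hε =>
    Filter.frequently_lt_of_lt_limsup (hcob z) (by linarith)⟩
  · obtain ⟨c', hc1, hc2⟩ := exists_between hc
    filter_upwards [(Filter.eventually_lt_of_limsup_lt hc1 (hbdd z)).eventually_nhds] with w hw
    exact (Filter.limsup_le_of_le (hcob w) (hw.mono fun _ h => h.le)).trans_lt hc2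
  · exact Filter.le_limsup_of_le (hbdd z) fun b hb => hb.self_of_nhds

theorem exists_lower_envelope {X : Type*} [TopologicalSpace X] {W g : X → ℝ} (hg : Continuous g)
    (hWg : ∀ z, g z ≤ W z) : ∃ L : X → ℝ, LowerSemicontinuous L ∧ (∀ z, L z ≤ W z) ∧
      ∀ z, ∀ ε > 0, ∃ᶠ w in 𝓝 z, W w < L z + ε := by
  obtain ⟨V, h1, h2, h3⟩ := exists_upper_envelope (W := fun z => -W z) hg.neg
    fun z => neg_le_neg (hWg z)
  refine ⟨fun z => -V z, h1.neg, fun z => by linarith [h2 z], fun z ε hε => ?_⟩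
  exact (h3 z ε hε).mono fun w hw => by linarith

theorem le_of_frequently_approx {X : Type*} [TopologicalSpace X] {f : X → ℝ} (hf : Continuous f)
    {z : X} {c : ℝ} (h : ∀ ε > 0, ∃ᶠ w in 𝓝 z, c - ε < f w) : c ≤ f z := by
  refine le_of_forall_pos_le_add fun ε hε => ?_
  obtain ⟨w, h1, h2⟩ := ((h (ε / 2) (half_pos hε)).and_eventually
    (hf.continuousAt.eventually_lt (g := fun _ => f z + ε / 2) continuousAt_const
      (by linarith))).exists
  linarith

theorem le_of_forall_gt_of_continuous {f g : ℝ → ℝ} (hf : Continuous f) (hg : Continuous g)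
    {a b : ℝ} (hab : a < b) (h : ∀ s ∈ Ioo a b, f s ≤ g s) : f a ≤ g a := by
  have hcl : closure (Ioo a b) ⊆ {s | f s ≤ g s} := closure_minimal h (isClosed_le hf hg)
  rw [closure_Ioo hab.ne] at hcl
  exact hcl (left_mem_Icc.2 hab.le)

theorem mul_weight_le {E : Type*} [Norm E] (x : E) {C C' : ℝ} {m m' : ℕ} (hC : 0 ≤ C)
    (hCC : C ≤ C') (hm : m ≤ m') : C * (1 + ‖x‖ ^ 2) ^ m ≤ C' * (1 + ‖x‖ ^ 2) ^ m' :=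
  mul_le_mul hCC (pow_le_pow_right₀ (by nlinarith [sq_nonneg ‖x‖]) hm) (by positivity)
    (hC.trans hCC)

end Envelope

section Existence

open scoped Topology

variable {k d : ℕ} {Γ1 Γ2 : Type} [Fintype Γ1] [Fintype Γ2] [DecidableEq Γ1] [DecidableEq Γ2]
  [Nontrivial Γ1] [Nontrivial Γ2]

namespace Sys

variable {S : Sys k d Γ1 Γ2} {a T : ℝ} {h : Γ1 × Γ2 → Euc k → ℝ}

theorem le_of_sub_of_super {u v : Γ1 × Γ2 → ℝ × Euc k → ℝ}
    (husc : ∀ p, UpperSemicontinuous (u p)) (hlsc : ∀ p, LowerSemicontinuous (v p))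
    (hsub : SubOn S.b S.σm S.F a T u) (hsup : SuperOn S.b S.σm S.F a T v)
    (hu : ∃ (B : ℝ) (n : ℕ), 0 ≤ B ∧ ∀ p z, u p z ≤ B * (1 + ‖z.2‖ ^ 2) ^ n)
    (hv : ∃ (B : ℝ) (n : ℕ), 0 ≤ B ∧ ∀ p z, -v p z ≤ B * (1 + ‖z.2‖ ^ 2) ^ n)
    (huh : ∀ p (z : ℝ × Euc k), T ≤ z.1 → u p z ≤ h p z.2)
    (hhv : ∀ p (z : ℝ × Euc k), T ≤ z.1 → h p z.2 ≤ v p z) :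
    ∀ p (z : ℝ × Euc k), a < z.1 → u p z ≤ v p z := by
  obtain ⟨B, n, hB, hu⟩ := hu
  obtain ⟨B', n', hB', hv⟩ := hv
  intro p z hz
  rcases le_total T z.1 with hT | hT
  · exact (huh p z hT).trans (hhv p z hT)
  · exact S.comparison husc hlsc hsub hsup (B := B + B') (n := n + n')
      (fun p z _ => (hu p z).trans (mul_weight_le z.2 hB (by linarith) (by omega)))
      (fun p z _ => (hv p z).trans (mul_weight_le z.2 hB' (by linarith) (by omega)))
      (fun p x => (huh p (T, x) le_rfl).trans (hhv p (T, x) le_rfl)) p z ⟨hz, hT⟩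

theorem Terminal.exists_envelopes (H : S.Terminal T h) (haT : a < T) :
    ∃ V L : Γ1 × Γ2 → ℝ × Euc k → ℝ, (∀ p, UpperSemicontinuous (V p)) ∧
      (∀ p, LowerSemicontinuous (L p)) ∧ SubOn S.b S.σm S.F a T V ∧ SuperOn S.b S.σm S.F a T L ∧
      (∀ p z, L p z ≤ V p z) ∧ (∀ p (z : ℝ × Euc k), T ≤ z.1 → V p z ≤ h p z.2) ∧
      (∀ p (z : ℝ × Euc k), T ≤ z.1 → h p z.2 ≤ L p z) ∧
      (∃ (B : ℝ) (n : ℕ), 0 ≤ B ∧ ∀ p z, V p z ≤ B * (1 + ‖z.2‖ ^ 2) ^ n) ∧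
      ∃ (B : ℝ) (n : ℕ), 0 ≤ B ∧ ∀ p z, -L p z ≤ B * (1 + ‖z.2‖ ^ 2) ^ n := by
  obtain ⟨Ψ₀, hΨc, hΨs, hΨT, -, ⟨BΨ, nΨ, hBΨ, hΨB⟩, hΨcl⟩ :=
    H.exists_super_barrier haT.le 0 one_pos
  have hΨg : ∃ (B : ℝ) (n : ℕ), 0 ≤ B ∧ ∀ p z, -Ψ₀ p z ≤ B * (1 + ‖z.2‖ ^ 2) ^ n :=
    ⟨BΨ, nΨ, hBΨ, fun p z => (neg_le_abs _).trans (hΨB p z)⟩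
  set 𝒰 : Set (Γ1 × Γ2 → ℝ × Euc k → ℝ) := {u | (∀ p, UpperSemicontinuous (u p)) ∧
    SubOn S.b S.σm S.F a T u ∧ (∀ p (z : ℝ × Euc k), T ≤ z.1 → u p z ≤ h p z.2) ∧
    ∀ p z, u p z ≤ Ψ₀ p z} with h𝒰
  have hbar : ∀ x₀ : Euc k, ∀ ε > 0, ∃ ψ ∈ 𝒰, (∀ p, Continuous (ψ p)) ∧
      (∀ p (z : ℝ × Euc k), T ≤ z.1 → z.2 = x₀ → h p x₀ - ε ≤ ψ p z) ∧
      ∃ (B : ℝ) (n : ℕ), 0 ≤ B ∧ ∀ p z, -ψ p z ≤ B * (1 + ‖z.2‖ ^ 2) ^ n := by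
    intro x₀ ε hε
    obtain ⟨ψ, hψc, hψs, hψT, hψx, ⟨B, n, hB, hψB⟩, hψcl⟩ := H.exists_sub_barrier haT.le x₀ hε
    have hle : ∀ p (z : ℝ × Euc k), a < z.1 → ψ p z ≤ Ψ₀ p z :=
      le_of_sub_of_super (fun p => (hψc p).upperSemicontinuous)
        (fun p => (hΨc p).lowerSemicontinuous) hψs hΨs
        ⟨B, n, hB, fun p z => (le_abs_self _).trans (hψB p z)⟩ hΨg hψT hΨT
    refine ⟨ψ, ⟨fun p => (hψc p).upperSemicontinuous, hψs, hψT, fun p z => ?_⟩, hψc,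
      fun p z hz hzx => ?_, B, n, hB, fun p z => (neg_le_abs _).trans (hψB p z)⟩
    · have h1 : Continuous fun s : ℝ => ((s, z.2) : ℝ × Euc k) := by fun_prop
      have h2 : ψ p (a, z.2) ≤ Ψ₀ p (a, z.2) :=
        le_of_forall_gt_of_continuous ((hψc p).comp h1) ((hΨc p).comp h1) haT
          fun s hs => hle p (s, z.2) hs.1
      rw [← hψcl, ← hΨcl]
      rcases (clampTime_mem haT.le z).1.eq_or_lt with h3 | h3
      · have : clampTime a T z = (a, z.2) := Prod.ext h3.symm rfl
        rw [this]; exact h2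
      · exact hle p _ h3
    · rw [← hψcl, clampTime_of_ge haT.le hz, hzx]
      exact hψx p
  obtain ⟨ψ₀, hψ₀, hψ₀c, -, hψ₀g⟩ := hbar 0 1 one_pos
  have hbdd : ∀ p z, BddAbove (range fun u : 𝒰 => u.1 p z) := fun p z =>
    ⟨Ψ₀ p z, by rintro _ ⟨u, rfl⟩; exact u.2.2.2.2 p z⟩
  have : Nonempty 𝒰 := ⟨⟨ψ₀, hψ₀⟩⟩
  choose V hVusc hWV hVapp using fun p => exists_upper_envelope
    (W := fun z => ⨆ u : 𝒰, u.1 p z) (hΨc p) fun z => ciSup_le fun u => u.2.2.2.2 p z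
  have hle : ∀ u ∈ 𝒰, ∀ p z, u p z ≤ V p z := fun u hu p z =>
    (le_ciSup (hbdd p z) ⟨u, hu⟩).trans (hWV p z)
  have happ : ∀ p z, ∀ ε > 0, ∃ᶠ w in 𝓝 z, ∃ u ∈ 𝒰, V p z - ε < u p w := fun p z ε hε =>
    (hVapp p z ε hε).mono fun w hw => by
      obtain ⟨u, hu⟩ := exists_lt_of_lt_ciSup hw
      exact ⟨u.1, u.2, hu⟩
  have hVsub : SubOn S.b S.σm S.F a T V :=
    S.subOn_of_envelope (fun u hu => hu.2.1) (fun u hu => hu.1) hVusc hle happ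
  have hVΨ : ∀ p z, V p z ≤ Ψ₀ p z := fun p z =>
    le_of_frequently_approx (hΨc p) fun ε hε => (happ p z ε hε).mono fun w ⟨u, hu, hw⟩ =>
      hw.trans_le (hu.2.2.2 p w)
  have hΨg' : ∃ (B : ℝ) (n : ℕ), 0 ≤ B ∧ ∀ p z, Ψ₀ p z ≤ B * (1 + ‖z.2‖ ^ 2) ^ n :=
    ⟨BΨ, nΨ, hBΨ, fun p z => (le_abs_self _).trans (hΨB p z)⟩
  have hVh : ∀ p (z : ℝ × Euc k), T ≤ z.1 → V p z ≤ h p z.2 := by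
    intro p z hz
    refine le_of_forall_pos_le_add fun ε hε => ?_
    obtain ⟨Ψ, hc, hs, hT, hx, ⟨B, n, hB, hg⟩, hcl⟩ := H.exists_super_barrier haT.le z.2 hε
    have h1 : V p z ≤ Ψ p z := by
      refine le_of_frequently_approx (hc p) fun ε hε => ?_
      have hev : ∀ᶠ w : ℝ × Euc k in 𝓝 z, a < w.1 :=
        continuous_fst.continuousAt.eventually (isOpen_Ioi.mem_nhds (haT.trans_le hz))
      refine ((happ p z ε hε).and_eventually hev).mono fun w ⟨⟨u, hu, hw⟩, hwa⟩ => ?_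
      obtain ⟨B', n', hB', hg'⟩ := hΨg'
      exact hw.trans_le (le_of_sub_of_super hu.1 (fun p => (hc p).lowerSemicontinuous) hu.2.1 hs
        ⟨B', n', hB', fun p z => (hu.2.2.2 p z).trans (hg' p z)⟩
        ⟨B, n, hB, fun p z => (neg_le_abs _).trans (hg p z)⟩ hu.2.2.1 hT p w hwa)
    rw [← hcl, clampTime_of_ge haT.le hz] at h1
    exact h1.trans (hx p)
  choose L hLlsc hLV hLapp using fun p => exists_lower_envelope (W := V p) (hψ₀c p)
    fun z => hle ψ₀ hψ₀ p z
  have hLge : ∀ ψ ∈ 𝒰, (∀ p, Continuous (ψ p)) → ∀ p z, ψ p z ≤ L p z := by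
    intro ψ hψ hψc p z
    have hn : Continuous fun w => -ψ p w := (hψc p).neg
    refine neg_le_neg_iff.1 (le_of_frequently_approx hn fun ε hε =>
      (hLapp p z ε hε).mono fun w hw => ?_)
    linarith [hle ψ hψ p w]
  refine ⟨V, L, hVusc, hLlsc, hVsub, ?_, hLV, hVh, fun p z hz => ?_, ?_, ?_⟩
  · intro p z₀ hz₀ φ hφ hmin
    by_contra! hneg
    set R := min (z₀.1 - a) (T - z₀.1) with hR
    have hR0 : 0 < R := lt_min (by linarith [hz₀.1]) (by linarith [hz₀.2])
    have hin : ∀ w : ℝ × Euc k, dist w z₀ < R → w.1 ∈ Ioo a T := fun w hw => by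
      have h1 : |w.1 - z₀.1| < R := by
        rw [← Real.dist_eq]
        exact (le_max_left _ _).trans_lt (Prod.dist_eq (x := w) (y := z₀) ▸ hw)
      have h2 := abs_lt.1 h1
      exact ⟨by linarith [h2.1, min_le_left (z₀.1 - a) (T - z₀.1)],
        by linarith [h2.2, min_le_right (z₀.1 - a) (T - z₀.1)]⟩
    obtain ⟨U, hUusc, hUsub, hVU, hUV, w, hw⟩ := S.exists_bump hVsub hVusc hLlsc hLV hLapp hφ hmin
      hneg hR0
    have hUh : ∀ p (z : ℝ × Euc k), T ≤ z.1 → U p z ≤ h p z.2 := fun q z hz => by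
      rw [hUV q z (not_lt.1 fun hlt => absurd (hin z hlt).2 (not_lt.2 hz))]
      exact hVh q z hz
    have hUB : ∃ M : ℝ, 0 ≤ M ∧ ∀ q, ∀ z ∈ Metric.closedBall z₀ R, U q z ≤ M := by
      choose y hy hmax using fun q => ((hUusc q).upperSemicontinuousOn _).exists_isMaxOn
        ⟨z₀, Metric.mem_closedBall_self hR0.le⟩ (isCompact_closedBall z₀ R)
      refine ⟨∑ q, |U q (y q)|, Finset.sum_nonneg fun _ _ => abs_nonneg _, fun q z hz => ?_⟩
      exact (isMaxOn_iff.1 (hmax q) z hz).trans ((le_abs_self _).trans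
        (Finset.single_le_sum (f := fun q => |U q (y q)|) (fun _ _ => abs_nonneg _)
          (Finset.mem_univ q)))
    obtain ⟨M, hM, hUM⟩ := hUB
    have hUg : ∃ (B : ℝ) (n : ℕ), 0 ≤ B ∧ ∀ p z, U p z ≤ B * (1 + ‖z.2‖ ^ 2) ^ n := by
      obtain ⟨B', n', hB', hg'⟩ := hΨg'
      refine ⟨B' + M, n', by linarith, fun q z => ?_⟩
      by_cases hz : dist z z₀ < R
      · refine (hUM q z hz.le).trans ?_
        have := mul_weight_le z.2 hM (show M ≤ B' + M by linarith) (Nat.zero_le n')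
        simpa using this
      · rw [hUV q z (not_lt.1 hz)]
        exact ((hVΨ q z).trans (hg' q z)).trans (mul_weight_le z.2 hB' (by linarith) le_rfl)
    have hU : U ∈ 𝒰 := by
      refine ⟨hUusc, hUsub, hUh, fun q z => ?_⟩
      by_cases hz : a < z.1
      · exact le_of_sub_of_super hUusc (fun p => (hΨc p).lowerSemicontinuous) hUsub hΨs hUg hΨg
          hUh hΨT q z hz
      · rw [hUV q z (not_lt.1 fun hlt => absurd (hin z hlt).1 hz)]
        exact hVΨ q z
    exact absurd (hle U hU p w) (not_le.2 hw)
  · refine le_of_forall_pos_le_add fun ε hε => ?_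
    obtain ⟨ψ, hψ, hψc, hψx, -⟩ := hbar z.2 ε hε
    have h1 := hψx p z hz rfl
    have h2 := hLge ψ hψ hψc p z
    linarith
  · obtain ⟨B', n', hB', hg'⟩ := hΨg'
    exact ⟨B', n', hB', fun p z => (hVΨ p z).trans (hg' p z)⟩
  · obtain ⟨B, n, hB, hg⟩ := hψ₀g
    exact ⟨B, n, hB, fun p z => (neg_le_neg (hLge ψ₀ hψ₀ hψ₀c p z)).trans (hg p z)⟩

theorem Terminal.exists_solution (H : S.Terminal T h) (hT : 0 < T) :
    ∃ v : Γ1 × Γ2 → ℝ × Euc k → ℝ, (∀ p, Continuous (v p)) ∧ SubOn S.b S.σm S.F 0 T v ∧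
      SuperOn S.b S.σm S.F 0 T v ∧ (∀ p x, v p (T, x) = h p x) ∧
      ∃ (B : ℝ) (n : ℕ), 0 ≤ B ∧ ∀ p z, |v p z| ≤ B * (1 + ‖z.2‖ ^ 2) ^ n := by
  obtain ⟨V, L, hV, hL, hVs, hLs, hLV, hVT, hLT, hVg, hLg⟩ :=
    H.exists_envelopes (a := -1) (by linarith : (-1 : ℝ) < T)
  have hVL : ∀ p (z : ℝ × Euc k), -1 < z.1 → V p z = L p z := fun p z hz =>
    le_antisymm (le_of_sub_of_super hV hL hVs hLs hVg hLg hVT hLT p z hz) (hLV p z)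
  have hcl : ∀ z : ℝ × Euc k, -1 < (clampTime 0 T z).1 := fun z =>
    lt_of_lt_of_le (by norm_num) (clampTime_mem hT.le z).1
  have hVL' : ∀ p (z : ℝ × Euc k), V p (clampTime 0 T z) = L p (clampTime 0 T z) := fun p z =>
    hVL p _ (hcl z)
  have hsub : Ioo (0 : ℝ) T ⊆ Ioo (-1) T := Ioo_subset_Ioo_left (by norm_num)
  have hself : ∀ z : ℝ × Euc k, z.1 ∈ Ioo 0 T → clampTime 0 T z = z := fun z hz =>
    clampTime_of_mem (Ioo_subset_Icc_self hz)
  refine ⟨fun p z => V p (clampTime 0 T z), fun p => ?_, ?_, ?_, fun p x => ?_, ?_⟩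
  · rw [continuous_iff_lower_upperSemicontinuous]
    refine ⟨?_, (hV p).comp (continuous_clampTime 0 T)⟩
    simp only [hVL']
    exact (hL p).comp (continuous_clampTime 0 T)
  · intro p z hz φ hφ hmax
    simp only [hself z hz]
    refine hVs p z (hsub hz) φ hφ ?_
    have hmax' : ∀ᶠ w in 𝓝 z, V p (clampTime 0 T w) - φ w.1 w.2
      ≤ V p (clampTime 0 T z) - φ z.1 z.2 := hmax
    filter_upwards [hmax', eventually_clampTime hz] with w hw hw'
    rwa [hw', hself z hz] at hw
  · intro p z hz φ hφ hmin
    have he : ∀ q, V q z = L q z := fun q => by simpa only [hself z hz] using hVL' q z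
    simp only [hself z hz, he]
    refine hLs p z (hsub hz) φ hφ ?_
    have hmin' : ∀ᶠ w in 𝓝 z, V p (clampTime 0 T z) - φ z.1 z.2
      ≤ V p (clampTime 0 T w) - φ w.1 w.2 := hmin
    filter_upwards [hmin', eventually_clampTime hz] with w hw hw'
    rwa [hVL', hVL', hw', hself z hz] at hw
  · show V p (clampTime 0 T (T, x)) = h p x
    rw [clampTime_of_ge hT.le le_rfl]
    exact le_antisymm (hVT p (T, x) le_rfl) ((hLT p (T, x) le_rfl).trans (hLV p _))
  · obtain ⟨B, n, hB, hg⟩ := hVg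
    obtain ⟨B', n', hB', hg'⟩ := hLg
    refine ⟨B + B', n + n', by linarith, fun p z => abs_le'.2 ⟨?_, ?_⟩⟩
    · exact (hg p _).trans (mul_weight_le z.2 hB (by linarith) (by omega))
    · refine (neg_le_neg (hVL' p z).ge).trans ?_
      exact (hg' p _).trans (mul_weight_le z.2 hB' (by linarith) (by omega))

end Sys

end Existence

section Reduction

open scoped Topology

variable {k d : ℕ} {Γ1 Γ2 : Type}

theorem rpow_le_weight {r γ : ℝ} (hr : 0 ≤ r) (hγ : 0 ≤ γ) :
    r ^ γ ≤ (1 + r ^ 2) ^ ⌈γ⌉₊ := by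
  have h1 : r ≤ 1 + r ^ 2 := by nlinarith [sq_nonneg (r - 1)]
  have h2 : 1 ≤ 1 + r ^ 2 := by nlinarith [sq_nonneg r]
  calc r ^ γ ≤ (1 + r ^ 2) ^ γ := Real.rpow_le_rpow hr h1 hγ
    _ ≤ (1 + r ^ 2) ^ (⌈γ⌉₊ : ℝ) := Real.rpow_le_rpow_of_exponent_le h2 (Nat.le_ceil γ)
    _ = (1 + r ^ 2) ^ ⌈γ⌉₊ := Real.rpow_natCast _ _

theorem exists_uniform_weight {ι α E : Type*} [Fintype ι] [SeminormedAddCommGroup E] (e : α → E)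
    {s : Set α} {g : ι → α → ℝ} (h : ∀ i, ∃ C γ : ℝ, 0 ≤ C ∧ 0 ≤ γ ∧ ∀ x ∈ s,
      |g i x| ≤ C * (1 + ‖e x‖ ^ γ)) :
    ∃ (C : ℝ) (m : ℕ), 0 ≤ C ∧ ∀ i, ∀ x ∈ s, |g i x| ≤ C * (1 + ‖e x‖ ^ 2) ^ m := by
  choose C γ hC hγ hg using h
  refine ⟨∑ i, 2 * C i, ∑ i, ⌈γ i⌉₊,
    Finset.sum_nonneg fun i _ => mul_nonneg two_pos.le (hC i), fun i x hx => ?_⟩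
  have h1 := rpow_le_weight (norm_nonneg (e x)) (hγ i)
  have h2 : 1 ≤ (1 + ‖e x‖ ^ 2) ^ ⌈γ i⌉₊ := one_le_pow₀ (by nlinarith [sq_nonneg ‖e x‖])
  have h3 : |g i x| ≤ 2 * C i * (1 + ‖e x‖ ^ 2) ^ ⌈γ i⌉₊ := by
    refine (hg i x hx).trans ?_
    have := mul_le_mul_of_nonneg_left (add_le_add h2 h1) (hC i)
    linarith
  exact h3.trans (mul_weight_le (e x) (mul_nonneg two_pos.le (hC i))
    (Finset.single_le_sum (f := fun i => 2 * C i)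
      (fun i _ => mul_nonneg two_pos.le (hC i)) (Finset.mem_univ i))
    (Finset.single_le_sum (f := fun i => ⌈γ i⌉₊) (fun _ _ => Nat.zero_le _) (Finset.mem_univ i)))

theorem polyGrowth_of_weight {T B : ℝ} {n : ℕ} {Φ : ℝ → Euc k → ℝ} (hB : 0 ≤ B)
    (h : ∀ t x, |Φ t x| ≤ B * (1 + ‖x‖ ^ 2) ^ n) : PolyGrowth T Φ := by
  refine ⟨B * 2 ^ n, (2 * n : ℕ), by positivity, by positivity, fun t _ x => (h t x).trans ?_⟩
  rw [Real.rpow_natCast, mul_assoc]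
  refine mul_le_mul_of_nonneg_left ?_ hB
  have h1 : (1 + ‖x‖ ^ 2) ^ n ≤ (2 * max 1 (‖x‖ ^ 2)) ^ n :=
    pow_le_pow_left₀ (by positivity)
      (by linarith [le_max_left 1 (‖x‖ ^ 2), le_max_right 1 (‖x‖ ^ 2)]) n
  have h2 : (max 1 (‖x‖ ^ 2)) ^ n ≤ 1 + ‖x‖ ^ (2 * n) := by
    rcases max_choice 1 (‖x‖ ^ 2) with h | h
    · rw [h, one_pow]; linarith [pow_nonneg (norm_nonneg x) (2 * n)]
    · rw [h, ← pow_mul]; linarith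
  rw [mul_pow] at h1
  exact h1.trans (mul_le_mul_of_nonneg_left h2 (by positivity))

theorem monotone_of_coordinatewise {ι : Type*} [Fintype ι] [DecidableEq ι] {g : (ι → ℝ) → ℝ}
    {i₀ : ι} (hg : ∀ i, i ≠ i₀ → ∀ y y' : ι → ℝ, (∀ j, j ≠ i → y j = y' j) → y i ≤ y' i →
      g y ≤ g y') {y y' : ι → ℝ} (hy : y ≤ y') (h0 : y i₀ = y' i₀) : g y ≤ g y' := by
  have key : ∀ s : Finset ι, g y ≤ g fun i => if i ∈ s then y' i else y i := by
    intro s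
    induction s using Finset.induction_on with
    | empty => simp
    | insert i s hi ih =>
      refine ih.trans ?_
      by_cases h : i = i₀
      · subst h
        refine le_of_eq (congrArg g (funext fun j => ?_))
        by_cases hj : j = i
        · subst hj; simp [hi, h0]
        · simp [Finset.mem_insert, hj]
      · refine hg i h _ _ (fun j hj => by simp [Finset.mem_insert, hj]) ?_
        simpa [hi] using hy i
  simpa using key Finset.univ

/-- Projection of a time onto `[0, T]`. -/
def clampReal (T t : ℝ) : ℝ := max 0 (min T t)

theorem continuous_clampReal (T : ℝ) : Continuous (clampReal T) :=
  continuous_const.max (continuous_const.min continuous_id)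

theorem clampReal_mem {T : ℝ} (hT : 0 ≤ T) (t : ℝ) : clampReal T t ∈ Icc 0 T :=
  ⟨le_max_left _ _, max_le hT (min_le_left _ _)⟩

theorem clampReal_of_mem {T t : ℝ} (ht : t ∈ Icc 0 T) : clampReal T t = t := by
  simp [clampReal, ht.1, ht.2]

theorem exists_linear_growth {ι : Type*} [Fintype ι] {T C : ℝ} {g : ℝ → Euc k → ι → ℝ}
    (hg : Continuous fun p : ℝ × Euc k => g p.1 p.2)
    (hlip : ∀ t ∈ Icc 0 T, ∀ x x' : Euc k, ∀ i, |g t x i - g t x' i| ≤ C * ‖x - x'‖) :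
    ∃ M : ℝ, 0 ≤ M ∧ ∀ t ∈ Icc 0 T, ∀ x i, |g t x i| ≤ M * (1 + ‖x‖) := by
  have hc : Continuous fun t : ℝ => g t 0 :=
    hg.comp (continuous_id.prodMk continuous_const)
  obtain ⟨M, hM⟩ := (isCompact_Icc (a := (0 : ℝ)) (b := T)).exists_bound_of_continuousOn
    hc.continuousOn
  refine ⟨max C (max M 0), le_max_of_le_right (le_max_right _ _), fun t ht x i => ?_⟩
  have h1 := hlip t ht x 0 i
  rw [sub_zero] at h1
  have h2 : |g t 0 i| ≤ M := (norm_le_pi_norm (g t 0) i).trans (hM t ht)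
  have h3 := abs_add_le (g t x i - g t 0 i) (g t 0 i)
  rw [sub_add_cancel] at h3
  have h4 : C * ‖x‖ ≤ max C (max M 0) * ‖x‖ :=
    mul_le_mul_of_nonneg_right (le_max_left _ _) (norm_nonneg x)
  have h5 : M ≤ max C (max M 0) := le_max_of_le_right (le_max_left _ _)
  linarith

variable [Fintype Γ1] [Fintype Γ2] [DecidableEq Γ1] [DecidableEq Γ2]

theorem exists_clamped_sys {T : ℝ} (hT : 0 ≤ T)
    {b : ℝ → Euc k → Fin k → ℝ} {σm : ℝ → Euc k → Matrix (Fin k) (Fin d) ℝ}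
    {f : Γ1 → Γ2 → ℝ → Euc k → ((Γ1 × Γ2) → ℝ) → (Fin d → ℝ) → ℝ}
    {gLow : Γ1 → Γ1 → ℝ → Euc k → ℝ} {gUp : Γ2 → Γ2 → ℝ → Euc k → ℝ}
    (H0b : Continuous fun p : ℝ × Euc k => b p.1 p.2)
    (H0s : Continuous fun p : ℝ × Euc k => σm p.1 p.2)
    (H0lip : ∃ C : ℝ, ∀ t ∈ Icc (0 : ℝ) T, ∀ x x' : Euc k,
      (∀ i, |b t x i - b t x' i| ≤ C * ‖x - x'‖) ∧
      (∀ i l, |σm t x i l - σm t x' i l| ≤ C * ‖x - x'‖))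
    (H1cont : ∀ (i : Γ1) (j : Γ2), ∀ t ∈ Icc (0 : ℝ) T, ∀ x : Euc k, ∀ ε > (0 : ℝ),
      ∃ η > (0 : ℝ), ∀ t' ∈ Icc (0 : ℝ) T, ∀ x' : Euc k, |t' - t| + ‖x' - x‖ < η →
        ∀ (y : (Γ1 × Γ2) → ℝ) (z : Fin d → ℝ), |f i j t' x' y z - f i j t x y z| < ε)
    (H1growth : ∀ (i : Γ1) (j : Γ2), PolyGrowth T fun t x => f i j t x 0 0)
    (H1lip : ∃ C : ℝ, ∀ (i : Γ1) (j : Γ2) (t : ℝ) (x : Euc k)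
      (y y' : (Γ1 × Γ2) → ℝ) (z z' : Fin d → ℝ),
      |f i j t x y z - f i j t x y' z'| ≤ C * (‖y - y'‖ + ‖z - z'‖))
    (H2 : ∀ (i : Γ1) (j : Γ2) (kl : Γ1 × Γ2), kl ≠ (i, j) →
      ∀ (t : ℝ) (x : Euc k) (z : Fin d → ℝ) (y y' : (Γ1 × Γ2) → ℝ),
      (∀ ab, ab ≠ kl → y ab = y' ab) → y kl ≤ y' kl → f i j t x y z ≤ f i j t x y' z)
    (H4lnn : ∀ (i i' : Γ1), ∀ t ∈ Icc (0 : ℝ) T, ∀ x : Euc k, 0 ≤ gLow i i' t x)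
    (H4unn : ∀ (j j' : Γ2), ∀ t ∈ Icc (0 : ℝ) T, ∀ x : Euc k, 0 ≤ gUp j j' t x)
    (H4lcont : ∀ i i' : Γ1, Continuous fun p : ℝ × Euc k => gLow i i' p.1 p.2)
    (H4ucont : ∀ j j' : Γ2, Continuous fun p : ℝ × Euc k => gUp j j' p.1 p.2)
    (H4nfl : NoFreeLoop T gLow gUp) :
    ∃ S : Sys k d Γ1 Γ2, (∀ t, S.b t = b (clampReal T t)) ∧ (∀ t, S.σm t = σm (clampReal T t)) ∧
      (∀ i j t, S.f i j t = f i j (clampReal T t)) ∧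
      (∀ i i' t, S.gL i i' t = gLow i i' (clampReal T t)) ∧
      ∀ j j' t, S.gU j j' t = gUp j j' (clampReal T t) := by
  have hτ : Continuous fun p : ℝ × Euc k => (clampReal T p.1, p.2) :=
    ((continuous_clampReal T).comp continuous_fst).prodMk continuous_snd
  have hm := clampReal_mem hT
  obtain ⟨C, hC⟩ := H0lip
  have hCC : ∀ (x x' : Euc k), C * ‖x - x'‖ ≤ max C 0 * ‖x - x'‖ := fun x x' =>
    mul_le_mul_of_nonneg_right (le_max_left _ _) (norm_nonneg _)
  obtain ⟨M₁, hM₁, hb⟩ := exists_linear_growth H0b fun t ht x x' => (hC t ht x x').1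
  obtain ⟨M₂, hM₂, hs⟩ := exists_linear_growth (g := fun t x (q : Fin k × Fin d) => σm t x q.1 q.2)
    (continuous_pi fun q => H0s.matrix_elem q.1 q.2) fun t ht x x' q => (hC t ht x x').2 q.1 q.2
  obtain ⟨A, m, hA, hf⟩ := exists_uniform_weight (ι := Γ1 × Γ2) (s := Icc (0 : ℝ) T ×ˢ univ)
    (fun z : ℝ × Euc k => z.2) (g := fun q z => f q.1 q.2 z.1 z.2 0 0) (fun q => by
      obtain ⟨C, γ, h1, h2, h3⟩ := H1growth q.1 q.2
      exact ⟨C, γ, h1, h2, fun z hz => h3 z.1 hz.1 z.2⟩)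
  obtain ⟨K, hK⟩ := H1lip
  refine ⟨{
    b := fun t => b (clampReal T t)
    σm := fun t => σm (clampReal T t)
    f := fun i j t => f i j (clampReal T t)
    gL := fun i i' t => gLow i i' (clampReal T t)
    gU := fun j j' t => gUp j j' (clampReal T t)
    b_cont := H0b.comp hτ
    σ_cont := H0s.comp hτ
    lip := ⟨max C 0, le_max_right _ _, fun t x x' =>
      ⟨fun i => ((hC _ (hm t) x x').1 i).trans (hCC x x'),
        fun i l => ((hC _ (hm t) x x').2 i l).trans (hCC x x')⟩⟩
    growth := ⟨M₁ + M₂, by positivity, fun t x =>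
      ⟨fun i => (hb _ (hm t) x i).trans
        (mul_le_mul_of_nonneg_right (by linarith) (by positivity)),
        fun i l => (hs _ (hm t) x (i, l)).trans
          (mul_le_mul_of_nonneg_right (by linarith) (by positivity))⟩⟩
    f_cont := ?_
    f_growth := ⟨A, m, hA, fun i j t x => hf (i, j) (clampReal T t, x) ⟨hm t, mem_univ _⟩⟩
    f_lip := ⟨max K 0, le_max_right _ _, fun i j t x y y' z z' => (hK i j _ x y y' z z').trans
      (mul_le_mul_of_nonneg_right (le_max_left _ _) (by positivity))⟩
    f_mono := fun i j t x y y' z hy h0 => monotone_of_coordinatewise (i₀ := (i, j))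
      (g := fun y => f i j (clampReal T t) x y z)
      (fun kl hkl y y' h1 h2 => H2 i j kl hkl _ x z y y' h1 h2) hy h0
    gL_nonneg := fun i i' t x => H4lnn i i' _ (hm t) x
    gU_nonneg := fun j j' t x => H4unn j j' _ (hm t) x
    gL_cont := fun i i' => (H4lcont i i').comp hτ
    gU_cont := fun j j' => (H4ucont j j').comp hτ
    nfl := fun M hM p h0 h1 h2 t x => H4nfl M hM p h0 h1 h2 _ (hm t) x },
    fun _ => rfl, fun _ => rfl, fun _ _ _ => rfl, fun _ _ _ => rfl, fun _ _ _ => rfl⟩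
  intro i j t x ε hε
  obtain ⟨η, hη, h⟩ := H1cont i j _ (hm t) x ε hε
  obtain ⟨ρ, hρ, h'⟩ := Metric.continuous_iff.1 (continuous_clampReal T) t (η / 2) (half_pos hη)
  refine ⟨min ρ (η / 2), lt_min hρ (half_pos hη), fun t' x' hd y z => h _ (hm t') x' ?_ y z⟩
  rw [Prod.dist_eq, max_lt_iff] at hd
  have h1 := h' t' (hd.1.trans_le (min_le_left _ _))
  have h2 := hd.2.trans_le (min_le_right _ _)
  rw [Real.dist_eq] at h1
  rw [dist_eq_norm] at h2
  linarith

variable [Nontrivial Γ1] [Nontrivial Γ2]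

theorem Sys.F_eq_of_clamped (S : Sys k d Γ1 Γ2) {T : ℝ}
    {b : ℝ → Euc k → Fin k → ℝ} {σm : ℝ → Euc k → Matrix (Fin k) (Fin d) ℝ}
    {f : Γ1 → Γ2 → ℝ → Euc k → ((Γ1 × Γ2) → ℝ) → (Fin d → ℝ) → ℝ}
    {gLow : Γ1 → Γ1 → ℝ → Euc k → ℝ} {gUp : Γ2 → Γ2 → ℝ → Euc k → ℝ}
    (hSb : ∀ t, S.b t = b (clampReal T t)) (hSs : ∀ t, S.σm t = σm (clampReal T t))
    (hSf : ∀ i j t, S.f i j t = f i j (clampReal T t))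
    (hSl : ∀ i i' t, S.gL i i' t = gLow i i' (clampReal T t))
    (hSu : ∀ j j' t, S.gU j j' t = gUp j j' (clampReal T t))
    (p : Γ1 × Γ2) {t : ℝ} (ht : t ∈ Ioo 0 T) (x : Euc k) (y : Γ1 × Γ2 → ℝ) (φ : ℝ → Euc k → ℝ) :
    S.F p (t, x) y (parab S.b S.σm φ (t, x)) (sigGrad S.σm φ t x) =
      FmaxMin f gLow gUp p t x y (timeDeriv φ t x) (genL b σm φ t x) (sigGrad σm φ t x) := by
  have hc := clampReal_of_mem (Ioo_subset_Icc_self ht)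
  have h1 : S.b t = b t := by rw [hSb, hc]
  have h2 : S.σm t = σm t := by rw [hSs, hc]
  have h3 : ∀ i j, S.f i j t = f i j t := fun i j => by rw [hSf, hc]
  have h4 : ∀ i i', S.gL i i' t = gLow i i' t := fun i i' => by rw [hSl, hc]
  have h5 : ∀ j j', S.gU j j' t = gUp j j' t := fun j j' => by rw [hSu, hc]
  have h6 : genL S.b S.σm φ t x = genL b σm φ t x := by simp only [genL, h1, h2]
  have h7 : sigGrad S.σm φ t x = sigGrad σm φ t x := by
    funext l; simp only [sigGrad, h2]
  have h8 : lowerObst S.gL p.1 p.2 t x y = lowerObst gLow p.1 p.2 t x y := by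
    simp only [lowerObst, h4]
  have h9 : upperObst S.gU p.1 p.2 t x y = upperObst gUp p.1 p.2 t x y := by
    simp only [upperObst, h5]
  simp only [Sys.F, FmaxMin, parab, h3, h6, h7, h8, h9, neg_zero, neg_add,
    sub_eq_add_neg, zero_add]

theorem subOn_of_isViscSubsolSys (S : Sys k d Γ1 Γ2) {T : ℝ}
    {b : ℝ → Euc k → Fin k → ℝ} {σm : ℝ → Euc k → Matrix (Fin k) (Fin d) ℝ}
    {G : Γ1 × Γ2 → ℝ → Euc k → ((Γ1 × Γ2) → ℝ) → ℝ → ℝ → (Fin d → ℝ) → ℝ}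
    (hF : ∀ (p : Γ1 × Γ2) (t : ℝ), t ∈ Ioo 0 T → ∀ (x : Euc k) (y : Γ1 × Γ2 → ℝ)
      (φ : ℝ → Euc k → ℝ), S.F p (t, x) y (parab S.b S.σm φ (t, x)) (sigGrad S.σm φ t x) =
      G p t x y (timeDeriv φ t x) (genL b σm φ t x) (sigGrad σm φ t x))
    {g : Γ1 × Γ2 → Euc k → ℝ} {v : Γ1 × Γ2 → ℝ → Euc k → ℝ}
    (hv : IsViscSubsolSys T b σm g G v) :
    SubOn S.b S.σm S.F 0 T fun p z => v p z.1 z.2 := by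
  rintro p ⟨t, x⟩ ht φ hφ hmax
  set c := v p t x - φ t x with hc
  have hφc : IsC12 fun t x => φ t x + c := hφ.add (IsC12.const c)
  have h := hv.2 p t x ht _ hφc (by
    filter_upwards [hmax] with w hw
    have hw' : v p w.1 w.2 - φ w.1 w.2 ≤ v p t x - φ t x := hw
    show v p w.1 w.2 - (φ w.1 w.2 + c) ≤ v p t x - (φ t x + c)
    linarith) (by simp [hc])
  rw [← hF p t ht] at h
  rwa [parab_add S.b S.σm hφ (IsC12.const c), parab_const, add_zero,
    sigGrad_add S.σm hφ (IsC12.const c), sigGrad_const, add_zero] at h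

theorem superOn_of_isViscSupersolSys (S : Sys k d Γ1 Γ2) {T : ℝ}
    {b : ℝ → Euc k → Fin k → ℝ} {σm : ℝ → Euc k → Matrix (Fin k) (Fin d) ℝ}
    {G : Γ1 × Γ2 → ℝ → Euc k → ((Γ1 × Γ2) → ℝ) → ℝ → ℝ → (Fin d → ℝ) → ℝ}
    (hF : ∀ (p : Γ1 × Γ2) (t : ℝ), t ∈ Ioo 0 T → ∀ (x : Euc k) (y : Γ1 × Γ2 → ℝ)
      (φ : ℝ → Euc k → ℝ), S.F p (t, x) y (parab S.b S.σm φ (t, x)) (sigGrad S.σm φ t x) =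
      G p t x y (timeDeriv φ t x) (genL b σm φ t x) (sigGrad σm φ t x))
    {g : Γ1 × Γ2 → Euc k → ℝ} {v : Γ1 × Γ2 → ℝ → Euc k → ℝ}
    (hv : IsViscSupersolSys T b σm g G v) :
    SuperOn S.b S.σm S.F 0 T fun p z => v p z.1 z.2 := by
  rintro p ⟨t, x⟩ ht φ hφ hmin
  set c := v p t x - φ t x with hc
  have hφc : IsC12 fun t x => φ t x + c := hφ.add (IsC12.const c)
  have h := hv.2 p t x ht _ hφc (by
    filter_upwards [hmin] with w hw
    have hw' : v p t x - φ t x ≤ v p w.1 w.2 - φ w.1 w.2 := hw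
    show v p t x - (φ t x + c) ≤ v p w.1 w.2 - (φ w.1 w.2 + c)
    linarith) (by simp [hc])
  rw [← hF p t ht] at h
  rwa [parab_add S.b S.σm hφ (IsC12.const c), parab_const, add_zero,
    sigGrad_add S.σm hφ (IsC12.const c), sigGrad_const, add_zero] at h

end Reduction

/-- **Existence and uniqueness for the max-min system** (Theorem 2.1, system (1.2)):
under (H0)-(H4) there exists a unique family of continuous functions of polynomial
growth on `[0,T] × ℝ^k` which is a viscosity solution of the system of PDEs with
bilateral inter-connected obstacles of max-min type, with terminal data `h^{ij}`. -/
theorem maxmin_system_existence_uniqueness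
    {k d : ℕ} (hk : 1 ≤ k) (hd : 1 ≤ d) {Γ1 Γ2 : Type}
    [Fintype Γ1] [Fintype Γ2] [DecidableEq Γ1] [DecidableEq Γ2]
    [Nontrivial Γ1] [Nontrivial Γ2]
    (T : ℝ) (hT : 0 < T)
    (b : ℝ → Euc k → Fin k → ℝ) (σm : ℝ → Euc k → Matrix (Fin k) (Fin d) ℝ)
    (f : Γ1 → Γ2 → ℝ → Euc k → ((Γ1 × Γ2) → ℝ) → (Fin d → ℝ) → ℝ)
    (hfun : Γ1 → Γ2 → Euc k → ℝ)
    (gLow : Γ1 → Γ1 → ℝ → Euc k → ℝ) (gUp : Γ2 → Γ2 → ℝ → Euc k → ℝ)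
    -- (H0): `b`, `σ` jointly continuous, Lipschitz in `x` uniformly in `t`
    (H0b : Continuous fun p : ℝ × Euc k => b p.1 p.2)
    (H0s : Continuous fun p : ℝ × Euc k => σm p.1 p.2)
    (H0lip : ∃ C : ℝ, ∀ t ∈ Icc (0 : ℝ) T, ∀ x x' : Euc k,
      (∀ i, |b t x i - b t x' i| ≤ C * ‖x - x'‖) ∧
      (∀ i l, |σm t x i l - σm t x' i l| ≤ C * ‖x - x'‖))
    -- (H1)(i): each `f^{ij}` is continuous in `(t,x)` uniformly w.r.t. `(y,z)`,
    -- and `(t,x) ↦ f^{ij}(t,x,0,0)` is of polynomial growth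
    (H1cont : ∀ (i : Γ1) (j : Γ2), ∀ t ∈ Icc (0 : ℝ) T, ∀ x : Euc k, ∀ ε > (0 : ℝ),
      ∃ η > (0 : ℝ), ∀ t' ∈ Icc (0 : ℝ) T, ∀ x' : Euc k, |t' - t| + ‖x' - x‖ < η →
        ∀ (y : (Γ1 × Γ2) → ℝ) (z : Fin d → ℝ), |f i j t' x' y z - f i j t x y z| < ε)
    (H1growth : ∀ (i : Γ1) (j : Γ2), PolyGrowth T fun t x => f i j t x 0 0)
    -- (H1)(ii): Lipschitz continuity in `(\vec y, z)` uniformly in `(t,x)`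
    (H1lip : ∃ C : ℝ, ∀ (i : Γ1) (j : Γ2) (t : ℝ) (x : Euc k)
      (y y' : (Γ1 × Γ2) → ℝ) (z z' : Fin d → ℝ),
      |f i j t x y z - f i j t x y' z'| ≤ C * (‖y - y'‖ + ‖z - z'‖))
    -- (H2): monotonicity: `f^{ij}` is nondecreasing in `y^{kl}` for `(k,l) ≠ (i,j)`
    (H2 : ∀ (i : Γ1) (j : Γ2) (kl : Γ1 × Γ2), kl ≠ (i, j) →
      ∀ (t : ℝ) (x : Euc k) (z : Fin d → ℝ) (y y' : (Γ1 × Γ2) → ℝ),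
      (∀ ab, ab ≠ kl → y ab = y' ab) → y kl ≤ y' kl → f i j t x y z ≤ f i j t x y' z)
    -- (H3): the terminal data are continuous, of polynomial growth and consistent
    (H3cont : ∀ (i : Γ1) (j : Γ2), Continuous (hfun i j))
    (H3growth : ∀ (i : Γ1) (j : Γ2), ∃ C γ : ℝ, 0 ≤ C ∧ 0 ≤ γ ∧
      ∀ x : Euc k, |hfun i j x| ≤ C * (1 + ‖x‖ ^ γ))
    (H3consist : ∀ (i : Γ1) (j : Γ2) (x : Euc k),
      (∀ kk, kk ≠ i → hfun kk j x - gLow i kk T x ≤ hfun i j x) ∧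
      (∀ l, l ≠ j → hfun i j x ≤ hfun i l x + gUp j l T x))
    -- (H4): switching costs: nonnegative, jointly continuous, polynomial growth,
    -- vanishing on the diagonal, and the non-free-loop property
    (H4lnn : ∀ (i i' : Γ1), ∀ t ∈ Icc (0 : ℝ) T, ∀ x : Euc k, 0 ≤ gLow i i' t x)
    (H4unn : ∀ (j j' : Γ2), ∀ t ∈ Icc (0 : ℝ) T, ∀ x : Euc k, 0 ≤ gUp j j' t x)
    (H4lcont : ∀ i i' : Γ1, Continuous fun p : ℝ × Euc k => gLow i i' p.1 p.2)
    (H4ucont : ∀ j j' : Γ2, Continuous fun p : ℝ × Euc k => gUp j j' p.1 p.2)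
    (H4lgrowth : ∀ i i' : Γ1, PolyGrowth T (gLow i i'))
    (H4ugrowth : ∀ j j' : Γ2, PolyGrowth T (gUp j j'))
    (H4lzero : ∀ (i : Γ1) (t : ℝ) (x : Euc k), gLow i i t x = 0)
    (H4uzero : ∀ (j : Γ2) (t : ℝ) (x : Euc k), gUp j j t x = 0)
    (H4nfl : NoFreeLoop T gLow gUp)
    :
    (∃ v : Γ1 × Γ2 → ℝ → Euc k → ℝ,
      (∀ ij, Continuous fun p : ℝ × Euc k => v ij p.1 p.2) ∧
      (∀ ij, PolyGrowth T (v ij)) ∧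
      IsViscSolSys T b σm (fun ij => hfun ij.1 ij.2) (FmaxMin f gLow gUp) v) ∧
    ∀ v v' : Γ1 × Γ2 → ℝ → Euc k → ℝ,
      ((∀ ij, Continuous fun p : ℝ × Euc k => v ij p.1 p.2) ∧
        (∀ ij, PolyGrowth T (v ij)) ∧
        IsViscSolSys T b σm (fun ij => hfun ij.1 ij.2) (FmaxMin f gLow gUp) v) →
      ((∀ ij, Continuous fun p : ℝ × Euc k => v' ij p.1 p.2) ∧
        (∀ ij, PolyGrowth T (v' ij)) ∧
        IsViscSolSys T b σm (fun ij => hfun ij.1 ij.2) (FmaxMin f gLow gUp) v') →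
      ∀ ij : Γ1 × Γ2, ∀ t ∈ Icc (0 : ℝ) T, ∀ x : Euc k, v ij t x = v' ij t x := by
  obtain ⟨S, hSb, hSs, hSf, hSl, hSu⟩ := exists_clamped_sys hT.le H0b H0s H0lip H1cont H1growth
    H1lip H2 H4lnn H4unn H4lcont H4ucont H4nfl
  have hF : ∀ (p : Γ1 × Γ2) (t : ℝ), t ∈ Ioo 0 T → ∀ (x : Euc k) (y : Γ1 × Γ2 → ℝ)
      (φ : ℝ → Euc k → ℝ), S.F p (t, x) y (parab S.b S.σm φ (t, x)) (sigGrad S.σm φ t x) =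
      FmaxMin f gLow gUp p t x y (timeDeriv φ t x) (genL b σm φ t x) (sigGrad σm φ t x) :=
    fun p t ht x y φ => S.F_eq_of_clamped hSb hSs hSf hSl hSu p ht x y φ
  have hTT : clampReal T T = T := clampReal_of_mem ⟨hT.le, le_rfl⟩
  have H : S.Terminal T fun ij => hfun ij.1 ij.2 :=
    { cont := fun p => H3cont p.1 p.2
      growth := by
        obtain ⟨C, m, hC, h⟩ := exists_uniform_weight (ι := Γ1 × Γ2) (s := univ)
          (fun x : Euc k => x) (g := fun p => hfun p.1 p.2) (fun p => by
            obtain ⟨C, γ, h1, h2, h3⟩ := H3growth p.1 p.2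
            exact ⟨C, γ, h1, h2, fun x _ => h3 x⟩)
        exact ⟨C, m, hC, fun p x => h p x (mem_univ x)⟩
      lower := fun p x i hi => by
        rw [hSl, hTT]; exact (H3consist p.1 p.2 x).1 i hi
      upper := fun p x l hl => by
        rw [hSu, hTT]; exact (H3consist p.1 p.2 x).2 l hl }
  constructor
  · obtain ⟨v, hvc, hsub, hsup, hvT, B, n, hB, hvB⟩ := H.exists_solution hT
    refine ⟨fun ij t x => v ij (t, x), hvc, fun ij => polyGrowth_of_weight hB fun t x =>
      hvB ij (t, x), ⟨fun ij x => (hvT ij x).le, fun ij t x ht φ hφ hmax _ => ?_⟩,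
      fun ij x => (hvT ij x).ge, fun ij t x ht φ hφ hmin _ => ?_⟩
    · rw [← hF ij t ht]
      exact hsub ij (t, x) ht φ hφ hmax
    · rw [← hF ij t ht]
      exact hsup ij (t, x) ht φ hφ hmin
  · have key : ∀ v v' : Γ1 × Γ2 → ℝ → Euc k → ℝ,
        ((∀ ij, Continuous fun p : ℝ × Euc k => v ij p.1 p.2) ∧ (∀ ij, PolyGrowth T (v ij)) ∧
          IsViscSolSys T b σm (fun ij => hfun ij.1 ij.2) (FmaxMin f gLow gUp) v) →
        ((∀ ij, Continuous fun p : ℝ × Euc k => v' ij p.1 p.2) ∧ (∀ ij, PolyGrowth T (v' ij)) ∧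
          IsViscSolSys T b σm (fun ij => hfun ij.1 ij.2) (FmaxMin f gLow gUp) v') →
        ∀ ij : Γ1 × Γ2, ∀ t ∈ Icc (0 : ℝ) T, ∀ x : Euc k, v ij t x ≤ v' ij t x := by
      rintro v v' ⟨hc, hg, hsol⟩ ⟨hc', hg', hsol'⟩ ij t ht x
      have hweight : ∀ w : Γ1 × Γ2 → ℝ → Euc k → ℝ, (∀ ij, PolyGrowth T (w ij)) →
          ∃ (C : ℝ) (m : ℕ), 0 ≤ C ∧ ∀ p, ∀ z ∈ Icc (0 : ℝ) T ×ˢ univ,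
            |w p z.1 z.2| ≤ C * (1 + ‖z.2‖ ^ 2) ^ m := fun w hw =>
        exists_uniform_weight (fun z : ℝ × Euc k => z.2) (g := fun p z => w p z.1 z.2) fun p => by
          obtain ⟨C, γ, h1, h2, h3⟩ := hw p
          exact ⟨C, γ, h1, h2, fun z hz => h3 z.1 hz.1 z.2⟩
      obtain ⟨B, n, hB, hv⟩ := hweight v hg
      obtain ⟨B', n', hB', hv'⟩ := hweight v' hg'
      have hle : ∀ s ∈ Ioc 0 T, v ij s x ≤ v' ij s x := fun s hs =>
        S.comparison (a := 0) (T := T) (B := B + B') (n := n + n')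
          (fun p => (hc p).upperSemicontinuous) (fun p => (hc' p).lowerSemicontinuous)
          (subOn_of_isViscSubsolSys S hF hsol.1) (superOn_of_isViscSupersolSys S hF hsol'.2)
          (fun p z hz => ((le_abs_self _).trans (hv p z ⟨hz, mem_univ _⟩)).trans
            (mul_weight_le z.2 hB (by linarith) (by omega)))
          (fun p z hz => ((neg_le_abs _).trans (hv' p z ⟨hz, mem_univ _⟩)).trans
            (mul_weight_le z.2 hB' (by linarith) (by omega)))
          (fun p x => (hsol.1.1 p x).trans (hsol'.2.1 p x)) ij (s, x) hs
      rcases ht.1.eq_or_lt with h0 | h0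
      · subst h0
        have hx : Continuous fun s : ℝ => ((s, x) : ℝ × Euc k) := by fun_prop
        exact le_of_forall_gt_of_continuous ((hc ij).comp hx) ((hc' ij).comp hx) hT
          fun s hs => hle s ⟨hs.1, hs.2.le⟩
      · exact hle t ⟨h0, ht.2⟩
    exact fun v v' hv hv' ij t ht x => le_antisymm (key v v' hv hv' ij t ht x)
      (key v' v hv' hv ij t ht x)


end
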